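/- arXiv:0811.2591 — 2 statements merged into one kernel-verified Lean document; each statement's English description precedes it below -/
import Mathlib

section
/- Let κ > 0 and E ∈ [−2+κ, 2−κ], and let B be an N×N hermitian Wigner matrix satisfying condition C1, with eigenvalues λ_α and orthonormal eigenvectors v_α. Let b ∈ ℂ^N have i.i.d. components, independent of B, satisfying condition C1, set ξ_α = |b·v_α|², z = E + iη, and X = N^{-1} Σ_α (ξ_α − 1)/(λ_α − z). Then there exists a constant c > 0 (depending on κ) such that for every δ > 0, P(|X| ≥ δ) ≤ 5 e^{−c min{ δ√(Nη), δ²Nη }}, provided Nη ≥ (log N)² and N is sufficiently large (independently of δ). -/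
open MeasureTheory ProbabilityTheory
open scoped ENNReal NNReal

noncomputable section

/-- The density of the Wigner semicircle law. -/
def rhoSC (x : ℝ) : ℝ := if |x| ≤ 2 then Real.sqrt (4 - x ^ 2) / (2 * Real.pi) else 0

/-- The Stieltjes transform of the Wigner semicircle law. -/
def mSC (z : ℂ) : ℂ := ∫ x : ℝ, (rhoSC x : ℂ) / ((x : ℂ) - z)

/-- The Stieltjes transform of the empirical eigenvalue distribution of a matrix:
`m(z) = N⁻¹ Tr (H - z)⁻¹`. -/
def stTrans {N : ℕ} (A : Matrix (Fin N) (Fin N) ℂ) (z : ℂ) : ℂ :=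
  (Matrix.trace (A - z • (1 : Matrix (Fin N) (Fin N) ℂ))⁻¹) / (N : ℂ)

open scoped Classical in
/-- The number of eigenvalues (with multiplicity) of a Hermitian matrix lying in a set `I`. -/
def eigCount {N : ℕ} {A : Matrix (Fin N) (Fin N) ℂ} (hA : A.IsHermitian) (I : Set ℝ) : ℕ :=
  (Finset.univ.filter fun i => hA.eigenvalues i ∈ I).card

/-- `ν` has a strictly positive density `h` on `ℝ² ≃ ℂ` which is either a product of two copies
of a one-variable function or radially symmetric. -/
def WignerDensityOf (ν : Measure ℂ) (h : ℝ → ℝ → ℝ) : Prop :=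
  (∀ x y, 0 < h x y) ∧
  ν = (volume : Measure ℂ).withDensity (fun z => ENNReal.ofReal (h z.re z.im)) ∧
  ((∃ hs : ℝ → ℝ, ∀ x y, h x y = hs x * hs y) ∨
   (∃ hs : ℝ → ℝ, ∀ x y, h x y = hs (x ^ 2 + y ^ 2)))

/-- Condition C1, with explicit constants: Gaussian moments of the off-diagonal law `ν`
and of the diagonal law `ν'` are bounded by `D` resp. `D'`. -/
def CondC1 (ν : Measure ℂ) (ν' : Measure ℝ) (δ₀ D D' : ℝ) : Prop :=
  0 < δ₀ ∧
  (∫⁻ z, ENNReal.ofReal (Real.exp (δ₀ * ‖z‖ ^ 2)) ∂ν) ≤ ENNReal.ofReal D ∧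
  (∫⁻ x, ENNReal.ofReal (Real.exp (δ₀ * x ^ 2)) ∂ν') ≤ ENNReal.ofReal D'

/-- `H` is an `N × N` hermitian Wigner ensemble on the probability space `(Ω, P)`:
the entries above the diagonal are i.i.d. with law `N^{-1/2} ν` where `ν` has mean zero,
variance one and a density as in `WignerDensityOf`; the diagonal entries are real i.i.d.
with law `N^{-1/2} ν'`, `ν'` of mean zero; and all these entries are independent. -/
structure IsWignerMatrix {Ω : Type} [MeasurableSpace Ω] (P : Measure Ω) (N : ℕ)
    (H : Ω → Matrix (Fin N) (Fin N) ℂ) (ν : Measure ℂ) (ν' : Measure ℝ) : Prop where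
  herm : ∀ ω, (H ω).IsHermitian
  prob : IsProbabilityMeasure P
  probν : IsProbabilityMeasure ν
  probν' : IsProbabilityMeasure ν'
  density : ∃ h, WignerDensityOf ν h
  mean : (∫ z, z ∂ν) = 0
  var : (∫ z, ‖z‖ ^ 2 ∂ν) = 1
  mean' : (∫ x, x ∂ν') = 0
  offdiag : ∀ i j : Fin N, i < j →
    P.map (fun ω => (Real.sqrt N : ℂ) * H ω i j) = ν
  diag : ∀ i : Fin N, P.map (fun ω => Real.sqrt N * (H ω i i).re) = ν'
  diag_real : ∀ ω i, (H ω i i).im = 0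
  indep : iIndepFun
    (fun (p : {p : Fin N × Fin N // p.1 ≤ p.2}) (ω : Ω) => H ω p.1.1 p.1.2) P
/-- The Fourier transform on `ℝ²` of a real function of two variables. -/
def fourier2 (f : ℝ → ℝ → ℝ) (t s : ℝ) : ℂ :=
  ∫ x : ℝ, ∫ y : ℝ, Complex.exp (-Complex.I * (t * x + s * y)) * (f x y : ℂ)

/-- The Laplacian of a function of two real variables. -/
def laplacian2 (g : ℝ → ℝ → ℝ) (x y : ℝ) : ℝ :=
  deriv (deriv (fun t => g t y)) x + deriv (deriv (fun t => g x t)) y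

/-- Condition C2 with exponent `a` and constants `w`, `w'`: decay of the Fourier transforms
of the density `h` and of `h · Δ(-log h)`. -/
def CondC2 (h : ℝ → ℝ → ℝ) (a : ℕ) (w w' : ℝ) : Prop :=
  0 < w ∧ 0 < w' ∧
  (∀ t s : ℝ, ‖fourier2 h t s‖ ≤ 1 / (1 + w * (t ^ 2 + s ^ 2)) ^ a) ∧
  (∀ t s : ℝ, ‖fourier2
      (fun x y => h x y * laplacian2 (fun u v => -Real.log (h u v)) x y) t s‖
    ≤ 1 / (1 + w' * (t ^ 2 + s ^ 2)) ^ a)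

/-- Either the real and imaginary parts under `ν` are i.i.d., or `ν` is rotationally
symmetric. -/
def ComplexSymm (ν : Measure ℂ) : Prop :=
  (∃ μ₀ : Measure ℝ,
    ν = Measure.map (fun p : ℝ × ℝ => (p.1 : ℂ) + p.2 * Complex.I) (μ₀.prod μ₀)) ∨
  (∀ θ : ℝ, Measure.map (fun z => Complex.exp (θ * Complex.I) * z) ν = ν)

/-- exponential in `ℝ≥0∞` -/
def ee (x : ℝ) : ℝ≥0∞ := ENNReal.ofReal (Real.exp x)

lemma ee_add (x y : ℝ) : ee (x + y) = ee x * ee y := by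
  simp [ee, Real.exp_add, ENNReal.ofReal_mul (Real.exp_pos x).le]

lemma ee_mono {x y : ℝ} (h : x ≤ y) : ee x ≤ ee y :=
  ENNReal.ofReal_le_ofReal (Real.exp_le_exp.2 h)

lemma ee_zero : ee 0 = 1 := by simp [ee]

lemma ee_sum {ι : Type*} (s : Finset ι) (f : ι → ℝ) : ee (∑ i ∈ s, f i) = ∏ i ∈ s, ee (f i) := by
  classical
  induction s using Finset.induction_on with
  | empty => simp [ee_zero]
  | insert a s ha ih => rw [Finset.sum_insert ha, Finset.prod_insert ha, ee_add, ih]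

lemma measurable_ee : Measurable ee := by
  unfold ee; fun_prop

@[fun_prop]
lemma measurable_ee_comp {α : Type*} [MeasurableSpace α] {f : α → ℝ} (hf : Measurable f) :
    Measurable (fun x => ee (f x)) := measurable_ee.comp hf

/-- sub-Gaussian centered law -/
structure SG (δ₀ D : ℝ) (μ : Measure ℂ) : Prop where
  prob : IsProbabilityMeasure μ
  mean : (∫ z, z ∂μ) = 0
  exp : (∫⁻ z, ee (δ₀ * ‖z‖ ^ 2) ∂μ) ≤ ENNReal.ofReal D

lemma SG.one_le {δ₀ D : ℝ} {μ : Measure ℂ} (hδ : 0 < δ₀) (h : SG δ₀ D μ) : 1 ≤ D := by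
  have := h.prob
  have h1 : (1 : ℝ≥0∞) ≤ ENNReal.ofReal D := by
    refine le_trans ?_ h.exp
    calc (1 : ℝ≥0∞) = ∫⁻ z, 1 ∂μ := by simp
      _ ≤ _ := by
        apply lintegral_mono
        intro z
        show 1 ≤ ee _
        rw [← ee_zero]; exact ee_mono (by positivity)
  simpa using h1

lemma SG.integrable {δ₀ D : ℝ} {μ : Measure ℂ} (h : SG δ₀ D μ) :
    Integrable (fun z => Real.exp (δ₀ * ‖z‖ ^ 2)) μ := by
  refine ⟨by fun_prop, ?_⟩
  rw [hasFiniteIntegral_iff_ofReal (Filter.Eventually.of_forall fun z => (Real.exp_pos _).le)]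
  exact lt_of_le_of_lt h.exp ENNReal.ofReal_lt_top

lemma SG.integral_le {δ₀ D : ℝ} {μ : Measure ℂ} (hδ : 0 < δ₀) (h : SG δ₀ D μ) :
    ∫ z, Real.exp (δ₀ * ‖z‖ ^ 2) ∂μ ≤ D := by
  have h1 := h.exp
  unfold ee at h1
  rw [← ofReal_integral_eq_lintegral_ofReal h.integrable
    (Filter.Eventually.of_forall fun z => (Real.exp_pos _).le)] at h1
  exact (ENNReal.ofReal_le_ofReal_iff (by linarith [h.one_le hδ])).1 h1

/-- Jensen -/
lemma SG.jensen {δ₀ D : ℝ} {μ : Measure ℂ} (hδ : 0 < δ₀) (h : SG δ₀ D μ) {a : ℝ} (ha : 0 ≤ a)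
    (ha' : a ≤ δ₀) : Integrable (fun z => Real.exp (a * ‖z‖ ^ 2)) μ ∧
    ∫ z, Real.exp (a * ‖z‖ ^ 2) ∂μ ≤ Real.exp (Real.log D / δ₀ * a) := by
  have := h.prob
  have hD := h.one_le hδ
  have hi : Integrable (fun z => Real.exp (a * ‖z‖ ^ 2)) μ := by
    refine h.integrable.mono' (by fun_prop) (Filter.Eventually.of_forall fun z => ?_)
    rw [Real.norm_eq_abs, abs_of_pos (Real.exp_pos _)]
    exact Real.exp_le_exp.2 (by gcongr)
  refine ⟨hi, ?_⟩
  set r := a / δ₀ with hr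
  have hr0 : 0 ≤ r := by positivity
  have hr1 : r ≤ 1 := by rw [hr, div_le_one hδ]; exact ha'
  set K := Real.exp (Real.log D / δ₀ * a)
  have key : ∀ z : ℂ, Real.exp (a * ‖z‖ ^ 2) ≤
      K * ((1 - r) + r * (Real.exp (δ₀ * ‖z‖ ^ 2) / D)) := by
    intro z
    have hc := convexOn_exp.2 (Set.mem_univ 0) (Set.mem_univ (δ₀ * ‖z‖ ^ 2 - Real.log D))
      (sub_nonneg.2 hr1) hr0 (by ring)
    simp only [smul_eq_mul, mul_zero, zero_add, Real.exp_zero, mul_one] at hc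
    rw [Real.exp_sub, Real.exp_log (by linarith)] at hc
    calc Real.exp (a * ‖z‖ ^ 2) = K * Real.exp (r * (δ₀ * ‖z‖ ^ 2 - Real.log D)) := by
          rw [← Real.exp_add]; congr 1; rw [hr]; field_simp; ring
      _ ≤ _ := by gcongr
  calc ∫ z, Real.exp (a * ‖z‖ ^ 2) ∂μ
      ≤ ∫ z, K * ((1 - r) + r * (Real.exp (δ₀ * ‖z‖ ^ 2) / D)) ∂μ := by
        apply integral_mono hi _ key
        have := h.integrable
        fun_prop
    _ = K * ((1 - r) + r * ((∫ z, Real.exp (δ₀ * ‖z‖ ^ 2) ∂μ) / D)) := by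
        rw [integral_const_mul, integral_add (by fun_prop)
          ((h.integrable.div_const D).const_mul r), integral_const_mul, integral_div]
        simp
    _ ≤ K * ((1 - r) + r * 1) := by
        gcongr
        rw [div_le_one (by linarith)]
        exact h.integral_le hδ
    _ = K := by ring

lemma exp_le_add_exp_sq (x : ℝ) : Real.exp x ≤ x + Real.exp (x ^ 2) := by
  by_cases h : |x| ≤ 1
  · have h1 := (abs_le.1 (Real.abs_exp_sub_one_sub_id_le h)).2
    have h2 := Real.add_one_le_exp (x ^ 2)
    linarith
  · rcases lt_abs.1 (not_le.1 h) with h | h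
    · have : Real.exp x ≤ Real.exp (x ^ 2) := Real.exp_le_exp.2 (by nlinarith)
      linarith
    · have h2 := Real.add_one_le_exp (x ^ 2)
      have h3 : Real.exp x ≤ 1 := Real.exp_le_one_iff.2 (by linarith)
      nlinarith

lemma exp_le_one_add_sq (x : ℝ) : Real.exp x ≤ 1 + x + x ^ 2 * Real.exp |x| := by
  have h0 : 1 ≤ Real.exp |x| := Real.one_le_exp (abs_nonneg x)
  by_cases h : |x| ≤ 1
  · have h1 := (abs_le.1 (Real.abs_exp_sub_one_sub_id_le h)).2
    nlinarith [sq_nonneg x]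
  · rcases lt_abs.1 (not_le.1 h) with h | h
    · rw [abs_of_pos (by linarith)]
      have h4 : 1 * Real.exp x ≤ x ^ 2 * Real.exp x := by gcongr; nlinarith
      linarith
    · have h3 : Real.exp x ≤ 1 := Real.exp_le_one_iff.2 (by linarith)
      nlinarith [sq_nonneg x]

lemma norm_le_exp {δ₀ : ℝ} (hδ : 0 < δ₀) (z : ℂ) :
    ‖z‖ ≤ (1 + 1 / δ₀) * Real.exp (δ₀ * ‖z‖ ^ 2) := by
  have h1 := Real.add_one_le_exp (δ₀ * ‖z‖ ^ 2)
  have h2 : ‖z‖ ≤ 1 + ‖z‖ ^ 2 := by nlinarith [norm_nonneg z, sq_nonneg (‖z‖ - 1)]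
  calc ‖z‖ ≤ 1 + ‖z‖ ^ 2 := h2
    _ ≤ (1 + 1 / δ₀) * (δ₀ * ‖z‖ ^ 2 + 1) := by
      have : (1 + 1 / δ₀) * (δ₀ * ‖z‖ ^ 2 + 1) = 1 + ‖z‖ ^ 2 + (δ₀ * ‖z‖ ^ 2 + 1 / δ₀) := by
        field_simp; ring
      rw [this]
      have : 0 ≤ δ₀ * ‖z‖ ^ 2 + 1 / δ₀ := by positivity
      linarith
    _ ≤ _ := by gcongr

lemma SG.integrable_id {δ₀ D : ℝ} {μ : Measure ℂ} (hδ : 0 < δ₀) (h : SG δ₀ D μ) :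
    Integrable (fun z : ℂ => z) μ := by
  refine (h.integrable.const_mul (1 + 1 / δ₀)).mono' (by fun_prop) (Filter.Eventually.of_forall fun z => ?_)
  exact norm_le_exp hδ z

lemma SG.mgf {δ₀ D : ℝ} {μ : Measure ℂ} (hδ : 0 < δ₀) (h : SG δ₀ D μ) (w : ℂ) :
    ∫⁻ z, ee (((starRingEnd ℂ) w * z).re) ∂μ ≤ ee ((Real.log D + 1) / δ₀ * ‖w‖ ^ 2) := by
  have := h.prob
  have hD := h.one_le hδ
  have hlD : 0 ≤ Real.log D := Real.log_nonneg hD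
  have habs : ∀ z : ℂ, |((starRingEnd ℂ) w * z).re| ≤ ‖w‖ * ‖z‖ := by
    intro z
    refine (Complex.abs_re_le_norm _).trans ?_
    simp
  by_cases hw : ‖w‖ ^ 2 ≤ δ₀
  · obtain ⟨hi, hj⟩ := h.jensen hδ (sq_nonneg ‖w‖) hw
    have hre : Integrable (fun z : ℂ => ((starRingEnd ℂ) w * z).re) μ :=
      ((h.integrable_id hδ).const_mul _).re
    have hre0 : ∫ z : ℂ, ((starRingEnd ℂ) w * z).re ∂μ = 0 := by
      have h1 := integral_re ((h.integrable_id hδ).const_mul ((starRingEnd ℂ) w))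
      simp only [RCLike.re_eq_complex_re] at h1
      rw [h1, integral_const_mul, h.mean]; simp
    have hb : ∀ z : ℂ, Real.exp (((starRingEnd ℂ) w * z).re) ≤
        ((starRingEnd ℂ) w * z).re + Real.exp (‖w‖ ^ 2 * ‖z‖ ^ 2) := by
      intro z
      refine (exp_le_add_exp_sq _).trans ?_
      gcongr
      rw [← mul_pow]
      exact sq_le_sq' (by linarith [abs_le.1 (habs z)]) (abs_le.1 (habs z)).2
    have hie : Integrable (fun z : ℂ => Real.exp (((starRingEnd ℂ) w * z).re)) μ := by
      refine (hre.add hi).mono' (by fun_prop) (Filter.Eventually.of_forall fun z => ?_)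
      rw [Real.norm_eq_abs, abs_of_pos (Real.exp_pos _)]
      exact hb z
    unfold ee
    rw [← ofReal_integral_eq_lintegral_ofReal hie
      (Filter.Eventually.of_forall fun z => (Real.exp_pos _).le)]
    apply ENNReal.ofReal_le_ofReal
    calc _ ≤ ∫ z : ℂ, (((starRingEnd ℂ) w * z).re + Real.exp (‖w‖ ^ 2 * ‖z‖ ^ 2)) ∂μ :=
          integral_mono hie (hre.add hi) hb
      _ = ∫ z : ℂ, Real.exp (‖w‖ ^ 2 * ‖z‖ ^ 2) ∂μ := by
          rw [integral_add hre hi, hre0, zero_add]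
      _ ≤ _ := hj
      _ ≤ _ := by gcongr; linarith
  · push Not at hw
    calc ∫⁻ z, ee (((starRingEnd ℂ) w * z).re) ∂μ
        ≤ ∫⁻ z, ee (‖w‖ ^ 2 / δ₀) * ee (δ₀ * ‖z‖ ^ 2) ∂μ := by
          apply lintegral_mono
          intro z
          show ee _ ≤ ee _ * ee _
          rw [← ee_add]
          apply ee_mono
          refine (le_abs_self _).trans ((habs z).trans ?_)
          have : ‖w‖ ^ 2 / δ₀ + δ₀ * ‖z‖ ^ 2 - ‖w‖ * ‖z‖ =
            (‖w‖ - δ₀ * ‖z‖ / 2) ^ 2 / δ₀ + 3 / 4 * (δ₀ * ‖z‖ ^ 2) := by field_simp; ring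
          have h2 : 0 ≤ (‖w‖ - δ₀ * ‖z‖ / 2) ^ 2 / δ₀ + 3 / 4 * (δ₀ * ‖z‖ ^ 2) := by positivity
          linarith
      _ = ee (‖w‖ ^ 2 / δ₀) * ∫⁻ z, ee (δ₀ * ‖z‖ ^ 2) ∂μ := by
          rw [lintegral_const_mul]
          exact measurable_ee.comp (by fun_prop)
      _ ≤ ee (‖w‖ ^ 2 / δ₀) * ee (Real.log D) := by
          gcongr
          refine h.exp.trans ?_
          rw [ee, Real.exp_log (by linarith)]
      _ ≤ _ := by
          rw [← ee_add]
          apply ee_mono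
          have : Real.log D * 1 ≤ Real.log D * (‖w‖ ^ 2 / δ₀) := by
            gcongr
            rw [le_div_iff₀ hδ]; linarith
          have e : (Real.log D + 1) / δ₀ * ‖w‖ ^ 2 = ‖w‖ ^ 2 / δ₀ + Real.log D * (‖w‖ ^ 2 / δ₀) := by
            ring
          rw [e]; linarith

lemma SG.var_le {δ₀ D : ℝ} {μ : Measure ℂ} (hδ : 0 < δ₀) (h : SG δ₀ D μ) :
    Integrable (fun z : ℂ => ‖z‖ ^ 2) μ ∧ δ₀ * ∫ z, ‖z‖ ^ 2 ∂μ ≤ D := by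
  have hb : ∀ z : ℂ, δ₀ * ‖z‖ ^ 2 ≤ Real.exp (δ₀ * ‖z‖ ^ 2) := fun z => by
    linarith [Real.add_one_le_exp (δ₀ * ‖z‖ ^ 2)]
  have hi : Integrable (fun z : ℂ => δ₀ * ‖z‖ ^ 2) μ := by
    refine h.integrable.mono' (by fun_prop) (Filter.Eventually.of_forall fun z => ?_)
    rw [Real.norm_eq_abs, abs_of_nonneg (by positivity)]
    exact hb z
  refine ⟨?_, ?_⟩
  · have := hi.const_mul (δ₀⁻¹)
    refine this.congr (Filter.Eventually.of_forall fun z => ?_)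
    show δ₀⁻¹ * (δ₀ * ‖z‖ ^ 2) = _
    field_simp
  · rw [← integral_const_mul]
    exact (integral_mono hi h.integrable hb).trans (h.integral_le hδ)

lemma SG.diag {δ₀ D : ℝ} {μ : Measure ℂ} (hδ : 0 < δ₀) (h : SG δ₀ D μ) (a : ℝ)
    (ha : |a| ≤ δ₀ / 2) :
    ∫⁻ z, ee (a * (‖z‖ ^ 2 - ∫ y, ‖y‖ ^ 2 ∂μ)) ∂μ ≤
      ee (8 / δ₀ ^ 2 * Real.exp D * D * a ^ 2) := by
  have := h.prob
  have hD := h.one_le hδ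
  obtain ⟨hv, hw⟩ := h.var_le hδ
  set w := ∫ y, ‖y‖ ^ 2 ∂μ with hwd
  have hw0 : 0 ≤ w := integral_nonneg fun z => by positivity
  have hb : ∀ z : ℂ, Real.exp (a * (‖z‖ ^ 2 - w)) ≤ (1 + a * (‖z‖ ^ 2 - w)) +
      a ^ 2 * (8 / δ₀ ^ 2 * Real.exp D) * Real.exp (δ₀ * ‖z‖ ^ 2) := by
    intro z
    refine (exp_le_one_add_sq _).trans ?_
    refine add_le_add le_rfl ?_
    set y := ‖z‖ ^ 2 - w with hy
    have h1 : y ^ 2 ≤ 8 / δ₀ ^ 2 * Real.exp (δ₀ / 2 * |y|) := by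
      have := Real.quadratic_le_exp_of_nonneg (x := δ₀ / 2 * |y|) (by positivity)
      have h3 : (δ₀ / 2 * |y|) ^ 2 = δ₀ ^ 2 / 4 * y ^ 2 := by rw [mul_pow, sq_abs]; ring
      rw [h3] at this
      have h4 : δ₀ ^ 2 / 8 * y ^ 2 ≤ Real.exp (δ₀ / 2 * |y|) := by
        have : 0 ≤ δ₀ / 2 * |y| := by positivity
        linarith
      calc y ^ 2 = 8 / δ₀ ^ 2 * (δ₀ ^ 2 / 8 * y ^ 2) := by field_simp
        _ ≤ _ := by gcongr
    have h2 : |a * y| ≤ δ₀ / 2 * |y| := by rw [abs_mul]; gcongr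
    have h3 : |y| ≤ ‖z‖ ^ 2 + w := by
      rw [hy, abs_le]; constructor <;> nlinarith [sq_nonneg ‖z‖]
    calc (a * y) ^ 2 * Real.exp |a * y| ≤
        (a ^ 2 * (8 / δ₀ ^ 2 * Real.exp (δ₀ / 2 * |y|))) * Real.exp (δ₀ / 2 * |y|) := by
          rw [mul_pow]; gcongr
      _ = a ^ 2 * (8 / δ₀ ^ 2) * Real.exp (δ₀ * |y|) := by
          have : Real.exp (δ₀ * |y|) = Real.exp (δ₀ / 2 * |y|) * Real.exp (δ₀ / 2 * |y|) := by
            rw [← Real.exp_add]; congr 1; ring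
          rw [this]; ring
      _ ≤ a ^ 2 * (8 / δ₀ ^ 2) * Real.exp (D + δ₀ * ‖z‖ ^ 2) := by
          gcongr
          nlinarith
      _ = _ := by rw [Real.exp_add]; ring
  have hi1 : Integrable (fun z : ℂ => 1 + a * (‖z‖ ^ 2 - w)) μ := by fun_prop
  have hi2 := (h.integrable).const_mul (a ^ 2 * (8 / δ₀ ^ 2 * Real.exp D))
  have hie : Integrable (fun z : ℂ => Real.exp (a * (‖z‖ ^ 2 - w))) μ := by
    refine (hi1.add hi2).mono' (by fun_prop) (Filter.Eventually.of_forall fun z => ?_)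
    rw [Real.norm_eq_abs, abs_of_pos (Real.exp_pos _)]
    exact hb z
  unfold ee
  rw [← ofReal_integral_eq_lintegral_ofReal hie
    (Filter.Eventually.of_forall fun z => (Real.exp_pos _).le)]
  apply ENNReal.ofReal_le_ofReal
  have e0 : ∫ z : ℂ, (1 + a * (‖z‖ ^ 2 - w)) ∂μ = 1 := by
    rw [integral_add (by fun_prop) (by fun_prop), integral_const_mul,
      integral_sub hv (by fun_prop)]
    simp [hwd]
  calc _ ≤ ∫ z : ℂ, ((1 + a * (‖z‖ ^ 2 - w)) +
      a ^ 2 * (8 / δ₀ ^ 2 * Real.exp D) * Real.exp (δ₀ * ‖z‖ ^ 2)) ∂μ :=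
        integral_mono hie (hi1.add hi2) hb
    _ = 1 + a ^ 2 * (8 / δ₀ ^ 2 * Real.exp D) * ∫ z, Real.exp (δ₀ * ‖z‖ ^ 2) ∂μ := by
        rw [integral_add hi1 hi2, integral_const_mul, e0]
    _ ≤ 1 + a ^ 2 * (8 / δ₀ ^ 2 * Real.exp D) * D := by
        gcongr; exact h.integral_le hδ
    _ ≤ _ := by
        have := Real.add_one_le_exp (8 / δ₀ ^ 2 * Real.exp D * D * a ^ 2)
        linarith

lemma lintegral_pi_prod {ι : Type*} [Fintype ι] (μ : ι → Measure ℂ)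
    [∀ i, IsProbabilityMeasure (μ i)] (f : ι → ℂ → ℝ≥0∞) (hf : ∀ i, Measurable (f i)) :
    ∫⁻ b, ∏ i, f i (b i) ∂(Measure.pi μ) = ∏ i, ∫⁻ z, f i z ∂(μ i) := by
  rw [lintegral_prod_eq_prod_lintegral_of_indepFun Finset.univ (fun i (b : ι → ℂ) => f i (b i))
    (iIndepFun_pi fun i => (hf i).aemeasurable) (fun i => (hf i).comp (measurable_pi_apply i))]
  refine Finset.prod_congr rfl fun i _ => ?_
  exact (measurePreserving_eval μ i).lintegral_comp (hf i)

lemma SG.pi_mgf {ι : Type*} [Fintype ι] {δ₀ D : ℝ} {μ : ι → Measure ℂ} (hδ : 0 < δ₀)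
    (h : ∀ i, SG δ₀ D (μ i)) (w : ι → ℂ) :
    ∫⁻ b, ee ((∑ i, (starRingEnd ℂ) (w i) * b i).re) ∂(Measure.pi μ) ≤
      ee ((Real.log D + 1) / δ₀ * ∑ i, ‖w i‖ ^ 2) := by
  have := fun i => (h i).prob
  simp_rw [Complex.re_sum, Finset.mul_sum, ee_sum]
  rw [lintegral_pi_prod μ (fun i z => ee ((starRingEnd ℂ (w i) * z).re))
    (fun i => measurable_ee.comp (by fun_prop))]
  exact Finset.prod_le_prod' fun i _ => (h i).mgf hδ (w i)

lemma SG.pi_diag {ι : Type*} [Fintype ι] {δ₀ D : ℝ} {μ : ι → Measure ℂ} (hδ : 0 < δ₀)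
    (h : ∀ i, SG δ₀ D (μ i)) (a : ι → ℝ) (ha : ∀ i, |a i| ≤ δ₀ / 2) :
    ∫⁻ b, ee (∑ i, a i * (‖b i‖ ^ 2 - ∫ y, ‖y‖ ^ 2 ∂(μ i))) ∂(Measure.pi μ) ≤
      ee (8 / δ₀ ^ 2 * Real.exp D * D * ∑ i, a i ^ 2) := by
  have := fun i => (h i).prob
  simp_rw [Finset.mul_sum, ee_sum]
  rw [lintegral_pi_prod μ (fun i z => ee (a i * (‖z‖ ^ 2 - ∫ y, ‖y‖ ^ 2 ∂(μ i))))
    (fun i => measurable_ee.comp (by fun_prop))]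
  exact Finset.prod_le_prod' fun i _ => (h i).diag hδ (a i) (ha i)

lemma SG.pi_exp {ι : Type*} [Fintype ι] {δ₀ D : ℝ} {μ : ι → Measure ℂ} (hδ : 0 < δ₀)
    (h : ∀ i, SG δ₀ D (μ i)) (a : ι → ℝ) (ha0 : ∀ i, 0 ≤ a i) (ha : ∀ i, a i ≤ δ₀) :
    ∫⁻ b, ee (∑ i, a i * ‖b i‖ ^ 2) ∂(Measure.pi μ) ≤
      ee (Real.log D / δ₀ * ∑ i, a i) := by
  have := fun i => (h i).prob
  simp_rw [Finset.mul_sum, ee_sum]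
  rw [lintegral_pi_prod μ (fun i z => ee (a i * ‖z‖ ^ 2))
    (fun i => measurable_ee.comp (by fun_prop))]
  refine Finset.prod_le_prod' fun i _ => ?_
  obtain ⟨h1, h2⟩ := (h i).jensen hδ (ha0 i) (ha i)
  unfold ee
  rw [← ofReal_integral_eq_lintegral_ofReal h1
    (Filter.Eventually.of_forall fun z => (Real.exp_pos _).le)]
  exact ENNReal.ofReal_le_ofReal h2

/-- standard complex Gaussian (real and imaginary parts of variance one) -/
def gC : Measure ℂ :=
  Measure.map (fun p : ℝ × ℝ => (p.1 : ℂ) + p.2 * Complex.I)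
    ((gaussianReal 0 1).prod (gaussianReal 0 1))

instance : IsProbabilityMeasure gC := by
  unfold gC
  exact Measure.isProbabilityMeasure_map (by fun_prop)

lemma lintegral_gauss (t : ℝ) : ∫⁻ x, ee (t * x) ∂(gaussianReal 0 1) = ee (t ^ 2 / 2) := by
  have h := congrFun (mgf_id_gaussianReal (μ := 0) (v := 1)) t
  simp only [mgf, id] at h
  unfold ee
  rw [← ofReal_integral_eq_lintegral_ofReal (integrable_exp_mul_gaussianReal t)
    (Filter.Eventually.of_forall fun z => (Real.exp_pos _).le), h]
  simp

lemma lintegral_gC (x : ℂ) : ∫⁻ g, ee (((starRingEnd ℂ) g * x).re) ∂gC = ee (‖x‖ ^ 2 / 2) := by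
  unfold gC
  rw [lintegral_map (by fun_prop) (by fun_prop)]
  have : ∀ p : ℝ × ℝ, ee (((starRingEnd ℂ) ((p.1 : ℂ) + p.2 * Complex.I) * x).re) =
      ee (x.re * p.1) * ee (x.im * p.2) := by
    intro p
    rw [← ee_add]; congr 1; simp; ring
  simp_rw [this]
  rw [lintegral_prod_mul (f := fun y : ℝ => ee (x.re * y)) (g := fun y : ℝ => ee (x.im * y))
    (measurable_ee.comp (by fun_prop)).aemeasurable
    (measurable_ee.comp (by fun_prop)).aemeasurable, lintegral_gauss, lintegral_gauss, ← ee_add]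
  congr 1
  rw [Complex.sq_norm, Complex.normSq_apply]; ring

lemma gC_SG : ∃ δ D : ℝ, 0 < δ ∧ SG δ D gC := by
  obtain ⟨C, hC, hi⟩ := IsGaussian.exists_integrable_exp_sq (gaussianReal 0 1)
  set D := ∫ x, Real.exp (C * ‖x‖ ^ 2) ∂(gaussianReal 0 1) with hD
  have hl : ∫⁻ x, ee (C * x ^ 2) ∂(gaussianReal 0 1) = ENNReal.ofReal D := by
    rw [hD, ofReal_integral_eq_lintegral_ofReal hi
      (Filter.Eventually.of_forall fun z => (Real.exp_pos _).le)]
    simp [ee]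
  refine ⟨C, D * D, hC, inferInstance, ?_, ?_⟩
  · unfold gC
    rw [integral_map (by fun_prop) (by fun_prop)]
    have hx : Integrable (fun x : ℝ => (x : ℂ)) (gaussianReal 0 1) := by
      have : Integrable (fun x : ℝ => x) (gaussianReal 0 1) :=
        (memLp_id_gaussianReal 1).integrable (by simp)
      exact this.ofReal
    have h0 : ∫ x : ℝ, (x : ℂ) ∂(gaussianReal 0 1) = 0 := by
      have := integral_ofReal (𝕜 := ℂ) (μ := gaussianReal 0 1) (f := fun x : ℝ => x)
      simp only [Complex.coe_algebraMap, RCLike.ofReal, integral_id_gaussianReal] at this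
      simpa using this
    rw [integral_add (hx.comp_fst _) ((hx.comp_snd _).mul_const _),
      integral_fun_fst (fun x : ℝ => (x : ℂ)), integral_mul_const,
      integral_fun_snd (fun x : ℝ => (x : ℂ)), h0]
    simp
  · unfold gC
    rw [lintegral_map (by fun_prop) (by fun_prop)]
    have : ∀ p : ℝ × ℝ, ee (C * ‖(p.1 : ℂ) + p.2 * Complex.I‖ ^ 2) =
      ee (C * p.1 ^ 2) * ee (C * p.2 ^ 2) := by
      intro p
      rw [← ee_add]; congr 1; rw [Complex.sq_norm, Complex.normSq_apply]; simp; ring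
    simp_rw [this]
    rw [lintegral_prod_mul (f := fun x : ℝ => ee (C * x ^ 2)) (g := fun x : ℝ => ee (C * x ^ 2))
      (measurable_ee.comp (by fun_prop)).aemeasurable
      (measurable_ee.comp (by fun_prop)).aemeasurable, hl]
    rw [ENNReal.ofReal_mul]
    exact integral_nonneg fun z => (Real.exp_pos _).le

/-- squared Euclidean norm -/
def nsq {n : Type*} [Fintype n] (v : n → ℂ) : ℝ := ∑ i, ‖v i‖ ^ 2

lemma nsq_nonneg {n : Type*} [Fintype n] (v : n → ℂ) : 0 ≤ nsq v :=
  Finset.sum_nonneg fun _ _ => by positivity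

lemma nsq_eq {n : Type*} [Fintype n] (v : n → ℂ) : ((nsq v : ℝ) : ℂ) = dotProduct (star v) v := by
  simp [nsq, dotProduct, ← Complex.conj_mul']

lemma nsq_mulVec {m n : Type*} [Fintype m] [Fintype n] (T : Matrix m n ℂ) (x : n → ℂ) :
    ((nsq (T.mulVec x) : ℝ) : ℂ) = dotProduct (star x) ((T.conjTranspose * T).mulVec x) := by
  rw [nsq_eq, Matrix.star_mulVec, ← Matrix.mulVec_mulVec, Matrix.dotProduct_mulVec (star x)]

lemma nsq_unitary {n : Type*} [Fintype n] [DecidableEq n] (U : Matrix n n ℂ)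
    (hU : U.conjTranspose * U = 1) (x : n → ℂ) : nsq (U.mulVec x) = nsq x := by
  have := nsq_mulVec U x
  rw [hU, Matrix.one_mulVec, ← nsq_eq] at this
  exact_mod_cast this

lemma spectral_aux {m n : Type*} [Fintype m] [Fintype n] [DecidableEq n] (T : Matrix m n ℂ) :
    ∃ (U : Matrix n n ℂ) (μ : n → ℝ), U.conjTranspose * U = 1 ∧
      (∀ x, nsq (T.mulVec x) = ∑ k, μ k * ‖(U.conjTranspose.mulVec x) k‖ ^ 2) ∧
      (∀ k, ∃ x, nsq x = 1 ∧ nsq (T.mulVec x) = μ k) ∧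
      ∑ k, μ k = ∑ i, ∑ j, ‖T i j‖ ^ 2 := by
  have hA : (T.conjTranspose * T).IsHermitian := Matrix.isHermitian_conjTranspose_mul_self T
  set U : Matrix n n ℂ := (hA.eigenvectorUnitary : Matrix n n ℂ) with hUd
  have hU1 : U.conjTranspose * U = 1 := by
    rw [← Matrix.star_eq_conjTranspose]
    exact (Matrix.mem_unitaryGroup_iff'.1 hA.eigenvectorUnitary.2)
  have hsp : T.conjTranspose * T =
      U * Matrix.diagonal (fun k => ((hA.eigenvalues k : ℝ) : ℂ)) * U.conjTranspose := by
    have := hA.spectral_theorem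
    rw [Unitary.conjStarAlgAut_apply] at this
    rw [← Matrix.star_eq_conjTranspose]
    exact this
  have h1 : ∀ x, nsq (T.mulVec x) =
      ∑ k, hA.eigenvalues k * ‖(U.conjTranspose.mulVec x) k‖ ^ 2 := by
    intro x
    have h2 := nsq_mulVec T x
    rw [hsp, ← Matrix.mulVec_mulVec, ← Matrix.mulVec_mulVec, Matrix.dotProduct_mulVec (star x),
      ← Matrix.conjTranspose_conjTranspose U, ← Matrix.star_mulVec,
      Matrix.conjTranspose_conjTranspose U] at h2
    have h3 : ((nsq (T.mulVec x) : ℝ) : ℂ) =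
        ((∑ k, hA.eigenvalues k * ‖(U.conjTranspose.mulVec x) k‖ ^ 2 : ℝ) : ℂ) := by
      rw [h2]
      simp only [dotProduct, Matrix.mulVec_diagonal, Pi.star_apply, RCLike.star_def]
      push_cast
      refine Finset.sum_congr rfl fun k _ => ?_
      rw [← Complex.conj_mul']; ring
    exact_mod_cast h3
  refine ⟨U, hA.eigenvalues, hU1, h1, ?_, ?_⟩
  · intro k
    refine ⟨U.mulVec (Pi.single k 1), ?_, ?_⟩
    · rw [nsq_unitary U hU1]
      simp [nsq, Pi.single_apply, apply_ite norm, ite_pow]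
    · rw [h1, Matrix.mulVec_mulVec, hU1, Matrix.one_mulVec]
      simp [Pi.single_apply, apply_ite norm, ite_pow]
  · have h2 := hA.trace_eq_sum_eigenvalues
    have h3 : (T.conjTranspose * T).trace = ((∑ i, ∑ j, ‖T i j‖ ^ 2 : ℝ) : ℂ) := by
      simp only [Matrix.trace, Matrix.diag, Matrix.mul_apply, Matrix.conjTranspose_apply]
      rw [Finset.sum_comm]
      push_cast
      refine Finset.sum_congr rfl fun i _ => Finset.sum_congr rfl fun j _ => ?_
      rw [← Complex.conj_mul']; rfl
    rw [h3] at h2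
    have h4 : ((∑ i, ∑ j, ‖T i j‖ ^ 2 : ℝ) : ℂ) = ((∑ k, hA.eigenvalues k : ℝ) : ℂ) := by
      rw [h2]; push_cast; rfl
    exact_mod_cast h4.symm

lemma SG.quad (δ₀ D : ℝ) (hδ : 0 < δ₀) (hD : 1 ≤ D) : ∃ c C : ℝ, 0 < c ∧ 0 < C ∧
    ∀ (m n : Type) [Fintype m] [Fintype n] (μ : n → Measure ℂ)
      (_ : ∀ i, SG δ₀ D (μ i)) (T : Matrix m n ℂ) (_ : ∀ x, nsq (T.mulVec x) ≤ c * nsq x),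
      ∫⁻ b, ee (nsq (T.mulVec b)) ∂(Measure.pi μ) ≤ ee (C * ∑ i, ∑ j, ‖T i j‖ ^ 2) := by
  obtain ⟨δg, Dg, hδg, hg⟩ := gC_SG
  have hDg := hg.one_le hδg
  have hlg : 0 ≤ Real.log Dg := Real.log_nonneg hDg
  have hl : 0 ≤ Real.log D := Real.log_nonneg hD
  set C1 := (Real.log D + 1) / δ₀ with hC1
  have hC1p : 0 < C1 := by positivity
  refine ⟨δg / (2 * C1), (Real.log Dg + 1) / δg * (2 * C1), by positivity, by positivity, ?_⟩
  intro m n _ _ μ hμ T hT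
  classical
  have hprob := fun i => (hμ i).prob
  obtain ⟨U, lam, hU, hq, hk, hs⟩ := spectral_aux T
  have hlam0 : ∀ k, 0 ≤ lam k := fun k => by
    obtain ⟨x, _, hx⟩ := hk k; rw [← hx]; exact nsq_nonneg _
  have hlam1 : ∀ k, lam k ≤ δg / (2 * C1) := fun k => by
    obtain ⟨x, hx1, hx⟩ := hk k
    rw [← hx]; simpa [hx1] using hT x
  set W : (n → ℂ) → n → ℂ := fun g => U.mulVec (fun k => (Real.sqrt (2 * lam k) : ℂ) * g k) with hW
  have hWn : ∀ g, nsq (W g) = ∑ k, 2 * lam k * ‖g k‖ ^ 2 := by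
    intro g
    rw [hW]; simp only
    rw [nsq_unitary U hU, nsq]
    refine Finset.sum_congr rfl fun k _ => ?_
    rw [norm_mul, mul_pow, Complex.norm_real, Real.norm_eq_abs, sq_abs,
      Real.sq_sqrt (by linarith [hlam0 k])]
  have hWm : Measurable W := by
    rw [hW]
    refine measurable_pi_lambda _ fun i => ?_
    simp only [Matrix.mulVec, dotProduct]
    fun_prop
  have hWb : ∀ g b, ∑ i, (starRingEnd ℂ) (W g i) * b i =
      ∑ k, (starRingEnd ℂ) (g k) * ((Real.sqrt (2 * lam k) : ℂ) * (U.conjTranspose.mulVec b) k) := by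
    intro g b
    have : ∑ i, (starRingEnd ℂ) (W g i) * b i = dotProduct (star (W g)) b := rfl
    rw [this, hW]; simp only
    rw [Matrix.star_mulVec, ← Matrix.dotProduct_mulVec]
    simp only [dotProduct, Pi.star_apply, star_mul, RCLike.star_def, Complex.conj_ofReal]
    refine Finset.sum_congr rfl fun k _ => by ring
  have key : ∀ b : n → ℂ, ee (nsq (T.mulVec b)) =
      ∫⁻ g, ee ((∑ i, (starRingEnd ℂ) (W g i) * b i).re) ∂(Measure.pi fun _ : n => gC) := by
    intro b
    simp_rw [hWb, Complex.re_sum, ee_sum]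
    rw [lintegral_pi_prod (fun _ : n => gC) (fun k z => ee (((starRingEnd ℂ) z *
      ((Real.sqrt (2 * lam k) : ℂ) * (U.conjTranspose.mulVec b) k)).re)) (fun i => by fun_prop)]
    simp_rw [lintegral_gC]
    rw [← ee_sum, hq]
    congr 1
    refine Finset.sum_congr rfl fun k _ => ?_
    rw [norm_mul, mul_pow, Complex.norm_real, Real.norm_eq_abs, sq_abs,
      Real.sq_sqrt (by linarith [hlam0 k])]
    ring
  simp_rw [key]
  rw [lintegral_lintegral_swap]
  · calc _ ≤ ∫⁻ g, ee (∑ k, (C1 * (2 * lam k)) * ‖g k‖ ^ 2) ∂(Measure.pi fun _ : n => gC) := by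
          apply lintegral_mono
          intro g
          refine (SG.pi_mgf hδ hμ (W g)).trans (le_of_eq ?_)
          congr 1
          have := hWn g
          rw [nsq] at this
          rw [this, Finset.mul_sum]
          refine Finset.sum_congr rfl fun k _ => by ring
      _ ≤ ee (Real.log Dg / δg * ∑ k, C1 * (2 * lam k)) := by
          refine SG.pi_exp hδg (fun _ => hg) _ (fun k => ?_) (fun k => ?_)
          · have := hlam0 k; positivity
          · have := hlam1 k
            rw [le_div_iff₀ (by positivity)] at this
            linarith
      _ ≤ _ := by
          apply ee_mono
          rw [← hs, ← Finset.mul_sum, ← Finset.mul_sum]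
          have h0 : 0 ≤ ∑ k, lam k := Finset.sum_nonneg fun k _ => hlam0 k
          rw [← mul_assoc C1, mul_comm C1, ← mul_assoc]
          gcongr
          linarith
  · apply Measurable.aemeasurable
    simp only [Function.uncurry_def]
    apply measurable_ee_comp
    apply Complex.measurable_re.comp
    refine Finset.measurable_sum _ fun i _ => ?_
    have : Measurable fun p : (n → ℂ) × (n → ℂ) => W p.2 i :=
      (measurable_pi_apply i).comp (hWm.comp measurable_snd)
    fun_prop

lemma sum_split_aux {n : Type} [Fintype n] (p : n → Prop) [DecidablePred p] (f : n → n → ℂ) :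
    (∑ i, ∑ j, if p i ∧ ¬ p j then f i j else 0) =
      ∑ i : {i // p i}, ∑ j : {j // ¬ p j}, f i j := by
  rw [← Fintype.sum_subtype_add_sum_subtype p]
  have h2 : (∑ i : {i // ¬ p i}, ∑ j, if p i ∧ ¬ p j then f i j else 0) = 0 := by
    refine Finset.sum_eq_zero fun i _ => Finset.sum_eq_zero fun j _ => ?_
    simp [i.2]
  rw [h2, add_zero]
  refine Finset.sum_congr rfl fun i _ => ?_
  rw [← Fintype.sum_subtype_add_sum_subtype p]
  have h3 : (∑ j : {j // p j}, if p i ∧ ¬ p j then f i j else 0) = 0 :=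
    Finset.sum_eq_zero fun j _ => by simp [j.2]
  rw [h3, zero_add]
  refine Finset.sum_congr rfl fun j _ => ?_
  simp [i.2, j.2]

lemma SG.decoup (δ₀ D : ℝ) (hδ : 0 < δ₀) (hD : 1 ≤ D) : ∃ c C : ℝ, 0 < c ∧ 0 < C ∧
    ∀ (n : Type) [Fintype n] (μ : n → Measure ℂ) (p : n → Prop) [DecidablePred p]
      (_ : ∀ i, SG δ₀ D (μ i)) (A : Matrix n n ℂ) (_ : ∀ x, nsq (A.mulVec x) ≤ c * nsq x),
      ∫⁻ b, ee ((∑ i, ∑ j, if p i ∧ ¬ p j then (starRingEnd ℂ) (b i) * A i j * b j else 0).re)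
        ∂(Measure.pi μ) ≤ ee (C * ∑ i, ∑ j, ‖A i j‖ ^ 2) := by
  obtain ⟨c, C, hc, hC, hq⟩ := SG.quad δ₀ D hδ hD
  have hl : 0 ≤ Real.log D := Real.log_nonneg hD
  set C1 := (Real.log D + 1) / δ₀ with hC1
  have hC1p : 0 < C1 := by positivity
  refine ⟨c / C1, C * C1, by positivity, by positivity, ?_⟩
  intro n _ μ p _ hμ A hA
  classical
  have hprob := fun i => (hμ i).prob
  set T0 : Matrix {i // p i} {j // ¬ p j} ℂ := fun i j => A i j with hT0
  set F : ({i // p i} → ℂ) × ({j // ¬ p j} → ℂ) → ℝ≥0∞ := fun q =>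
    ee ((∑ i, (starRingEnd ℂ) (T0.mulVec q.2 i) * q.1 i).re) with hF
  have hFm : Measurable F := by
    rw [hF]
    simp only [Matrix.mulVec, dotProduct]
    fun_prop
  have hf : ∀ b : n → ℂ, ee ((∑ i, ∑ j, if p i ∧ ¬ p j then
      (starRingEnd ℂ) (b i) * A i j * b j else 0).re) =
      F (MeasurableEquiv.piEquivPiSubtypeProd (fun _ => ℂ) p b) := by
    intro b
    rw [hF, sum_split_aux p (fun i j => (starRingEnd ℂ) (b i) * A i j * b j)]
    simp only
    congr 1
    rw [← Complex.conj_re]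
    congr 1
    rw [map_sum]
    refine Finset.sum_congr rfl fun i _ => ?_
    simp only [map_sum, map_mul, Matrix.mulVec, dotProduct, Finset.sum_mul]
    refine Finset.sum_congr rfl fun j _ => ?_
    simp [hT0, MeasurableEquiv.piEquivPiSubtypeProd, Equiv.piEquivPiSubtypeProd]
    ring
  simp_rw [hf]
  rw [(measurePreserving_piEquivPiSubtypeProd μ p).lintegral_comp hFm,
    lintegral_prod_symm' _ hFm]
  set T : Matrix {i // p i} {j // ¬ p j} ℂ := (Real.sqrt C1 : ℂ) • T0 with hT
  have hsq : ‖(Real.sqrt C1 : ℂ)‖ ^ 2 = C1 := by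
    rw [Complex.norm_real, Real.norm_eq_abs, sq_abs, Real.sq_sqrt hC1p.le]
  have hTn : ∀ x, nsq (T.mulVec x) = C1 * nsq (T0.mulVec x) := by
    intro x
    rw [hT, Matrix.smul_mulVec, nsq, nsq, Finset.mul_sum]
    refine Finset.sum_congr rfl fun i _ => ?_
    rw [Pi.smul_apply, norm_smul, mul_pow, hsq]
  have hT0A : ∀ x, nsq (T0.mulVec x) ≤ c / C1 * nsq x := by
    intro x
    set y : n → ℂ := fun j => if h : p j then 0 else x ⟨j, h⟩ with hy
    have h1 : nsq y = nsq x := by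
      rw [nsq, ← Fintype.sum_subtype_add_sum_subtype p, nsq]
      have : ∑ i : {i // p i}, ‖y i‖ ^ 2 = 0 :=
        Finset.sum_eq_zero fun i _ => by simp [hy, i.2]
      rw [this, zero_add]
      refine Finset.sum_congr rfl fun i _ => by simp [hy, i.2]
    have h2 : nsq (T0.mulVec x) ≤ nsq (A.mulVec y) := by
      rw [nsq, nsq, ← Fintype.sum_subtype_add_sum_subtype p (fun i => ‖A.mulVec y i‖ ^ 2)]
      have h3 : ∀ i : {i // p i}, A.mulVec y i = T0.mulVec x i := by
        intro i
        simp only [Matrix.mulVec, dotProduct]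
        rw [← Fintype.sum_subtype_add_sum_subtype p]
        have : ∑ j : {j // p j}, A i j * y j = 0 :=
          Finset.sum_eq_zero fun j _ => by simp [hy, j.2]
        rw [this, zero_add]
        refine Finset.sum_congr rfl fun j _ => by simp [hy, hT0, j.2]
      simp_rw [h3]
      have : 0 ≤ ∑ i : {i // ¬ p i}, ‖A.mulVec y i‖ ^ 2 :=
        Finset.sum_nonneg fun _ _ => by positivity
      linarith
    rw [← h1]
    exact h2.trans (hA y)
  calc _ ≤ ∫⁻ y, ee (nsq (T.mulVec y)) ∂(Measure.pi fun i : {j // ¬ p j} => μ i) := by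
        apply lintegral_mono
        intro y
        refine (SG.pi_mgf hδ (fun i : {i // p i} => hμ i) (T0.mulVec y)).trans (le_of_eq ?_)
        show _ = ee (nsq (T.mulVec y))
        rw [hTn, nsq]
    _ ≤ ee (C * ∑ i, ∑ j, ‖T i j‖ ^ 2) := by
        refine hq _ _ (fun i : {j // ¬ p j} => μ i) (fun i => hμ i) T (fun x => ?_)
        rw [hTn]
        calc C1 * nsq (T0.mulVec x) ≤ C1 * (c / C1 * nsq x) := by gcongr; exact hT0A x
          _ = c * nsq x := by field_simp
    _ ≤ _ := by
        apply ee_mono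
        rw [mul_assoc]
        gcongr
        have e : ∑ i, ∑ j, ‖T i j‖ ^ 2 = C1 * ∑ i, ∑ j, ‖T0 i j‖ ^ 2 := by
          simp_rw [Finset.mul_sum]
          refine Finset.sum_congr rfl fun i _ => Finset.sum_congr rfl fun j _ => ?_
          rw [hT, Matrix.smul_apply, norm_smul, mul_pow, hsq]
        rw [e]
        gcongr
        rw [← Fintype.sum_subtype_add_sum_subtype p (fun i => ∑ j, ‖A i j‖ ^ 2)]
        have h0 : 0 ≤ ∑ i : {i // ¬ p i}, ∑ j, ‖A i j‖ ^ 2 :=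
          Finset.sum_nonneg fun _ _ => Finset.sum_nonneg fun _ _ => by positivity
        refine le_trans ?_ (le_add_of_nonneg_right h0)
        refine Finset.sum_le_sum fun i _ => ?_
        rw [← Fintype.sum_subtype_add_sum_subtype p (fun j => ‖A i j‖ ^ 2)]
        have h0 : 0 ≤ ∑ j : {j // p j}, ‖A i j‖ ^ 2 :=
          Finset.sum_nonneg fun _ _ => by positivity
        exact le_add_of_nonneg_left h0

lemma count_aux {n : Type} [Fintype n] [DecidableEq n] (i j : n) (hij : i ≠ j) :
    4 * ((Finset.univ.filter fun p : Finset n => i ∈ p ∧ j ∉ p).card : ℝ) =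
      2 ^ (Fintype.card n) := by
  have h : (Finset.univ.filter fun p : Finset n => i ∈ p ∧ j ∉ p) =
      Finset.Icc {i} (Finset.univ.erase j) := by
    ext p
    simp only [Finset.mem_filter, Finset.mem_univ, true_and, Finset.mem_Icc,
      Finset.singleton_subset_iff]
    constructor
    · rintro ⟨h1, h2⟩
      exact ⟨h1, fun x hx => Finset.mem_erase.2 ⟨fun e => h2 (e ▸ hx), Finset.mem_univ _⟩⟩
    · rintro ⟨h1, h2⟩
      exact ⟨h1, fun hj => by simpa using h2 hj⟩
  rw [h, Finset.card_Icc_finset (by simp [hij]), Finset.card_erase_of_mem (Finset.mem_univ _)]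
  have hc : 2 ≤ Fintype.card n := by
    have : ({i, j} : Finset n).card ≤ Fintype.card n := Finset.card_le_univ _
    rwa [Finset.card_pair hij] at this
  obtain ⟨k, hk⟩ := Nat.exists_eq_add_of_le hc
  simp only [Finset.card_univ, Finset.card_singleton, hk]
  have : 2 + k - 1 - 1 = k := by omega
  rw [this]; push_cast; ring

lemma avg_aux {n : Type} [Fintype n] [DecidableEq n] (f : n → n → ℂ) :
    (∑ i, ∑ j, f i j) = ∑ i, f i i + ∑ p : Finset n, ((1 / 2 ^ (Fintype.card n) : ℝ) : ℂ) *
      (4 * ∑ i, ∑ j, if i ∈ p ∧ ¬ j ∈ p then f i j else 0) := by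
  have h1 : ∑ p : Finset n, ((1 / 2 ^ (Fintype.card n) : ℝ) : ℂ) *
      (4 * ∑ i, ∑ j, if i ∈ p ∧ ¬ j ∈ p then f i j else 0) =
      ∑ i, ∑ j, if i = j then 0 else f i j := by
    simp_rw [Finset.mul_sum]
    rw [Finset.sum_comm]
    refine Finset.sum_congr rfl fun i _ => ?_
    rw [Finset.sum_comm]
    refine Finset.sum_congr rfl fun j _ => ?_
    by_cases hij : i = j
    · subst hij; simp
    · rw [if_neg hij]
      have h2 := count_aux i j hij
      simp_rw [mul_ite, mul_zero]
      rw [← Finset.sum_filter, Finset.sum_const, nsmul_eq_mul]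
      have h3 : (4 : ℂ) * ((Finset.univ.filter fun p : Finset n => i ∈ p ∧ j ∉ p).card : ℂ) =
        2 ^ (Fintype.card n) := by exact_mod_cast h2
      calc _ = (4 * ((Finset.univ.filter fun p : Finset n => i ∈ p ∧ j ∉ p).card : ℂ)) *
            ((1 / 2 ^ (Fintype.card n) : ℝ) : ℂ) * f i j := by ring
        _ = f i j := by rw [h3]; push_cast; field_simp
  rw [h1, ← Finset.sum_add_distrib]
  refine Finset.sum_congr rfl fun i _ => ?_
  rw [← Finset.add_sum_erase _ _ (Finset.mem_univ i),
    ← Finset.add_sum_erase (Finset.univ) (fun j => if i = j then 0 else f i j) (Finset.mem_univ i)]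
  simp only [if_true, zero_add]
  congr 1
  refine Finset.sum_congr rfl fun j hj => ?_
  rw [if_neg (Finset.ne_of_mem_erase hj).symm]

lemma ee_avg {ι : Type*} (s : Finset ι) (w : ℝ) (hw : 0 ≤ w) (hs : ∑ _i ∈ s, w = 1) (f : ι → ℝ) :
    ee (∑ i ∈ s, w * f i) ≤ ∑ i ∈ s, ENNReal.ofReal w * ee (f i) := by
  have h := convexOn_exp.map_sum_le (t := s) (w := fun _ => w) (p := f) (fun _ _ => hw) hs
    (fun _ _ => Set.mem_univ _)
  simp only [smul_eq_mul] at h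
  unfold ee
  refine (ENNReal.ofReal_le_ofReal h).trans ?_
  rw [ENNReal.ofReal_sum_of_nonneg (fun i _ => by positivity)]
  exact Finset.sum_le_sum fun i _ => by rw [ENNReal.ofReal_mul hw]

lemma ee_half (x y : ℝ) : ee (x + y) ≤ ENNReal.ofReal (1 / 2) * ee (2 * x) +
    ENNReal.ofReal (1 / 2) * ee (2 * y) := by
  have := ee_avg (Finset.univ : Finset (Fin 2)) (1 / 2) (by norm_num) (by simp) ![2 * x, 2 * y]
  simp only [Fin.sum_univ_two] at this
  simp only [Matrix.cons_val_zero, Matrix.cons_val_one] at this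
  convert this using 2
  ring

/-- Hanson-Wright exponential moment bound -/
lemma SG.hw (δ₀ D : ℝ) (hδ : 0 < δ₀) (hD : 1 ≤ D) : ∃ c C : ℝ, 0 < c ∧ 0 < C ∧
    ∀ (n : Type) [Fintype n] (μ : n → Measure ℂ)
      (_ : ∀ i, SG δ₀ D (μ i)) (A : Matrix n n ℂ) (_ : ∀ x, nsq (A.mulVec x) ≤ c * nsq x),
      ∫⁻ b, ee ((∑ i, ∑ j, (starRingEnd ℂ) (b i) * A i j * b j -
        ∑ i, A i i * ((∫ y, ‖y‖ ^ 2 ∂(μ i) : ℝ) : ℂ)).re)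
        ∂(Measure.pi μ) ≤ ee (C * ∑ i, ∑ j, ‖A i j‖ ^ 2) := by
  obtain ⟨c, C, hc, hC, hq⟩ := SG.decoup δ₀ D hδ hD
  refine ⟨min (c / 64) (δ₀ ^ 2 / 16), max (C * 64) (8 / δ₀ ^ 2 * Real.exp D * D * 4),
    by positivity, by positivity, ?_⟩
  intro n _ μ hμ A hA
  classical
  have hprob := fun i => (hμ i).prob
  set K := max (C * 64) (8 / δ₀ ^ 2 * Real.exp D * D * 4) * ∑ i, ∑ j, ‖A i j‖ ^ 2 with hK
  set w : n → ℝ := fun i => ∫ y, ‖y‖ ^ 2 ∂(μ i) with hw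
  set F2 := ∑ i, ∑ j, ‖A i j‖ ^ 2 with hF2
  have hF0 : 0 ≤ F2 := Finset.sum_nonneg fun _ _ => Finset.sum_nonneg fun _ _ => by positivity
  set X1 : (n → ℂ) → ℝ := fun b => ∑ i, (2 * (A i i).re) * (‖b i‖ ^ 2 - w i) with hX1
  set Z : Finset n → (n → ℂ) → ℝ := fun p b => (∑ i, ∑ j, if i ∈ p ∧ ¬ j ∈ p then
    (starRingEnd ℂ) (b i) * ((8 : ℂ) • A) i j * b j else 0).re with hZ
  set q : ℝ := 1 / 2 ^ (Fintype.card n) with hqd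
  have hdecomp : ∀ b : n → ℂ, 2 * ((∑ i, ∑ j, (starRingEnd ℂ) (b i) * A i j * b j -
        ∑ i, A i i * ((w i : ℝ) : ℂ)).re) = X1 b + ∑ p : Finset n, q * Z p b := by
    intro b
    have e1 : ∀ p : Finset n, ((q * Z p b : ℝ)) = 2 * ((q : ℂ) * (4 * ∑ i, ∑ j,
        if i ∈ p ∧ ¬ j ∈ p then (starRingEnd ℂ) (b i) * A i j * b j else 0)).re := by
      intro p
      rw [Complex.re_ofReal_mul, mul_left_comm]
      congr 1
      rw [hZ]; simp only
      have : (2 : ℝ) * (4 * ∑ i, ∑ j, if i ∈ p ∧ ¬ j ∈ p then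
          (starRingEnd ℂ) (b i) * A i j * b j else 0).re = (((8 : ℝ) : ℂ) * ∑ i, ∑ j,
          if i ∈ p ∧ ¬ j ∈ p then (starRingEnd ℂ) (b i) * A i j * b j else 0).re := by
        rw [Complex.re_ofReal_mul]
        have : ((4 : ℂ)) = ((4 : ℝ) : ℂ) := by norm_num
        rw [this, Complex.re_ofReal_mul]; ring
      rw [this]
      congr 1
      simp_rw [Finset.mul_sum, mul_ite, mul_zero]
      refine Finset.sum_congr rfl fun i _ => Finset.sum_congr rfl fun j _ => ?_
      split_ifs
      · simp; ring
      · rfl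
    rw [avg_aux]
    rw [Finset.sum_congr rfl (fun p _ => e1 p)]
    rw [← Finset.mul_sum Finset.univ _ (2 : ℝ), ← Complex.re_sum, hX1, Complex.sub_re,
      Complex.add_re]
    have e2 : 2 * ((∑ i, (starRingEnd ℂ) (b i) * A i i * b i).re -
        (∑ i, A i i * ((w i : ℝ) : ℂ)).re) = ∑ i, (2 * (A i i).re) * (‖b i‖ ^ 2 - w i) := by
      rw [← Complex.sub_re, ← Finset.sum_sub_distrib, Complex.re_sum, Finset.mul_sum]
      refine Finset.sum_congr rfl fun i _ => ?_
      have : (starRingEnd ℂ) (b i) * A i i * b i - A i i * ((w i : ℝ) : ℂ) =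
        ((‖b i‖ ^ 2 - w i : ℝ) : ℂ) * A i i := by
        push_cast
        rw [← Complex.conj_mul']; ring
      rw [this, Complex.re_ofReal_mul]; ring
    simp only
    rw [← e2]; ring
  have hAii : ∀ i, |2 * (A i i).re| ≤ δ₀ / 2 := by
    intro i
    have h1 := (hA (Pi.single i 1)).trans
      (mul_le_mul_of_nonneg_right (min_le_right _ _) (nsq_nonneg _))
    have h2 : nsq (Pi.single i (1 : ℂ)) = 1 := by
      simp [nsq, Pi.single_apply, apply_ite norm, ite_pow]
    have h3 : ‖A i i‖ ^ 2 ≤ nsq (A.mulVec (Pi.single i 1)) := by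
      rw [nsq, Matrix.mulVec_single_one]
      exact Finset.single_le_sum (f := fun k => ‖A.col i k‖ ^ 2) (fun k _ => by positivity)
        (Finset.mem_univ i)
    rw [h2, mul_one] at h1
    have h4 : ‖A i i‖ ≤ δ₀ / 4 := by
      apply le_of_sq_le_sq _ (by positivity)
      calc ‖A i i‖ ^ 2 ≤ δ₀ ^ 2 / 16 := h3.trans h1
        _ = (δ₀ / 4) ^ 2 := by ring
    have h5 := Complex.abs_re_le_norm (A i i)
    rw [abs_mul, abs_two]
    linarith
  have hdiag : ∫⁻ b, ee (X1 b) ∂(Measure.pi μ) ≤ ee K := by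
    refine (SG.pi_diag hδ hμ (fun i => 2 * (A i i).re) hAii).trans (ee_mono ?_)
    have h1 : ∑ i, (2 * (A i i).re) ^ 2 ≤ 4 * F2 := by
      rw [hF2, Finset.mul_sum]
      refine Finset.sum_le_sum fun i _ => ?_
      have h2 : ‖A i i‖ ^ 2 ≤ ∑ j, ‖A i j‖ ^ 2 :=
        Finset.single_le_sum (f := fun j => ‖A i j‖ ^ 2) (fun k _ => by positivity)
          (Finset.mem_univ i)
      have h3 : (A i i).re ^ 2 ≤ ‖A i i‖ ^ 2 := by
        rw [← sq_abs]; gcongr; exact Complex.abs_re_le_norm _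
      nlinarith
    calc _ ≤ 8 / δ₀ ^ 2 * Real.exp D * D * (4 * F2) := by gcongr
      _ = (8 / δ₀ ^ 2 * Real.exp D * D * 4) * F2 := by ring
      _ ≤ K := by rw [hK]; gcongr; exact le_max_right _ _
  have h8 : ‖(8 : ℂ)‖ = 8 := by simp
  have hZm : ∀ p, Measurable (Z p) := by
    intro p
    rw [hZ]; simp only
    apply Complex.measurable_re.comp
    refine Finset.measurable_sum _ fun i _ => Finset.measurable_sum _ fun j _ => ?_
    split_ifs <;> fun_prop
  have hZb : ∀ p, ∫⁻ b, ee (Z p b) ∂(Measure.pi μ) ≤ ee K := by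
    intro p
    refine (hq n μ (fun i => i ∈ p) hμ ((8 : ℂ) • A) (fun x => ?_)).trans (ee_mono ?_)
    · have h1 : nsq (((8 : ℂ) • A).mulVec x) = 64 * nsq (A.mulVec x) := by
        rw [Matrix.smul_mulVec, nsq, nsq, Finset.mul_sum]
        refine Finset.sum_congr rfl fun i _ => ?_
        rw [Pi.smul_apply, norm_smul, mul_pow, h8]; norm_num
      have h2 := (hA x).trans
        (mul_le_mul_of_nonneg_right (min_le_left _ _) (nsq_nonneg _))
      rw [h1]; linarith
    · have h1 : ∑ i, ∑ j, ‖((8 : ℂ) • A) i j‖ ^ 2 = 64 * F2 := by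
        rw [hF2]
        simp_rw [Finset.mul_sum]
        refine Finset.sum_congr rfl fun i _ => Finset.sum_congr rfl fun j _ => ?_
        rw [Matrix.smul_apply, norm_smul, mul_pow, h8]; norm_num
      rw [h1, hK, ← mul_assoc]
      gcongr; exact le_max_left _ _
  have hq0 : 0 ≤ q := by positivity
  have hq1 : ∑ _p : Finset n, q = 1 := by
    rw [Finset.sum_const, hqd]; simp
  have hoff : ∫⁻ b, ee (∑ p : Finset n, q * Z p b) ∂(Measure.pi μ) ≤ ee K := by
    calc _ ≤ ∫⁻ b, ∑ p : Finset n, ENNReal.ofReal q * ee (Z p b) ∂(Measure.pi μ) :=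
          lintegral_mono fun b => ee_avg Finset.univ q hq0 hq1 (fun p => Z p b)
      _ = ∑ p : Finset n, ENNReal.ofReal q * ∫⁻ b, ee (Z p b) ∂(Measure.pi μ) := by
          rw [lintegral_finsetSum]
          · refine Finset.sum_congr rfl fun p _ => ?_
            rw [lintegral_const_mul _ (measurable_ee_comp (hZm p))]
          · intro p _
            exact (measurable_ee_comp (hZm p)).const_mul _
      _ ≤ ∑ p : Finset n, ENNReal.ofReal q * ee K :=
          Finset.sum_le_sum fun p _ => by gcongr; exact hZb p
      _ = ee K := by
          rw [← Finset.sum_mul, ← ENNReal.ofReal_sum_of_nonneg (fun _ _ => hq0), hq1]; simp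
  have hX1m : Measurable X1 := by rw [hX1]; fun_prop
  calc _ ≤ ∫⁻ b, (ENNReal.ofReal (1 / 2) * ee (X1 b) + ENNReal.ofReal (1 / 2) *
        ee (∑ p : Finset n, q * Z p b)) ∂(Measure.pi μ) := by
        apply lintegral_mono
        intro b
        have h1 := ee_half (X1 b / 2) ((∑ p : Finset n, q * Z p b) / 2)
        have h2 := hdecomp b
        have h3 : X1 b / 2 + (∑ p : Finset n, q * Z p b) / 2 =
          ((∑ i, ∑ j, (starRingEnd ℂ) (b i) * A i j * b j -
            ∑ i, A i i * ((w i : ℝ) : ℂ)).re) := by linarith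
        rw [h3, mul_div_cancel₀ _ two_ne_zero, mul_div_cancel₀ _ two_ne_zero] at h1
        exact h1
    _ = ENNReal.ofReal (1 / 2) * ∫⁻ b, ee (X1 b) ∂(Measure.pi μ) + ENNReal.ofReal (1 / 2) *
        ∫⁻ b, ee (∑ p : Finset n, q * Z p b) ∂(Measure.pi μ) := by
        rw [lintegral_add_left (by fun_prop), lintegral_const_mul _ (by fun_prop),
          lintegral_const_mul]
        apply measurable_ee_comp
        exact Finset.measurable_sum _ fun p _ => (hZm p).const_mul _
    _ ≤ ENNReal.ofReal (1 / 2) * ee K + ENNReal.ofReal (1 / 2) * ee K := by gcongr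
    _ = ee K := by
        rw [← add_mul, ← ENNReal.ofReal_add (by norm_num) (by norm_num)]; norm_num

/-- resolvent -/
def res {n : Type*} [Fintype n] [DecidableEq n] (H : Matrix n n ℂ) (z : ℂ) : Matrix n n ℂ :=
  (H - z • (1 : Matrix n n ℂ))⁻¹

section
variable {n : Type*} [Fintype n] [DecidableEq n] {H : Matrix n n ℂ} {z : ℂ}

lemma cs_sum (a b : n → ℂ) : ‖dotProduct a b‖ ^ 2 ≤ nsq a * nsq b := by
  have h1 : ‖dotProduct a b‖ ≤ ∑ i, ‖a i‖ * ‖b i‖ := by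
    refine (norm_sum_le _ _).trans (Finset.sum_le_sum fun i _ => by rw [norm_mul])
  calc ‖dotProduct a b‖ ^ 2 ≤ (∑ i, ‖a i‖ * ‖b i‖) ^ 2 := by gcongr
    _ ≤ _ := Finset.sum_mul_sq_le_sq_mul_sq _ _ _

lemma nsq_star (a : n → ℂ) : nsq (star a) = nsq a := by
  simp [nsq]

lemma im_herm (hH : H.IsHermitian) (x : n → ℂ) : (dotProduct (star x) (H.mulVec x)).im = 0 := by
  have h : star (dotProduct (star x) (H.mulVec x)) = dotProduct (star x) (H.mulVec x) := by
    rw [← Matrix.star_dotProduct, Matrix.star_mulVec, hH.eq, ← Matrix.dotProduct_mulVec]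
  exact Complex.conj_eq_iff_im.1 h

lemma im_form (hH : H.IsHermitian) (x : n → ℂ) :
    (dotProduct (star x) ((H - z • (1 : Matrix n n ℂ)).mulVec x)).im = -(z.im * nsq x) := by
  rw [Matrix.sub_mulVec, dotProduct_sub, Complex.sub_im, im_herm hH, Matrix.smul_mulVec,
    Matrix.one_mulVec, dotProduct_smul, ← nsq_eq]
  simp

lemma nsq_eq_zero {x : n → ℂ} (h : nsq x = 0) : x = 0 := by
  funext i
  have := (Finset.sum_eq_zero_iff_of_nonneg (fun i _ => by positivity)).1 h i (Finset.mem_univ i)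
  simpa using this

lemma res_unit (hH : H.IsHermitian) (hz : 0 < z.im) :
    IsUnit (H - z • (1 : Matrix n n ℂ)) := by
  rw [← Matrix.mulVec_injective_iff_isUnit]
  intro x y hxy
  have h0 : (H - z • (1 : Matrix n n ℂ)).mulVec (x - y) = 0 := by
    rw [Matrix.mulVec_sub, sub_eq_zero]; exact hxy
  have h1 := im_form (z := z) hH (x - y)
  rw [h0] at h1
  simp only [dotProduct_zero, Complex.zero_im] at h1
  have h2 : nsq (x - y) = 0 := by
    rcases mul_eq_zero.1 (neg_eq_zero.1 h1.symm) with h | h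
    · exact absurd h hz.ne'
    · exact h
  exact sub_eq_zero.1 (nsq_eq_zero h2)

lemma res_mul (hH : H.IsHermitian) (hz : 0 < z.im) :
    res H z * (H - z • (1 : Matrix n n ℂ)) = 1 :=
  Matrix.nonsing_inv_mul _ ((Matrix.isUnit_iff_isUnit_det _).1 (res_unit hH hz))

lemma mul_res (hH : H.IsHermitian) (hz : 0 < z.im) :
    (H - z • (1 : Matrix n n ℂ)) * res H z = 1 :=
  Matrix.mul_nonsing_inv _ ((Matrix.isUnit_iff_isUnit_det _).1 (res_unit hH hz))

lemma ward_vec (hH : H.IsHermitian) (hz : 0 < z.im) (a : n → ℂ) :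
    (dotProduct (star a) ((res H z).mulVec a)).im = z.im * nsq ((res H z).mulVec a) := by
  set u := (res H z).mulVec a with hu
  have ha : a = (H - z • (1 : Matrix n n ℂ)).mulVec u := by
    rw [hu, Matrix.mulVec_mulVec, mul_res hH hz, Matrix.one_mulVec]
  have h1 : dotProduct (star a) u = star (dotProduct (star u) a) := by
    rw [Matrix.star_dotProduct]
  rw [h1, ha]
  have := im_form (z := z) hH u
  rw [RCLike.star_def, Complex.conj_im, this, neg_neg]

lemma res_bound (hH : H.IsHermitian) (hz : 0 < z.im) (a : n → ℂ) :
    z.im ^ 2 * nsq ((res H z).mulVec a) ≤ nsq a := by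
  have h1 := ward_vec hH hz a
  set u := (res H z).mulVec a with hu
  have h2 := cs_sum (star a) u
  rw [nsq_star] at h2
  have h3 : z.im * nsq u ≤ ‖dotProduct (star a) u‖ := by
    rw [← h1]; exact (le_abs_self _).trans (Complex.abs_im_le_norm _)
  have hu0 := nsq_nonneg u
  have h4 : (z.im * nsq u) ^ 2 ≤ nsq a * nsq u := le_trans (by gcongr) h2
  rcases hu0.eq_or_lt with h | h
  · rw [← h]; simp [nsq_nonneg]
  · have : (z.im ^ 2 * nsq u) * nsq u ≤ nsq a * nsq u := by linarith [h4, mul_pow z.im (nsq u) 2]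
    exact le_of_mul_le_mul_right this h

lemma ward_col (hH : H.IsHermitian) (hz : 0 < z.im) (j : n) :
    (res H z j j).im = z.im * ∑ i, ‖res H z i j‖ ^ 2 := by
  have := ward_vec hH hz (Pi.single j 1)
  rw [Matrix.mulVec_single_one] at this
  rw [nsq] at this
  simp only [Matrix.col_apply] at this
  rw [← this]
  simp [dotProduct, Pi.single_apply, apply_ite]

lemma res_conj (hH : H.IsHermitian) :
    res (-H) (-(starRingEnd ℂ) z) = -(res H z).conjTranspose := by
  unfold res
  have : -H - (-(starRingEnd ℂ) z) • (1 : Matrix n n ℂ) =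
      -(H - z • (1 : Matrix n n ℂ)).conjTranspose := by
    rw [Matrix.conjTranspose_sub, hH.eq, Matrix.conjTranspose_smul, Matrix.conjTranspose_one]
    simp
    abel
  rw [this, Matrix.conjTranspose_nonsing_inv]
  rw [← neg_one_smul ℂ ((H - z • (1 : Matrix n n ℂ)).conjTranspose)]
  by_cases hd : IsUnit (H - z • (1 : Matrix n n ℂ)).conjTranspose.det
  · apply Matrix.inv_eq_left_inv
    rw [neg_one_smul, neg_mul_neg, Matrix.nonsing_inv_mul _ hd]
  · rw [Matrix.nonsing_inv_apply_not_isUnit _ hd, Matrix.nonsing_inv_apply_not_isUnit]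
    · simp
    · rw [Matrix.det_smul]
      intro h
      exact hd (isUnit_of_mul_isUnit_right h)

lemma ward_row (hH : H.IsHermitian) (hz : 0 < z.im) (j : n) :
    (res H z j j).im = z.im * ∑ i, ‖res H z j i‖ ^ 2 := by
  have h := ward_col (H := -H) (z := -(starRingEnd ℂ) z) hH.neg (by simpa using hz) j
  rw [res_conj hH] at h
  simpa using h

lemma ward_trace (hH : H.IsHermitian) (hz : 0 < z.im) :
    (Matrix.trace (res H z)).im = z.im * ∑ i, ∑ j, ‖res H z i j‖ ^ 2 := by
  rw [Finset.sum_comm, Finset.mul_sum, Matrix.trace, Complex.im_sum]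
  exact Finset.sum_congr rfl fun j _ => ward_col hH hz j

lemma res_diag_bound (hH : H.IsHermitian) (hz : 0 < z.im) (j : n) :
    ‖res H z j j‖ ≤ 1 / z.im := by
  have h1 := ward_col hH hz j
  have h2 : ‖res H z j j‖ ^ 2 ≤ ∑ i, ‖res H z i j‖ ^ 2 :=
    Finset.single_le_sum (f := fun i => ‖res H z i j‖ ^ 2) (fun i _ => by positivity)
      (Finset.mem_univ j)
  have h3 : (res H z j j).im ≤ ‖res H z j j‖ := (le_abs_self _).trans (Complex.abs_im_le_norm _)
  rw [le_div_iff₀ hz]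
  by_contra hcon
  push Not at hcon
  have h4 : z.im * ‖res H z j j‖ ^ 2 ≤ ‖res H z j j‖ := by
    calc _ ≤ z.im * ∑ i, ‖res H z i j‖ ^ 2 := by gcongr
      _ ≤ _ := by rw [← h1]; exact h3
  have h5 : 0 < ‖res H z j j‖ := by
    by_contra h
    have : ‖res H z j j‖ = 0 := le_antisymm (not_lt.1 h) (norm_nonneg _)
    rw [this] at hcon; linarith
  nlinarith

/-- the minor with row and column `j` zeroed -/
def minor (H : Matrix n n ℂ) (j : n) : Matrix n n ℂ := fun k l => if k = j ∨ l = j then 0 else H k l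

/-- the column `j` without diagonal entry -/
def colv (H : Matrix n n ℂ) (j : n) : n → ℂ := fun k => if k = j then 0 else H k j

lemma minor_herm (hH : H.IsHermitian) (j : n) : (minor H j).IsHermitian := by
  ext k l
  simp only [minor, Matrix.conjTranspose_apply]
  by_cases h : k = j ∨ l = j
  · rw [if_pos h, if_pos h.symm]; simp
  · rw [if_neg h, if_neg (fun h' => h h'.symm)]
    exact hH.apply k l

/-- key elimination identity -/
lemma minor_elim (hH : H.IsHermitian) (hz : 0 < z.im) (j : n) (x y : n → ℂ)
    (hxy : (H - z • (1 : Matrix n n ℂ)).mulVec x = y) :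
    x - x j • Pi.single j 1 =
      (res (minor H j) z).mulVec (y - y j • Pi.single j 1 - x j • colv H j) := by
  have key : (minor H j - z • (1 : Matrix n n ℂ)).mulVec (x - x j • Pi.single j 1) =
      y - y j • Pi.single j 1 - x j • colv H j := by
    funext k
    have hk := congrFun hxy k
    simp only [Matrix.sub_mulVec, Matrix.smul_mulVec, Matrix.one_mulVec, Pi.sub_apply,
      Pi.smul_apply, smul_eq_mul] at hk ⊢
    by_cases hkj : k = j
    · subst hkj
      simp [minor, colv, Matrix.mulVec, dotProduct]
    · simp only [colv, if_neg hkj, Pi.single_apply, mul_zero, sub_zero]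
      rw [← hk]
      have : (minor H j).mulVec (x - x j • Pi.single j 1) k = H.mulVec x k - H k j * x j := by
        simp only [Matrix.mulVec, dotProduct]
        rw [← Finset.add_sum_erase _ _ (Finset.mem_univ j),
          ← Finset.add_sum_erase Finset.univ (fun l => H k l * x l) (Finset.mem_univ j)]
        rw [add_sub_cancel_left]
        simp only [minor, or_true, if_true, zero_mul, zero_add]
        refine Finset.sum_congr rfl fun l hl => ?_
        have hl' := Finset.ne_of_mem_erase hl
        simp [hkj, hl', Pi.single_apply]
      rw [this]; ring
  rw [← key, Matrix.mulVec_mulVec, res_mul (minor_herm hH j) hz, Matrix.one_mulVec]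

end

section
variable {n : Type*} [Fintype n] [DecidableEq n] {H : Matrix n n ℂ} {z : ℂ}

lemma res_col_eq (hH : H.IsHermitian) (hz : 0 < z.im) (j : n) :
    (H - z • (1 : Matrix n n ℂ)).mulVec ((res H z).col j) = Pi.single j 1 := by
  rw [← Matrix.mulVec_single_one, Matrix.mulVec_mulVec, mul_res hH hz, Matrix.one_mulVec]

lemma elim_diag (hH : H.IsHermitian) (hz : 0 < z.im) (j k : n) :
    res H z k j - res H z j j * (if k = j then 1 else 0) =
      - (res H z j j * (res (minor H j) z).mulVec (colv H j) k) := by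
  have h := congrFun (minor_elim hH hz j _ _ (res_col_eq hH hz j)) k
  have e : (Pi.single j 1 - (Pi.single j 1 : n → ℂ) j • Pi.single j 1
      - (res H z).col j j • colv H j) = -(res H z j j • colv H j) := by
    simp
  rw [e, Matrix.mulVec_neg, Matrix.mulVec_smul] at h
  simpa [Pi.single_apply] using h

lemma schur (hH : H.IsHermitian) (hz : 0 < z.im) (j : n) :
    res H z j j * (H j j - z - dotProduct (star (colv H j))
      ((res (minor H j) z).mulVec (colv H j))) = 1 := by
  have h := congrFun (res_col_eq hH hz j) j
  rw [Matrix.sub_mulVec, Matrix.smul_mulVec, Matrix.one_mulVec] at h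
  simp only [Pi.sub_apply, Pi.smul_apply, smul_eq_mul, Pi.single_eq_same, Matrix.col_apply] at h
  have h2 : H.mulVec ((res H z).col j) j = H j j * res H z j j - res H z j j *
      dotProduct (star (colv H j)) ((res (minor H j) z).mulVec (colv H j)) := by
    simp only [Matrix.mulVec, dotProduct]
    rw [← Finset.add_sum_erase _ _ (Finset.mem_univ j),
      ← Finset.add_sum_erase Finset.univ (fun i => star (colv H j) i * _) (Finset.mem_univ j)]
    have h0 : star (colv H j) j = 0 := by simp [colv]
    rw [h0, zero_mul, zero_add, Finset.mul_sum, Matrix.col_apply, sub_eq_add_neg,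
      ← Finset.sum_neg_distrib]
    congr 1
    refine Finset.sum_congr rfl fun l hl => ?_
    have hl' := Finset.ne_of_mem_erase hl
    have e := elim_diag hH hz j l
    rw [if_neg hl', mul_zero, sub_zero] at e
    rw [Matrix.col_apply, e]
    have : star (colv H j) l = H j l := by
      simp only [colv, Pi.star_apply, if_neg hl']
      exact hH.apply j l
    rw [this]
    simp only [Matrix.mulVec, dotProduct]
    ring
  rw [h2] at h
  linear_combination h

lemma res_diag_ne (hH : H.IsHermitian) (hz : 0 < z.im) (j : n) : res H z j j ≠ 0 := by
  intro h
  have := schur hH hz j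
  rw [h, zero_mul] at this
  exact zero_ne_one this

lemma schur_bound (hH : H.IsHermitian) (hz : 0 < z.im) (j : n) :
    ‖res H z j j‖ * (z.im * nsq ((res (minor H j) z).mulVec (colv H j))) ≤ 1 := by
  have h := congrArg norm (schur hH hz j)
  rw [norm_mul, norm_one] at h
  rw [← h]
  refine mul_le_mul_of_nonneg_left ?_ (norm_nonneg _)
  have hj : (H j j).im = 0 := Complex.conj_eq_iff_im.1 (hH.apply j j)
  have h1 := ward_vec (minor_herm hH j) hz (colv H j)
  set S := dotProduct (star (colv H j)) ((res (minor H j) z).mulVec (colv H j))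
  have h2 : (H j j - z - S).im = - (z.im + S.im) := by
    simp [hj]; ring
  rw [← h1]
  have h3 := Complex.abs_im_le_norm (H j j - z - S)
  rw [h2, abs_neg] at h3
  have := le_abs_self (z.im + S.im)
  linarith

lemma elim_off (hH : H.IsHermitian) (hz : 0 < z.im) (j l : n) (hl : l ≠ j) :
    res H z l l = res (minor H j) z l l + res H z j l * res H z l j / res H z j j := by
  have h := congrFun (minor_elim hH hz j _ _ (res_col_eq hH hz l)) l
  have e : (Pi.single l 1 - (Pi.single l 1 : n → ℂ) j • Pi.single j 1
      - (res H z).col l j • colv H j) = Pi.single l 1 - res H z j l • colv H j := by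
    simp [Pi.single_apply, hl.symm]
  rw [e, Matrix.mulVec_sub, Matrix.mulVec_smul] at h
  have e2 := elim_diag hH hz j l
  rw [if_neg hl, mul_zero, sub_zero] at e2
  have h0 := res_diag_ne hH hz j
  simp [Pi.single_apply, hl] at h
  rw [h, e2]
  field_simp
  ring

/-- The trace of the `j`-th minor, without the `j`-th column. -/
def tau (H : Matrix n n ℂ) (z : ℂ) (j : n) : ℝ :=
  z.im * ∑ k ∈ Finset.univ.erase j, ∑ i, ‖res (minor H j) z i k‖ ^ 2

lemma tau_ge (hH : H.IsHermitian) (hz : 0 < z.im) (j : n) :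
    (Matrix.trace (res H z)).im - 1 / z.im ≤ tau H z j := by
  have h0 := res_diag_ne hH hz j
  have h1 : Matrix.trace (res H z) = ∑ k ∈ Finset.univ.erase j, res (minor H j) z k k +
      dotProduct (fun l => res H z j l) (fun l => res H z l j) / res H z j j := by
    rw [Matrix.trace, dotProduct, ← Finset.add_sum_erase _ _ (Finset.mem_univ j),
      ← Finset.add_sum_erase Finset.univ (fun l => res H z j l * res H z l j) (Finset.mem_univ j),
      add_div, Finset.sum_div]
    have : ∀ l ∈ Finset.univ.erase j, (res H z).diag l =
        res (minor H j) z l l + res H z j l * res H z l j / res H z j j := fun l hl =>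
      elim_off hH hz j l (Finset.ne_of_mem_erase hl)
    rw [Finset.sum_congr rfl this, Finset.sum_add_distrib, Matrix.diag_apply]
    field_simp
    ring
  have h2 : (∑ k ∈ Finset.univ.erase j, res (minor H j) z k k).im = tau H z j := by
    rw [tau, Complex.im_sum, Finset.mul_sum]
    exact Finset.sum_congr rfl fun k _ => ward_col (minor_herm hH j) hz k
  have h3 : ‖dotProduct (fun l => res H z j l) (fun l => res H z l j) / res H z j j‖
      ≤ 1 / z.im := by
    have a := cs_sum (fun l => res H z j l) (fun l => res H z l j)
    have b1 := ward_col hH hz j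
    have b2 := ward_row hH hz j
    have b3 : (res H z j j).im ≤ ‖res H z j j‖ :=
      (le_abs_self _).trans (Complex.abs_im_le_norm _)
    have hp : 0 < ‖res H z j j‖ := norm_pos_iff.2 h0
    rw [norm_div, div_le_div_iff₀ hp hz, one_mul]
    refine le_trans ?_ b3
    have c1 : 0 ≤ (res H z j j).im := by
      rw [b1]; exact mul_nonneg hz.le (Finset.sum_nonneg fun i _ => by positivity)
    refine (le_abs_self _).trans (abs_le_of_sq_le_sq ?_ c1)
    rw [mul_pow]
    calc _ ≤ (nsq (fun l => res H z j l) * nsq (fun l => res H z l j)) * z.im ^ 2 := by gcongr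
      _ = (z.im * nsq (fun l => res H z j l)) * (z.im * nsq (fun l => res H z l j)) := by ring
      _ = _ := by
        unfold nsq
        rw [← b1, ← b2, sq]
  have h4 := (le_abs_self _).trans ((Complex.abs_im_le_norm _).trans h3)
  rw [h1, Complex.add_im, h2]
  linarith

lemma exists_bad (hH : H.IsHermitian) (hz : 0 < z.im) {K : ℝ} (hK : 3 ≤ K)
    (hn : 0 < (Fintype.card n : ℝ)) (hK2 : 2 ≤ Fintype.card n * K * z.im)
    (htr : Fintype.card n * K ≤ (Matrix.trace (res H z)).im) :
    ∃ j, Fintype.card n * K / 2 ≤ tau H z j ∧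
      Fintype.card n * (z.im * nsq ((res (minor H j) z).mulVec (colv H j))) ≤ tau H z j / 2 := by
  by_contra hcon
  push Not at hcon
  set M : ℝ := (Fintype.card n : ℝ)
  have h1 : ∀ j, (res H z j j).im ≤ 4 / K := by
    intro j
    have t := tau_ge hH hz j
    have t1 : 1 / z.im ≤ M * K / 2 := by
      rw [div_le_iff₀ hz]; linarith
    have t2 : M * K / 2 ≤ tau H z j := by linarith
    have t3 := hcon j t2
    have t4 := schur_bound hH hz j
    set q := z.im * nsq ((res (minor H j) z).mulVec (colv H j))
    have t5 : K / 4 ≤ q := by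
      have : M * (K / 4) ≤ M * q := by linarith
      exact le_of_mul_le_mul_left this hn
    have t6 : ‖res H z j j‖ * (K / 4) ≤ 1 := le_trans (by gcongr) t4
    refine ((le_abs_self _).trans (Complex.abs_im_le_norm _)).trans ?_
    rw [le_div_iff₀ (by linarith)]
    linarith
  have h2 : (Matrix.trace (res H z)).im ≤ M * (4 / K) := by
    rw [Matrix.trace, Complex.im_sum]
    refine (Finset.sum_le_sum fun j _ => h1 j).trans ?_
    simp [M]
  have h3 : K ≤ 4 / K := le_of_mul_le_mul_left (htr.trans h2) hn
  rw [le_div_iff₀ (by linarith)] at h3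
  nlinarith

end

lemma ee_markov {α : Type*} [MeasurableSpace α] (μ : Measure α) {f : α → ℝ} (hf : Measurable f)
    (r : ℝ) : μ {x | r ≤ f x} ≤ ee (-r) * ∫⁻ x, ee (f x) ∂μ := by
  have h := mul_meas_ge_le_lintegral (μ := μ) (f := fun x => ee (f x)) (by fun_prop) (ee r)
  have h1 : {x | r ≤ f x} ⊆ {x | ee r ≤ ee (f x)} := fun x hx => ee_mono hx
  calc μ {x | r ≤ f x} = ee (-r) * (ee r * μ {x | r ≤ f x}) := by
        rw [← mul_assoc, ← ee_add]; simp [ee_zero]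
    _ ≤ ee (-r) * (ee r * μ {x | ee r ≤ ee (f x)}) := by gcongr
    _ ≤ _ := by gcongr

section
variable {n : Type*} [Fintype n] [DecidableEq n] {H : Matrix n n ℂ} {z : ℂ}

lemma res_bound_adj (hH : H.IsHermitian) (hz : 0 < z.im) (a : n → ℂ) :
    z.im ^ 2 * nsq ((res H z).conjTranspose.mulVec a) ≤ nsq a := by
  have h := res_bound (H := -H) (z := -(starRingEnd ℂ) z) hH.neg (by simpa using hz) a
  rw [res_conj hH, Matrix.neg_mulVec] at h
  simpa [nsq] using h

/-- resolvent with column `j` zeroed -/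
def resz (H : Matrix n n ℂ) (z : ℂ) (j : n) : Matrix n n ℂ :=
  fun i k => if k = j then 0 else res H z i k

/-- the version of `tau` in terms of the minor -/
def tauM (H : Matrix n n ℂ) (z : ℂ) (j : n) : ℝ :=
  z.im * ∑ k ∈ Finset.univ.erase j, ∑ i, ‖res H z i k‖ ^ 2

lemma tauM_nonneg (hz : 0 < z.im) (j : n) : 0 ≤ tauM H z j :=
  mul_nonneg hz.le (Finset.sum_nonneg fun _ _ => Finset.sum_nonneg fun _ _ => by positivity)

lemma tauM_eq (j : n) : tauM H z j = z.im * ∑ k, nsq ((resz H z j).col k) := by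
  rw [tauM, ← Finset.add_sum_erase Finset.univ _ (Finset.mem_univ j)]
  have : nsq ((resz H z j).col j) = 0 := by simp [nsq, resz]
  rw [this, zero_add]
  congr 1
  refine Finset.sum_congr rfl fun k hk => ?_
  simp [nsq, resz, Finset.ne_of_mem_erase hk]

lemma resz_bound (hH : H.IsHermitian) (hz : 0 < z.im) (j : n) (a : n → ℂ) :
    z.im ^ 2 * nsq ((resz H z j).mulVec a) ≤ nsq a := by
  have h : (resz H z j).mulVec a = (res H z).mulVec (fun k => if k = j then 0 else a k) := by
    funext i
    simp only [Matrix.mulVec, dotProduct, resz]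
    refine Finset.sum_congr rfl fun k _ => ?_
    split_ifs <;> simp
  rw [h]
  refine (res_bound hH hz _).trans (Finset.sum_le_sum fun k _ => ?_)
  dsimp only
  split_ifs <;> simp

lemma resz_bound_adj (hH : H.IsHermitian) (hz : 0 < z.im) (j : n) (a : n → ℂ) :
    z.im ^ 2 * nsq ((resz H z j).conjTranspose.mulVec a) ≤ nsq a := by
  refine le_trans ?_ (res_bound_adj hH hz a)
  refine mul_le_mul_of_nonneg_left (Finset.sum_le_sum fun k _ => ?_) (by positivity)
  by_cases hk : k = j
  · have : (resz H z j).conjTranspose.mulVec a k = 0 := by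
      simp [Matrix.mulVec, dotProduct, resz, hk]
    rw [this]; simp
  · have : (resz H z j).conjTranspose.mulVec a k = (res H z).conjTranspose.mulVec a k := by
      simp [Matrix.mulVec, dotProduct, resz, hk]
    rw [this]

lemma nsq_smul (r : ℂ) (a : n → ℂ) : nsq (r • a) = ‖r‖ ^ 2 * nsq a := by
  simp [nsq, mul_pow, Finset.mul_sum]

end

lemma lower_tail (δ₀ D : ℝ) (hδ : 0 < δ₀) (hD : 1 ≤ D) : ∃ σ : ℝ, 0 < σ ∧
    ∀ (n : Type) [Fintype n] [DecidableEq n] (μ : n → Measure ℂ) (_ : ∀ i, SG δ₀ D (μ i))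
    (j : n) (_ : ∀ i, i ≠ j → ∫ y, ‖y‖ ^ 2 ∂(μ i) = 1)
    (H : Matrix n n ℂ) (_ : H.IsHermitian) (z : ℂ) (_ : 0 < z.im) (T : ℝ) (_ : T ≤ tauM H z j),
    Measure.pi μ {b | z.im * nsq ((resz H z j).mulVec b) ≤ tauM H z j / 2} ≤
      ee (-(σ * (z.im * T))) := by
  obtain ⟨c, C, hc, hC, hw⟩ := SG.hw δ₀ D hδ hD
  set σ : ℝ := min (min c 1) (1 / (4 * C)) with hσ
  have hσ0 : 0 < σ := by positivity
  have hσ1 : σ ^ 2 ≤ c := by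
    have h1 : σ ≤ c := (min_le_left _ _).trans (min_le_left _ _)
    have h2 : σ ≤ 1 := (min_le_left _ _).trans (min_le_right _ _)
    nlinarith
  have hσ2 : C * σ ≤ 1 / 4 := by
    have : σ ≤ 1 / (4 * C) := min_le_right _ _
    calc C * σ ≤ C * (1 / (4 * C)) := by gcongr
      _ = 1 / 4 := by field_simp
  refine ⟨σ / 4, by positivity, ?_⟩
  intro n _ _ μ hμ j hv H hH z hz T hT
  set η := z.im with hη
  set W := resz H z j with hW
  set τ := tauM H z j with hτ
  have hτ0 : 0 ≤ τ := tauM_nonneg hz j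
  set A : Matrix n n ℂ := (((-(σ * η * η) : ℝ)) : ℂ) • (W.conjTranspose * W) with hA
  have hM : ∀ x, nsq ((W.conjTranspose * W).mulVec x) * (η ^ 2 * η ^ 2) ≤ nsq x := by
    intro x
    rw [← Matrix.mulVec_mulVec]
    have h1 := resz_bound_adj hH hz j (W.mulVec x)
    have h2 := resz_bound hH hz j x
    rw [← hη] at h1 h2
    calc _ = η ^ 2 * (η ^ 2 * nsq (W.conjTranspose.mulVec (W.mulVec x))) := by ring
      _ ≤ η ^ 2 * nsq (W.mulVec x) := by gcongr
      _ ≤ _ := h2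
  have hop : ∀ x, nsq (A.mulVec x) ≤ c * nsq x := by
    intro x
    rw [hA, Matrix.smul_mulVec, nsq_smul, Complex.norm_real, Real.norm_eq_abs, sq_abs]
    calc _ = σ ^ 2 * (nsq ((W.conjTranspose * W).mulVec x) * (η ^ 2 * η ^ 2)) := by ring
      _ ≤ σ ^ 2 * nsq x := by gcongr; exact hM x
      _ ≤ c * nsq x := by gcongr; exact nsq_nonneg x
  have hF : ∑ i, ∑ k, ‖A i k‖ ^ 2 ≤ σ ^ 2 * (η * τ) := by
    have e1 : ∀ k, ∑ i, ‖A i k‖ ^ 2 ≤ σ ^ 2 * η ^ 2 * nsq (W.col k) := by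
      intro k
      have h1 := resz_bound_adj hH hz j (W.col k)
      rw [← hη] at h1
      have h2 : ∑ i, ‖A i k‖ ^ 2 = (σ * η * η) ^ 2 * nsq (W.conjTranspose.mulVec (W.col k)) := by
        rw [nsq, Finset.mul_sum]
        refine Finset.sum_congr rfl fun i _ => ?_
        rw [hA, Matrix.smul_apply, smul_eq_mul, norm_mul, mul_pow, Complex.norm_real,
          Real.norm_eq_abs, sq_abs, neg_sq]
        rfl
      rw [h2]
      calc _ = σ ^ 2 * η ^ 2 * (η ^ 2 * nsq (W.conjTranspose.mulVec (W.col k))) := by ring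
        _ ≤ _ := by gcongr
    rw [Finset.sum_comm]
    refine (Finset.sum_le_sum fun k _ => e1 k).trans ?_
    rw [← Finset.mul_sum, hτ, tauM_eq, ← hη, ← hW]
    apply le_of_eq; ring
  have hquad : ∀ b : n → ℂ, (∑ i, ∑ k, (starRingEnd ℂ) (b i) * A i k * b k) =
      ((-(σ * η) * (η * nsq (W.mulVec b)) : ℝ) : ℂ) := by
    intro b
    have h1 : (∑ i, ∑ k, (starRingEnd ℂ) (b i) * A i k * b k) =
        dotProduct (star b) (A.mulVec b) := by
      simp only [Matrix.mulVec, dotProduct, Finset.mul_sum, mul_assoc]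
      rfl
    rw [h1, hA, Matrix.smul_mulVec, dotProduct_smul, ← Matrix.mulVec_mulVec,
      Matrix.dotProduct_mulVec, ← Matrix.star_mulVec, ← nsq_eq]
    push_cast
    simp only [smul_eq_mul]
    ring
  have hdiag : (∑ i, A i i * ((∫ y, ‖y‖ ^ 2 ∂(μ i) : ℝ) : ℂ)) = ((-(σ * η) * τ : ℝ) : ℂ) := by
    have e1 : ∀ i, A i i * ((∫ y, ‖y‖ ^ 2 ∂(μ i) : ℝ) : ℂ) =
        ((-(σ * η * η) * nsq (W.col i) : ℝ) : ℂ) := by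
      intro i
      have h2 : A i i = ((-(σ * η * η) * nsq (W.col i) : ℝ) : ℂ) := by
        rw [Complex.ofReal_mul, nsq_eq]
        rfl
      by_cases hi : i = j
      · have : nsq (W.col i) = 0 := by simp [nsq, hW, resz, hi]
        rw [h2, this]; simp
      · rw [hv i hi, h2]; simp
    rw [Finset.sum_congr rfl fun i _ => e1 i, ← Complex.ofReal_sum, ← Finset.mul_sum, hτ,
      tauM_eq]
    rw [← hη, ← hW]; congr 1; ring
  have key := hw n μ hμ A hop
  simp only [hquad, hdiag] at key
  have hsub : {b | η * nsq (W.mulVec b) ≤ τ / 2} ⊆ {b | σ * η * (τ / 2) ≤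
      (((-(σ * η) * (η * nsq (W.mulVec b)) : ℝ) : ℂ) - ((-(σ * η) * τ : ℝ) : ℂ)).re} := by
    intro b hb
    simp only [Set.mem_setOf_eq] at hb ⊢
    rw [← Complex.ofReal_sub, Complex.ofReal_re]
    have : σ * η * (η * nsq (W.mulVec b)) ≤ σ * η * (τ / 2) := by gcongr
    linarith
  have hmeas : Measurable fun b : n → ℂ => (((-(σ * η) * (η * nsq (W.mulVec b)) : ℝ) : ℂ)
      - ((-(σ * η) * τ : ℝ) : ℂ)).re := by
    unfold nsq Matrix.mulVec dotProduct
    fun_prop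
  calc _ ≤ _ := measure_mono hsub
    _ ≤ _ := ee_markov _ hmeas _
    _ ≤ ee (-(σ * η * (τ / 2))) * ee (C * ∑ i, ∑ j, ‖A i j‖ ^ 2) := by gcongr
    _ ≤ _ := by
      rw [← ee_add]
      apply ee_mono
      have h1 : C * ∑ i, ∑ j, ‖A i j‖ ^ 2 ≤ σ * (η * τ) / 4 := by
        calc _ ≤ C * (σ ^ 2 * (η * τ)) := by gcongr
          _ = (C * σ) * (σ * (η * τ)) := by ring
          _ ≤ 1 / 4 * (σ * (η * τ)) := by gcongr
          _ = _ := by ring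
      have h2 : σ * (η * T) ≤ σ * (η * τ) := by gcongr
      linarith

lemma indep_bound {Ω α β : Type*} [MeasurableSpace Ω] [MeasurableSpace α] [MeasurableSpace β]
    {P : Measure Ω} [IsProbabilityMeasure P] {Y : Ω → α} {M : Ω → β} (h : IndepFun Y M P)
    (hY : AEMeasurable Y P) (hM : AEMeasurable M P) {S : Set (α × β)} (hS : MeasurableSet S)
    {ε : ℝ≥0∞} (hb : ∀ ω, (P.map Y) {y | (y, M ω) ∈ S} ≤ ε) :
    P {ω | (Y ω, M ω) ∈ S} ≤ ε := by
  have h1 := (indepFun_iff_map_prod_eq_prod_map_map hY hM).1 h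
  have h2 : P {ω | (Y ω, M ω) ∈ S} = (P.map fun ω => (Y ω, M ω)) S :=
    (Measure.map_apply_of_aemeasurable (hY.prodMk hM) hS).symm
  have : IsProbabilityMeasure (P.map Y) := Measure.isProbabilityMeasure_map hY
  have : IsProbabilityMeasure (P.map M) := Measure.isProbabilityMeasure_map hM
  rw [h2, h1, Measure.prod_apply_symm hS,
    lintegral_map' (measurable_measure_prodMk_right hS).aemeasurable hM]
  calc _ ≤ ∫⁻ _, ε ∂P := lintegral_mono fun ω => hb ω
    _ = ε := by simp

/-- a matrix as a function -/
def mf {n : Type*} (H : Matrix n n ℂ) : n → n → ℂ := H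

lemma measurable_res {n : Type*} [Fintype n] [DecidableEq n] (z : ℂ) (i j : n) :
    Measurable fun H : n → n → ℂ => res (Matrix.of H) z i j := by
  unfold res
  have hc : Continuous fun H : n → n → ℂ => (Matrix.of H - z • (1 : Matrix n n ℂ)) :=
    Continuous.sub (g := fun _ => z • (1 : Matrix n n ℂ)) continuous_id continuous_const
  have h1 : Measurable fun H : n → n → ℂ => (Matrix.of H - z • (1 : Matrix n n ℂ)).det :=
    hc.matrix_det.measurable
  have h2 : Measurable fun H : n → n → ℂ =>
      (Matrix.of H - z • (1 : Matrix n n ℂ)).adjugate i j :=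
    (hc.matrix_adjugate.matrix_elem i j).measurable
  simp only [Matrix.inv_def, Ring.inverse_eq_inv', Matrix.smul_apply, smul_eq_mul]
  exact h1.inv.mul h2

lemma SG.conj {δ₀ D : ℝ} {μ : Measure ℂ} (h : SG δ₀ D μ) :
    SG δ₀ D (μ.map (starRingEnd ℂ)) := by
  have hm : Measurable (starRingEnd ℂ) := Complex.continuous_conj.measurable
  have := h.prob
  refine ⟨Measure.isProbabilityMeasure_map hm.aemeasurable, ?_, ?_⟩
  · rw [integral_map hm.aemeasurable (by fun_prop), integral_conj, h.mean, map_zero]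
  · rw [lintegral_map (by fun_prop) hm]
    simpa using h.exp

lemma var_conj {μ : Measure ℂ} :
    ∫ y, ‖y‖ ^ 2 ∂(μ.map (starRingEnd ℂ)) = ∫ y, ‖y‖ ^ 2 ∂μ := by
  have hm : Measurable (starRingEnd ℂ) := Complex.continuous_conj.measurable
  rw [integral_map hm.aemeasurable (by fun_prop)]
  simp

lemma SG.dirac {δ₀ D : ℝ} (hD : 1 ≤ D) : SG δ₀ D (Measure.dirac (0 : ℂ)) := by
  refine ⟨inferInstance, by simp, ?_⟩
  rw [lintegral_dirac]
  simpa [ee] using hD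

section
variable {Ω : Type} [MeasurableSpace Ω] {P : Measure Ω} {N : ℕ}
  {H : Ω → Matrix (Fin N) (Fin N) ℂ} {ν : Measure ℂ} {ν' : Measure ℝ}

lemma IsWignerMatrix.aem (h : IsWignerMatrix P N H ν ν') (i j : Fin N) :
    AEMeasurable (fun ω => H ω i j) P := by
  have := h.probν
  have := h.probν'
  have hN : (Real.sqrt N) ≠ 0 := by
    have : 0 < N := Fin.pos i
    positivity
  have key : ∀ i j : Fin N, i < j → AEMeasurable (fun ω => H ω i j) P := by
    intro i j hij
    have h1 : AEMeasurable (fun ω => (Real.sqrt N : ℂ) * H ω i j) P := by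
      apply AEMeasurable.of_map_ne_zero
      rw [h.offdiag i j hij]
      exact IsProbabilityMeasure.ne_zero ν
    have h2 := h1.const_mul ((Real.sqrt N : ℂ)⁻¹)
    refine h2.congr (Filter.Eventually.of_forall fun ω => ?_)
    have : (Real.sqrt N : ℂ) ≠ 0 := by exact_mod_cast hN
    field_simp
  rcases lt_trichotomy i j with hij | hij | hij
  · exact key i j hij
  · subst hij
    have h1 : AEMeasurable (fun ω => Real.sqrt N * (H ω i i).re) P := by
      apply AEMeasurable.of_map_ne_zero
      rw [h.diag i]
      exact IsProbabilityMeasure.ne_zero ν'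
    have h2 := (Complex.measurable_ofReal.comp_aemeasurable (h1.const_mul ((Real.sqrt N)⁻¹)))
    refine h2.congr (Filter.Eventually.of_forall fun ω => ?_)
    apply Complex.ext
    · simp only [Function.comp, Complex.ofReal_re]
      field_simp
    · simp [h.diag_real ω i]
  · have h1 := Complex.continuous_conj.measurable.comp_aemeasurable (key j i hij)
    refine h1.congr (Filter.Eventually.of_forall fun ω => ?_)
    exact (h.herm ω).apply i j

/-- the pair above the diagonal -/
def pr (k l : Fin N) : {p : Fin N × Fin N // p.1 ≤ p.2} :=
  if h : k ≤ l then ⟨(k, l), h⟩ else ⟨(l, k), (not_le.1 h).le⟩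

/-- conjugate when below the diagonal -/
def cj (k l : Fin N) (x : ℂ) : ℂ := if k ≤ l then x else (starRingEnd ℂ) x

lemma cj_pr {H : Matrix (Fin N) (Fin N) ℂ} (hH : H.IsHermitian) (k l : Fin N) :
    cj k l (H (pr k l).1.1 (pr k l).1.2) = H k l := by
  unfold cj pr
  split_ifs
  · rfl
  · exact hH.apply k l

lemma cj_meas (k l : Fin N) : Measurable (cj k l) := by
  unfold cj
  split_ifs
  · exact measurable_id
  · exact Complex.continuous_conj.measurable

lemma pr_mem (k l j : Fin N) : ((pr k l).1.1 = j ∨ (pr k l).1.2 = j) ↔ (k = j ∨ l = j) := by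
  unfold pr
  split_ifs
  · rfl
  · exact or_comm

lemma pr_inj (j : Fin N) : Function.Injective fun k => pr k j := by
  intro k l hkl
  have h1 := congrArg (fun p => p.1.1) hkl
  have h2 := congrArg (fun p => p.1.2) hkl
  simp only [pr] at h1 h2
  split_ifs at h1 h2 <;> simp_all

/-- scaled column -/
def ycol (H : Matrix (Fin N) (Fin N) ℂ) (j : Fin N) : Fin N → ℂ :=
  fun k => if k = j then 0 else (Real.sqrt N : ℂ) * H k j

lemma ycol_indep (h : IsWignerMatrix P N H ν ν') (j : Fin N) :
    IndepFun (fun ω => ycol (H ω) j) (fun ω => mf (minor (H ω) j)) P := by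
  classical
  set S : Finset {p : Fin N × Fin N // p.1 ≤ p.2} :=
    Finset.univ.filter fun p => p.1.1 = j ∨ p.1.2 = j with hS
  have h1 := iIndepFun.indepFun_finset₀ S Sᶜ disjoint_compl_right h.indep (fun p => h.aem _ _)
  have hm1 : ∀ k, pr k j ∈ S := fun k => by
    rw [hS, Finset.mem_filter]
    exact ⟨Finset.mem_univ _, (pr_mem k j j).2 (Or.inr rfl)⟩
  have hm2 : ∀ k l, ¬ (k = j ∨ l = j) → pr k l ∈ Sᶜ := fun k l hkl => by
    rw [Finset.mem_compl, hS, Finset.mem_filter]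
    exact fun hh => hkl ((pr_mem k l j).1 hh.2)
  let φ : (S → ℂ) → (Fin N → ℂ) := fun x k =>
    if k = j then 0 else (Real.sqrt N : ℂ) * cj k j (x ⟨pr k j, hm1 k⟩)
  let ψ : ((Sᶜ : Finset _) → ℂ) → (Fin N → Fin N → ℂ) := fun x k l =>
    if hkl : k = j ∨ l = j then 0 else cj k l (x ⟨pr k l, hm2 k l hkl⟩)
  have hφ : Measurable φ := by
    refine measurable_pi_iff.2 fun k => ?_
    by_cases hk : k = j
    · simp only [φ, if_pos hk]; exact measurable_const
    · simp only [φ, if_neg hk]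
      exact ((cj_meas k j).comp (measurable_pi_apply _)).const_mul _
  have hψ : Measurable ψ := by
    refine measurable_pi_iff.2 fun k => measurable_pi_iff.2 fun l => ?_
    by_cases hk : k = j ∨ l = j
    · simp only [ψ, dif_pos hk]; exact measurable_const
    · simp only [ψ, dif_neg hk]
      exact (cj_meas k l).comp (measurable_pi_apply _)
  have h2 := h1.comp hφ hψ
  convert h2 using 1
  · funext ω k
    simp only [ycol, φ, Function.comp, cj_pr (h.herm ω)]
  · funext ω k l
    simp only [mf, minor, ψ, Function.comp, cj_pr (h.herm ω)]
    split_ifs <;> rfl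

lemma ycol_aem (h : IsWignerMatrix P N H ν ν') (j k : Fin N) :
    AEMeasurable (fun ω => ycol (H ω) j k) P := by
  unfold ycol
  split_ifs
  · exact aemeasurable_const
  · exact (h.aem k j).const_mul _

lemma minor_aem (h : IsWignerMatrix P N H ν ν') (j : Fin N) :
    AEMeasurable (fun ω => mf (minor (H ω) j)) P := by
  refine aemeasurable_pi_iff.2 fun k => aemeasurable_pi_iff.2 fun l => ?_
  unfold mf minor
  split_ifs
  · exact aemeasurable_const
  · exact h.aem k l

lemma ycol_law (h : IsWignerMatrix P N H ν ν') (j : Fin N) :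
    P.map (fun ω => ycol (H ω) j) = Measure.pi fun k => P.map (fun ω => ycol (H ω) j k) := by
  have := h.prob
  refine (iIndepFun_iff_map_fun_eq_pi_map (f := fun k ω => ycol (H ω) j k)
    (fun k => ycol_aem h j k)).1 ?_
  have h1 := (h.indep.precomp (pr_inj j)).comp
    (fun k x => if k = j then 0 else (Real.sqrt N : ℂ) * cj k j x) (by
      intro k
      by_cases hk : k = j
      · simp only [if_pos hk]; exact measurable_const
      · simp only [if_neg hk]; exact (cj_meas k j).const_mul _)
  convert h1 using 1
  funext k ω
  simp only [ycol, Function.comp, cj_pr (h.herm ω)]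

lemma ycol_SG (h : IsWignerMatrix P N H ν ν') {δ₀ D : ℝ} (hδ : 0 < δ₀) (hν : SG δ₀ D ν)
    (j k : Fin N) :
    SG δ₀ D (P.map (fun ω => ycol (H ω) j k)) ∧
      (k ≠ j → ∫ y, ‖y‖ ^ 2 ∂(P.map (fun ω => ycol (H ω) j k)) = 1) := by
  have := h.prob
  rcases lt_trichotomy k j with hk | hk | hk
  · have : (fun ω => ycol (H ω) j k) = fun ω => (Real.sqrt N : ℂ) * H ω k j := by
      funext ω; simp [ycol, hk.ne]
    rw [this, h.offdiag k j hk]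
    exact ⟨hν, fun _ => h.var⟩
  · have : (fun ω => ycol (H ω) j k) = fun ω => (0 : ℂ) := by
      funext ω; simp [ycol, hk]
    rw [this, Measure.map_const, measure_univ, one_smul]
    exact ⟨SG.dirac (hν.one_le hδ), fun h => absurd hk h⟩
  · have e : (fun ω => ycol (H ω) j k) =
        (starRingEnd ℂ) ∘ fun ω => (Real.sqrt N : ℂ) * H ω j k := by
      funext ω
      simp only [ycol, if_neg hk.ne', Function.comp, map_mul, Complex.conj_ofReal]
      congr 1
      exact ((h.herm ω).apply k j).symm
    rw [e, ← AEMeasurable.map_map_of_aemeasurable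
      Complex.continuous_conj.measurable.aemeasurable ((h.aem j k).const_mul _),
      h.offdiag j k hk]
    exact ⟨hν.conj, fun _ => by rw [var_conj, h.var]⟩

end

lemma wigner_upper (δ₀ D : ℝ) (hδ : 0 < δ₀) (hD : 1 ≤ D) : ∃ σ : ℝ, 0 < σ ∧
    ∀ (N : ℕ) (Ω : Type) [MeasurableSpace Ω] (P : Measure Ω)
      (H : Ω → Matrix (Fin N) (Fin N) ℂ) (ν : Measure ℂ) (ν' : Measure ℝ), 0 < N →
      IsWignerMatrix P N H ν ν' → SG δ₀ D ν →
      ∀ (z : ℂ) (_ : 0 < z.im) (K : ℝ) (_ : 3 ≤ K) (_ : 2 ≤ N * K * z.im),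
      P {ω | N * K ≤ (Matrix.trace (res (H ω) z)).im} ≤
        N * ee (-(σ * (N * z.im * K))) := by
  obtain ⟨σ, hσ, lt⟩ := lower_tail δ₀ D hδ hD
  refine ⟨σ / 2, by positivity, ?_⟩
  intro N Ω _ P H ν ν' hN h hν z hz K hK hK2
  have := h.prob
  let S : Fin N → Set ((Fin N → ℂ) × (Fin N → Fin N → ℂ)) := fun j =>
    {p | N * K / 2 ≤ tauM (Matrix.of p.2) z j ∧
      z.im * nsq ((resz (Matrix.of p.2) z j).mulVec p.1) ≤ tauM (Matrix.of p.2) z j / 2}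
  have hmt : ∀ j, Measurable fun p : (Fin N → ℂ) × (Fin N → Fin N → ℂ) =>
      tauM (Matrix.of p.2) z j := by
    intro j
    unfold tauM
    refine Measurable.const_mul (Finset.measurable_sum _ fun k _ =>
      Finset.measurable_sum _ fun i _ => ?_) _
    exact ((measurable_res z i k).comp measurable_snd).norm.pow_const 2
  have hmq : ∀ j, Measurable fun p : (Fin N → ℂ) × (Fin N → Fin N → ℂ) =>
      z.im * nsq ((resz (Matrix.of p.2) z j).mulVec p.1) := by
    intro j
    unfold nsq Matrix.mulVec dotProduct resz
    refine Measurable.const_mul (Finset.measurable_sum _ fun k _ => ?_) _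
    refine (Measurable.norm (Finset.measurable_sum _ fun i _ => ?_)).pow_const 2
    refine Measurable.mul ?_ ((measurable_pi_apply i).comp measurable_fst)
    by_cases hi : i = j
    · simp only [if_pos hi]; exact measurable_const
    · simp only [if_neg hi]; exact (measurable_res z k i).comp measurable_snd
  have hS : ∀ j, MeasurableSet (S j) := fun j =>
    (measurableSet_le measurable_const (hmt j)).inter
      (measurableSet_le (hmq j) ((hmt j).div_const 2))
  have hsub : {ω | N * K ≤ (Matrix.trace (res (H ω) z)).im} ⊆
      ⋃ j, {ω | (ycol (H ω) j, mf (minor (H ω) j)) ∈ S j} := by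
    intro ω hω
    obtain ⟨j, h1, h2⟩ := exists_bad (h.herm ω) hz hK (by simpa using hN) (by simpa using hK2)
      (by simpa using hω)
    refine Set.mem_iUnion.2 ⟨j, ?_⟩
    simp only [Fintype.card_fin] at h1 h2
    refine ⟨h1, ?_⟩
    refine le_trans (le_of_eq ?_) h2
    have e : (resz (minor (H ω) j) z j).mulVec (ycol (H ω) j) =
        (Real.sqrt N : ℂ) • (res (minor (H ω) j) z).mulVec (colv (H ω) j) := by
      funext i
      simp only [Matrix.mulVec, dotProduct, Pi.smul_apply, smul_eq_mul, Finset.mul_sum]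
      refine Finset.sum_congr rfl fun k _ => ?_
      simp only [resz, ycol, colv]
      split_ifs
      · simp
      · ring
    change z.im * nsq ((resz (minor (H ω) j) z j).mulVec (ycol (H ω) j)) = _
    rw [e, nsq_smul, Complex.norm_real, Real.norm_eq_abs, sq_abs, Real.sq_sqrt (by positivity)]
    ring
  have hj : ∀ j, P {ω | (ycol (H ω) j, mf (minor (H ω) j)) ∈ S j} ≤
      ee (-(σ / 2 * (N * z.im * K))) := by
    intro j
    refine indep_bound (ycol_indep h j) (aemeasurable_pi_iff.2 fun k => ycol_aem h j k)
      (minor_aem h j) (hS j) fun ω => ?_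
    by_cases hτ : N * K / 2 ≤ tauM (minor (H ω) j) z j
    · rw [ycol_law h j]
      have := lt (Fin N) _ (fun k => (ycol_SG h hδ hν j k).1) j
        (fun k hk => (ycol_SG h hδ hν j k).2 hk) (minor (H ω) j) (minor_herm (h.herm ω) j) z hz _ hτ
      refine (measure_mono fun y hy => ?_).trans (this.trans (ee_mono (le_of_eq (by ring))))
      exact hy.2
    · have : {y | (y, mf (minor (H ω) j)) ∈ S j} = ∅ := by
        ext y
        simp only [Set.mem_setOf_eq, Set.mem_empty_iff_false, iff_false]
        exact fun hy => hτ hy.1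
      rw [this]; simp
  calc _ ≤ _ := measure_mono hsub
    _ ≤ ∑ j, P {ω | (ycol (H ω) j, mf (minor (H ω) j)) ∈ S j} :=
      measure_iUnion_fintype_le _ _
    _ ≤ ∑ _j : Fin N, ee (-(σ / 2 * (N * z.im * K))) := Finset.sum_le_sum fun j _ => hj j
    _ = _ := by simp

/-- centered quadratic form -/
def qf {n : Type*} [Fintype n] (A : Matrix n n ℂ) (b : n → ℂ) : ℂ :=
  ∑ i, ∑ j, (starRingEnd ℂ) (b i) * A i j * b j - ∑ i, A i i

lemma qf_smul {n : Type*} [Fintype n] (A : Matrix n n ℂ) (b : n → ℂ) (r : ℂ) :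
    qf (r • A) b = r * qf A b := by
  simp only [qf, mul_sub, Finset.mul_sum, Matrix.smul_apply, smul_eq_mul]
  congr 1
  refine Finset.sum_congr rfl fun i _ => Finset.sum_congr rfl fun j _ => by ring

lemma qf_meas {n : Type*} [Fintype n] (A : Matrix n n ℂ) : Measurable (qf A) := by
  unfold qf
  have : Measurable (starRingEnd ℂ) := Complex.continuous_conj.measurable
  fun_prop

lemma norm_cases (x : ℂ) (δ : ℝ) (h : δ ≤ ‖x‖) : δ / 2 ≤ ((1 : ℂ) * x).re ∨
    δ / 2 ≤ ((-1 : ℂ) * x).re ∨ δ / 2 ≤ (Complex.I * x).re ∨ δ / 2 ≤ (-Complex.I * x).re := by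
  by_contra hcon
  push Not at hcon
  obtain ⟨h1, h2, h3, h4⟩ := hcon
  simp at h1 h2 h3 h4
  have := Complex.norm_le_abs_re_add_abs_im x
  have a1 : |x.re| < δ / 2 := abs_lt.2 ⟨by linarith, h1⟩
  have a2 : |x.im| < δ / 2 := abs_lt.2 ⟨by linarith, h4⟩
  linarith

lemma quad_tail (δ₀ D : ℝ) (hδ : 0 < δ₀) (hD : 1 ≤ D) : ∃ ρ : ℝ, 0 < ρ ∧
    ∀ (N : ℕ) (_ : 0 < N) (μ : Measure ℂ) (_ : SG δ₀ D μ) (_ : ∫ y, ‖y‖ ^ 2 ∂μ = 1)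
    (H : Matrix (Fin N) (Fin N) ℂ) (_ : H.IsHermitian) (z : ℂ) (_ : 0 < z.im)
    (_ : 1 ≤ N * z.im) (δ : ℝ) (_ : 0 < δ)
    (_ : (Matrix.trace (res H z)).im ≤ N * (δ * Real.sqrt (N * z.im))),
    Measure.pi (fun _ : Fin N => μ) {b | δ ≤ ‖qf ((1 / (N : ℂ)) • res H z) b‖} ≤
      4 * ee (-(ρ * (δ * Real.sqrt (N * z.im)))) := by
  obtain ⟨c, C, hc, hC, hw⟩ := SG.hw δ₀ D hδ hD
  set σ : ℝ := min (min c 1) (1 / (4 * C)) with hσ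
  have hσ0 : 0 < σ := by positivity
  have hσ1 : σ ^ 2 ≤ c := by
    have h1 : σ ≤ c := (min_le_left _ _).trans (min_le_left _ _)
    have h2 : σ ≤ 1 := (min_le_left _ _).trans (min_le_right _ _)
    nlinarith
  have hσ2 : C * σ ≤ 1 / 4 := by
    have : σ ≤ 1 / (4 * C) := min_le_right _ _
    calc C * σ ≤ C * (1 / (4 * C)) := by gcongr
      _ = 1 / 4 := by field_simp
  refine ⟨σ / 4, by positivity, ?_⟩
  intro N hN μ hμ hv H hH z hz hL δ hδ0 htr
  have hN' : (0 : ℝ) < N := by exact_mod_cast hN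
  set L : ℝ := N * z.im with hLdef
  set t : ℝ := δ * Real.sqrt L with ht
  have hL0 : 0 < L := by linarith
  have hsL : Real.sqrt L ^ 2 = L := Real.sq_sqrt hL0.le
  set A : Matrix (Fin N) (Fin N) ℂ := (1 / (N : ℂ)) • res H z with hA
  set s : ℝ := σ * Real.sqrt L with hs
  have hs0 : 0 < s := by positivity
  have hnN : ‖(1 / (N : ℂ))‖ ^ 2 = 1 / (N : ℝ) ^ 2 := by
    rw [norm_div, norm_one, Complex.norm_natCast]; ring
  have hAop : ∀ x, L ^ 2 * nsq (A.mulVec x) ≤ nsq x := by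
    intro x
    rw [hA, Matrix.smul_mulVec, nsq_smul, hnN]
    refine le_trans (le_of_eq ?_) (res_bound hH hz x)
    rw [hLdef]; field_simp
  have hAF : L * ∑ i, ∑ j, ‖A i j‖ ^ 2 ≤ t := by
    have h1 := ward_trace hH hz
    have h2 : ∑ i, ∑ j, ‖A i j‖ ^ 2 = 1 / (N : ℝ) ^ 2 * ∑ i, ∑ j, ‖res H z i j‖ ^ 2 := by
      simp only [hA, Matrix.smul_apply, smul_eq_mul, norm_mul, mul_pow, hnN, Finset.mul_sum]
    have h3 : L * ∑ i, ∑ j, ‖A i j‖ ^ 2 = (Matrix.trace (res H z)).im / N := by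
      rw [h1, h2, hLdef]; field_simp
    rw [h3, div_le_iff₀ hN']
    linarith
  have main : ∀ θ : ℂ, ‖θ‖ = 1 → Measure.pi (fun _ : Fin N => μ) {b | δ / 2 ≤ (θ * qf A b).re} ≤
      ee (-(σ / 4 * t)) := by
    intro θ hθ
    set r : ℂ := (s : ℂ) * θ with hr
    have hr2 : ‖r‖ ^ 2 = σ ^ 2 * L := by
      rw [hr, norm_mul, hθ, mul_one, Complex.norm_real, Real.norm_eq_abs, sq_abs, hs, mul_pow, hsL]
    have hop : ∀ x, nsq ((r • A).mulVec x) ≤ c * nsq x := by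
      intro x
      rw [Matrix.smul_mulVec, nsq_smul, hr2]
      have h1 := hAop x
      have h0 := nsq_nonneg (A.mulVec x)
      calc σ ^ 2 * L * nsq (A.mulVec x) ≤ σ ^ 2 * L ^ 2 * nsq (A.mulVec x) := by
            gcongr; nlinarith
        _ = σ ^ 2 * (L ^ 2 * nsq (A.mulVec x)) := by ring
        _ ≤ σ ^ 2 * nsq x := by gcongr
        _ ≤ _ := by gcongr; exact nsq_nonneg x
    have hF : ∑ i, ∑ j, ‖(r • A) i j‖ ^ 2 ≤ σ ^ 2 * t := by
      have : ∑ i, ∑ j, ‖(r • A) i j‖ ^ 2 = σ ^ 2 * (L * ∑ i, ∑ j, ‖A i j‖ ^ 2) := by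
        simp only [Matrix.smul_apply, smul_eq_mul, norm_mul, mul_pow, hr2, Finset.mul_sum,
          mul_assoc]
      rw [this]; gcongr
    have key := hw (Fin N) (fun _ => μ) (fun _ => hμ) (r • A) hop
    have e : ∀ b : Fin N → ℂ, (∑ i, ∑ j, (starRingEnd ℂ) (b i) * (r • A) i j * b j -
        ∑ i, (r • A) i i * ((∫ y, ‖y‖ ^ 2 ∂μ : ℝ) : ℂ)).re = (r * qf A b).re := by
      intro b
      rw [← qf_smul, qf, hv]
      simp only [Complex.ofReal_one, mul_one]
    simp only [e] at key
    have hsub : {b | δ / 2 ≤ (θ * qf A b).re} ⊆ {b | s * (δ / 2) ≤ (r * qf A b).re} := by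
      intro b hb
      have hb' : δ / 2 ≤ (θ * qf A b).re := hb
      change s * (δ / 2) ≤ (r * qf A b).re
      rw [hr, mul_assoc (s : ℂ), Complex.re_ofReal_mul]
      gcongr
    calc _ ≤ _ := measure_mono hsub
      _ ≤ _ := ee_markov _ (Complex.measurable_re.comp ((qf_meas A).const_mul r)) _
      _ ≤ ee (-(s * (δ / 2))) * ee (C * ∑ i, ∑ j, ‖(r • A) i j‖ ^ 2) :=
        mul_le_mul' le_rfl key
      _ ≤ _ := by
        rw [← ee_add]
        apply ee_mono
        have ht0 : 0 < t := by positivity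
        have h1 : C * ∑ i, ∑ j, ‖(r • A) i j‖ ^ 2 ≤ σ * t / 4 := by
          calc _ ≤ C * (σ ^ 2 * t) := by gcongr
            _ = (C * σ) * (σ * t) := by ring
            _ ≤ 1 / 4 * (σ * t) := by gcongr
            _ = _ := by ring
        have h2 : s * (δ / 2) = σ * t / 2 := by rw [hs, ht]; ring
        rw [h2]; linarith
  have hsub : {b | δ ≤ ‖qf A b‖} ⊆ (({b | δ / 2 ≤ ((1 : ℂ) * qf A b).re} ∪
      {b | δ / 2 ≤ ((-1 : ℂ) * qf A b).re}) ∪ {b | δ / 2 ≤ (Complex.I * qf A b).re}) ∪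
      {b | δ / 2 ≤ (-Complex.I * qf A b).re} := by
    intro b hb
    rcases norm_cases (qf A b) δ hb with h | h | h | h
    · exact Or.inl (Or.inl (Or.inl h))
    · exact Or.inl (Or.inl (Or.inr h))
    · exact Or.inl (Or.inr h)
    · exact Or.inr h
  refine (measure_mono hsub).trans ?_
  refine (measure_union_le _ _).trans ?_
  refine (add_le_add ((measure_union_le _ _).trans (add_le_add ((measure_union_le _ _).trans
    (add_le_add (main 1 (by simp)) (main (-1) (by simp)))) (main Complex.I (by simp))))
    (main (-Complex.I) (by simp))).trans (le_of_eq ?_)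
  ring

lemma spectral_id {N : ℕ} (B : Matrix (Fin N) (Fin N) ℂ) (b : Fin N → ℂ) (lam : Fin N → ℝ)
    (v : Fin N → Fin N → ℂ) (z : ℂ) (hz : 0 < z.im)
    (h1 : ∀ α, B.mulVec (v α) = ((lam α : ℝ) : ℂ) • v α)
    (h2 : ∀ α β, (∑ i, (starRingEnd ℂ) (v α i) * v β i) = if α = β then 1 else 0) :
    (1 / (N : ℂ)) * ∑ α, (((‖∑ i, (starRingEnd ℂ) (b i) * v α i‖ ^ 2 : ℝ) : ℂ) - 1) /
      (((lam α : ℝ) : ℂ) - z) = qf ((1 / (N : ℂ)) • res B z) b := by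
  set V : Matrix (Fin N) (Fin N) ℂ := Matrix.of fun i α => v α i with hV
  set d : Fin N → ℂ := fun α => (((lam α : ℝ) : ℂ) - z)⁻¹ with hd
  have hne : ∀ α, ((lam α : ℝ) : ℂ) - z ≠ 0 := by
    intro α h
    have := congrArg Complex.im h
    simp at this
    linarith
  have hVV : V.conjTranspose * V = 1 := by
    ext α β
    simp only [Matrix.mul_apply, Matrix.conjTranspose_apply, Matrix.one_apply]
    exact h2 α β
  have hVV' : V * V.conjTranspose = 1 := mul_eq_one_comm.1 hVV
  have hBV : (B - z • (1 : Matrix (Fin N) (Fin N) ℂ)) * V =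
      V * Matrix.diagonal (fun α => ((lam α : ℝ) : ℂ) - z) := by
    ext i α
    rw [Matrix.mul_diagonal, Matrix.sub_mul, Matrix.smul_mul, Matrix.one_mul, Matrix.sub_apply,
      Matrix.smul_apply]
    have := congrFun (h1 α) i
    have e : (B * V) i α = B.mulVec (v α) i := rfl
    rw [e, this]
    simp only [Pi.smul_apply, smul_eq_mul, hV, Matrix.of_apply]
    ring
  have hR : res B z = V * Matrix.diagonal d * V.conjTranspose := by
    unfold res
    apply Matrix.inv_eq_right_inv
    rw [← Matrix.mul_assoc, ← Matrix.mul_assoc, hBV, Matrix.mul_assoc V, Matrix.diagonal_mul_diagonal]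
    have : (fun α => (((lam α : ℝ) : ℂ) - z) * d α) = fun _ => 1 := by
      funext α; exact mul_inv_cancel₀ (hne α)
    rw [this, Matrix.diagonal_one, Matrix.mul_one, hVV']
  rw [qf_smul]
  congr 1
  have htr : ∑ i, res B z i i = ∑ α, d α := by
    have : ∑ i, res B z i i = Matrix.trace (res B z) := rfl
    rw [this, hR, Matrix.trace_mul_comm, ← Matrix.mul_assoc, hVV, Matrix.one_mul,
      Matrix.trace_diagonal]
  have hq : ∑ i, ∑ j, (starRingEnd ℂ) (b i) * res B z i j * b j =
      ∑ α, d α * ((‖∑ i, (starRingEnd ℂ) (b i) * v α i‖ ^ 2 : ℝ) : ℂ) := by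
    have e1 : (∑ i, ∑ k, (starRingEnd ℂ) (b i) * res B z i k * b k) =
        dotProduct (star b) ((res B z).mulVec b) := by
      simp only [Matrix.mulVec, dotProduct, Finset.mul_sum, mul_assoc]
      rfl
    rw [e1, hR, ← Matrix.mulVec_mulVec, ← Matrix.mulVec_mulVec, Matrix.dotProduct_mulVec]
    simp only [dotProduct, Matrix.mulVec_diagonal]
    refine Finset.sum_congr rfl fun α _ => ?_
    have e2 : Matrix.vecMul (star b) V α = ∑ i, (starRingEnd ℂ) (b i) * v α i := rfl
    have e3 : V.conjTranspose.mulVec b α =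
        (starRingEnd ℂ) (∑ i, (starRingEnd ℂ) (b i) * v α i) := by
      simp only [Matrix.mulVec, dotProduct, map_sum, map_mul, Complex.conj_conj,
        Matrix.conjTranspose_apply, hV, Matrix.of_apply]
      exact Finset.sum_congr rfl fun i _ => mul_comm _ _
    rw [e2, e3]
    have e4 := Complex.mul_conj' (∑ i, (starRingEnd ℂ) (b i) * v α i)
    push_cast
    rw [← e4]; ring
  rw [qf, htr, hq, ← Finset.sum_sub_distrib]
  refine Finset.sum_congr rfl fun α _ => ?_
  rw [hd, div_eq_mul_inv]; ring

/-- **Concentration of the quadratic form `X = N⁻¹ Σ_α (ξ_α - 1)/(λ_α - z)`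
(Lemma `lm:x-old`).** -/
theorem stmt_13 :
    ∀ κ δ₀ D D' : ℝ, 0 < κ →
    ∃ c : ℝ, 0 < c ∧ ∃ N₀ : ℕ,
    ∀ (N : ℕ) (Ω : Type) (_ : MeasurableSpace Ω) (P : Measure Ω)
      (B : Ω → Matrix (Fin N) (Fin N) ℂ) (ν : Measure ℂ) (ν' : Measure ℝ)
      (bvec : Ω → Fin N → ℂ) (νb : Measure ℂ)
      (lam : Ω → Fin N → ℝ) (v : Ω → Fin N → Fin N → ℂ),
      N₀ ≤ N →
      IsWignerMatrix P N B ν ν' →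
      CondC1 ν ν' δ₀ D D' →
      -- the components of `b` are i.i.d. with a law `νb` satisfying C1,
      -- mean zero, variance one, and the symmetry condition (1.2)
      IsProbabilityMeasure νb →
      (∫⁻ z, ENNReal.ofReal (Real.exp (δ₀ * ‖z‖ ^ 2)) ∂νb) ≤ ENNReal.ofReal D →
      (∫ z, z ∂νb) = 0 →
      (∫ z, ‖z‖ ^ 2 ∂νb) = 1 →
      ComplexSymm νb →
      (∀ i : Fin N, P.map (fun ω => bvec ω i) = νb) →
      iIndepFun (fun (i : Fin N) (ω : Ω) => bvec ω i) P →
      -- `b` is independent of `B` (hence of its eigenvalues and eigenvectors)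
      IndepFun (fun ω => bvec ω)
        (fun ω => ((fun i j => B ω i j, lam ω, v ω) :
          (Fin N → Fin N → ℂ) × (Fin N → ℝ) × (Fin N → Fin N → ℂ))) P →
      -- `lam` and `v` are the eigenvalues and orthonormal eigenvectors of `B`
      (∀ ω α, (B ω).mulVec (v ω α) = ((lam ω α : ℝ) : ℂ) • v ω α) →
      (∀ ω α β, (∑ i, (starRingEnd ℂ) (v ω α i) * v ω β i) = if α = β then 1 else 0) →
      ∀ E : ℝ, E ∈ Set.Icc (-2 + κ) (2 - κ) →
      ∀ η : ℝ, 0 < η → (Real.log N) ^ 2 ≤ N * η →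
      ∀ δ : ℝ, 0 < δ →
        P {ω | δ ≤ ‖(1 / (N : ℂ)) * ∑ α,
            (((‖∑ i, (starRingEnd ℂ) (bvec ω i) * v ω α i‖ ^ 2 : ℝ) : ℂ) - 1) /
              (((lam ω α : ℝ) : ℂ) - ((E : ℂ) + η * Complex.I))‖}
          ≤ ENNReal.ofReal (5 * Real.exp
              (-(c * min (δ * Real.sqrt (N * η)) (δ ^ 2 * (N * η))))) := by
  intro κ δ₀ D D' _
  by_cases hδD : ¬ (0 < δ₀ ∧ 1 ≤ D)
  · refine ⟨1, one_pos, 0, ?_⟩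
    intro N Ω _ P B ν ν' bvec νb lam v _ hB hC1 hprob hexp hmean _ _ _ _ _ _ _
    exact absurd ⟨hC1.1, SG.one_le hC1.1 (⟨hprob, hmean, hexp⟩ : SG δ₀ D νb)⟩ hδD
  push Not at hδD
  obtain ⟨hδ₀, hD⟩ := hδD
  obtain ⟨σ, hσ, hup⟩ := wigner_upper δ₀ D hδ₀ hD
  obtain ⟨ρ, hρ, hqt⟩ := quad_tail δ₀ D hδ₀ hD
  set c : ℝ := min (1 / 3) ρ with hc
  have hc0 : 0 < c := by positivity
  have hc1 : c ≤ 1 / 3 := min_le_left _ _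
  have hc2 : c ≤ ρ := min_le_right _ _
  refine ⟨c, hc0, ⌈Real.exp (max 1 (1 / σ))⌉₊, ?_⟩
  intro N Ω _ P B ν ν' bvec νb lam v hN₀ hB hC1 hprob hexp hmean hvar _ hlaw hind hindB heig hon
    E _ η hη hNη δ hδ
  have hPr := hB.prob
  have hNe : Real.exp (max 1 (1 / σ)) ≤ N := (Nat.le_ceil _).trans (by exact_mod_cast hN₀)
  have hN' : (0 : ℝ) < N := (Real.exp_pos _).trans_le hNe
  have hN : 0 < N := by exact_mod_cast hN'
  have hlog : max 1 (1 / σ) ≤ Real.log N := (Real.le_log_iff_exp_le hN').2 hNe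
  set l := Real.log N with hl
  have hl1 : 1 ≤ l := (le_max_left _ _).trans hlog
  have hl2 : 1 ≤ σ * l := by
    have h := (le_max_right _ _).trans hlog
    rw [div_le_iff₀ hσ] at h
    linarith
  set z : ℂ := (E : ℂ) + η * Complex.I with hz
  have hzim : z.im = η := by simp [hz]
  have hz0 : 0 < z.im := by rw [hzim]; exact hη
  have hνb : SG δ₀ D νb := ⟨hprob, hmean, hexp⟩
  have hν : SG δ₀ D ν := ⟨hB.probν, hB.mean, hC1.2.1⟩
  set L : ℝ := N * η with hL
  have hL1 : 1 ≤ L := by nlinarith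
  set t : ℝ := δ * Real.sqrt L with ht
  have ht0 : 0 < t := by positivity
  have hmin : c * min t (δ ^ 2 * L) ≤ c * t := by
    gcongr; exact min_le_left _ _
  rcases lt_or_ge t 3 with ht3 | ht3
  · refine prob_le_one.trans ?_
    rw [← ENNReal.ofReal_one]
    apply ENNReal.ofReal_le_ofReal
    have h1 : -1 ≤ -(c * min t (δ ^ 2 * L)) := by nlinarith
    have h2 := Real.exp_le_exp.2 h1
    have h3 : Real.exp 1 < 2.7182818286 := Real.exp_one_lt_d9
    have h4 : Real.exp (-1) * Real.exp 1 = 1 := by rw [← Real.exp_add]; simp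
    nlinarith [Real.exp_pos (-1)]
  have hbm : ∀ i, AEMeasurable (fun ω => bvec ω i) P := by
    intro i
    apply AEMeasurable.of_map_ne_zero
    rw [hlaw i]
    exact IsProbabilityMeasure.ne_zero νb
  have hbl : P.map bvec = Measure.pi fun _ : Fin N => νb := by
    have h := (iIndepFun_iff_map_fun_eq_pi_map (f := fun i ω => bvec ω i) hbm).1 hind
    simp only [hlaw] at h
    exact h
  have hbm' : AEMeasurable bvec P := aemeasurable_pi_iff.2 hbm
  have hBm : AEMeasurable (fun ω => mf (B ω)) P :=
    aemeasurable_pi_iff.2 fun i => aemeasurable_pi_iff.2 fun j => hB.aem i j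
  have hi : IndepFun bvec (fun ω => mf (B ω)) P :=
    hindB.comp (φ := id) (ψ := Prod.fst) measurable_id measurable_fst
  simp only [fun ω => spectral_id (B ω) (bvec ω) (lam ω) (v ω) z hz0 (heig ω) (hon ω)]
  let S : Set ((Fin N → ℂ) × (Fin N → Fin N → ℂ)) :=
    {p | (Matrix.trace (res (Matrix.of p.2) z)).im ≤ N * t ∧
      δ ≤ ‖qf ((1 / (N : ℂ)) • res (Matrix.of p.2) z) p.1‖}
  have hmr : ∀ i j, Measurable fun p : (Fin N → ℂ) × (Fin N → Fin N → ℂ) =>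
      res (Matrix.of p.2) z i j := fun i j => (measurable_res z i j).comp measurable_snd
  have hS : MeasurableSet S := by
    have h1 : Measurable fun p : (Fin N → ℂ) × (Fin N → Fin N → ℂ) =>
        (Matrix.trace (res (Matrix.of p.2) z)).im := by
      unfold Matrix.trace
      exact Complex.measurable_im.comp (Finset.measurable_sum _ fun i _ => hmr i i)
    have h2 : Measurable fun p : (Fin N → ℂ) × (Fin N → Fin N → ℂ) =>
        qf ((1 / (N : ℂ)) • res (Matrix.of p.2) z) p.1 := by
      have hcj : Measurable (starRingEnd ℂ) := Complex.continuous_conj.measurable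
      unfold qf
      refine Measurable.sub (Finset.measurable_sum _ fun i _ => Finset.measurable_sum _ fun j _ => ?_)
        (Finset.measurable_sum _ fun i _ => (hmr i i).const_mul _)
      exact ((hcj.comp ((measurable_pi_apply i).comp measurable_fst)).mul
        ((hmr i j).const_mul _)).mul ((measurable_pi_apply j).comp measurable_fst)
    exact (measurableSet_le h1 measurable_const).inter (measurableSet_le measurable_const h2.norm)
  have hE1 : P {ω | N * t ≤ (Matrix.trace (res (B ω) z)).im} ≤ ee (-(c * t)) := by
    have h1 := hup N Ω P B ν ν' hN hB hν z hz0 t ht3 (by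
      rw [hzim]
      have : (N : ℝ) * t * η = L * t := by rw [hL]; ring
      rw [this]; nlinarith)
    rw [hzim] at h1
    refine h1.trans ?_
    have h2 : (N : ℝ≥0∞) = ee l := by
      rw [ee, hl, Real.exp_log hN', ENNReal.ofReal_natCast]
    rw [h2, ← ee_add]
    apply ee_mono
    have h3 : l * t ≤ σ * (L * t) := by
      calc l * t ≤ (σ * l) * (l * t) := by
            have : 0 ≤ l * t := by positivity
            nlinarith
        _ = σ * (l ^ 2 * t) := by ring
        _ ≤ _ := by gcongr
    have h4 : c * t ≤ 1 / 3 * t := by gcongr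
    change l + -(σ * (L * t)) ≤ -(c * t)
    nlinarith
  have hE2 : P {ω | (bvec ω, mf (B ω)) ∈ S} ≤ 4 * ee (-(c * t)) := by
    refine indep_bound hi hbm' hBm hS fun ω => ?_
    rw [hbl]
    by_cases htr : (Matrix.trace (res (B ω) z)).im ≤ N * t
    · have h1 := hqt N hN νb hνb hvar (B ω) (hB.herm ω) z hz0 (by rw [hzim]; exact hL1) δ hδ
        (by rw [hzim]; exact htr)
      rw [hzim] at h1
      refine (measure_mono fun y hy => hy.2).trans (h1.trans ?_)
      refine mul_le_mul' le_rfl (ee_mono ?_)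
      have : c * t ≤ ρ * t := by gcongr
      linarith
    · refine (measure_mono (t := ∅) fun y hy => ?_).trans (by simp)
      exact absurd hy.1 htr
  have hfin : 5 * ee (-(c * t)) ≤ ENNReal.ofReal (5 * Real.exp
      (-(c * min t (δ ^ 2 * L)))) := by
    rw [ENNReal.ofReal_mul (by norm_num)]
    have : ENNReal.ofReal 5 = 5 := by simp
    rw [this]
    refine mul_le_mul' le_rfl (ee_mono ?_)
    linarith
  refine le_trans ?_ hfin
  calc _ ≤ P ({ω | N * t ≤ (Matrix.trace (res (B ω) z)).im} ∪
        {ω | (bvec ω, mf (B ω)) ∈ S}) := by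
        refine measure_mono fun ω hω => ?_
        rcases le_total (N * t) (Matrix.trace (res (B ω) z)).im with h | h
        · exact Or.inl h
        · exact Or.inr ⟨h, hω⟩
    _ ≤ _ := measure_union_le _ _
    _ ≤ ee (-(c * t)) + 4 * ee (-(c * t)) := add_le_add hE1 hE2
    _ = _ := by ring

end
end

section
/- Let the components of the vector b ∈ ℂ^{N−1} be i.i.d. complex random variables with mean zero and variance 1 whose common law ν satisfies ∫ exp(δ₀|z|²) dν(z) < ∞ for some δ₀ > 0 and is either a product of i.i.d. real and imaginary parts or rotationally symmetric. Let {v_α}_{α ∈ 𝓘} be an orthonormal set in ℂ^{N−1} and set ξ_α = |b·v_α|². Then for any δ ≤ 1/2 there is a constant c > 0 such that P( Σ_{α ∈ 𝓘} ξ_α ≤ δ m ) ≤ e^{−c√m} holds for any index set 𝓘, where m = |𝓘| is its cardinality. -/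
open MeasureTheory ProbabilityTheory
open scoped ENNReal NNReal

noncomputable section

namespace S16

lemma taylor_bound (x : ℝ) :
    ‖Complex.exp (x * Complex.I) - (1 + x * Complex.I - x ^ 2 / 2)‖ ≤ 4 * |x| ^ 3 := by
  by_cases hx : |x| ≤ 1
  · have h := Complex.exp_bound (x := x * Complex.I) (by simpa using hx) (n := 3) (by norm_num)
    have e : ∑ m ∈ Finset.range 3, ((x : ℂ) * Complex.I) ^ m / (m.factorial : ℂ)
        = 1 + x * Complex.I - x ^ 2 / 2 := by
      simp [Finset.sum_range_succ, mul_pow, Nat.factorial]; ring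
    rw [e] at h
    refine h.trans ?_
    have : ‖(x : ℂ) * Complex.I‖ = |x| := by simp
    rw [this]
    have h3 : 0 ≤ |x| ^ 3 := by positivity
    norm_num [Nat.factorial]
    linarith
  · push Not at hx
    have h1 : ‖Complex.exp (x * Complex.I)‖ = 1 := Complex.norm_exp_ofReal_mul_I x
    have h2 : ‖(1 + x * Complex.I - x ^ 2 / 2 : ℂ)‖ ≤ 1 + |x| + |x| ^ 2 / 2 := by
      refine (norm_sub_le _ _).trans ?_
      refine add_le_add ((norm_add_le _ _).trans ?_) ?_ <;> simp
    refine (norm_sub_le _ _).trans ?_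
    rw [h1]
    have a : |x| ≤ |x| ^ 3 := by nlinarith [mul_pos (show 0 < |x| by linarith) (show 0 < |x| by linarith)]
    have b : |x| ^ 2 ≤ |x| ^ 3 := by nlinarith [sq_nonneg |x|]
    nlinarith

lemma pow4_le (δ₀ : ℝ) (h : 0 < δ₀) (y : ℝ) :
    y ^ 4 ≤ 2 / δ₀ ^ 2 * Real.exp (δ₀ * y ^ 2) := by
  have := Real.quadratic_le_exp_of_nonneg (x := δ₀ * y ^ 2) (by positivity)
  have h2 : (δ₀ * y ^ 2) ^ 2 / 2 ≤ Real.exp (δ₀ * y ^ 2) := by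
    have : 0 ≤ δ₀ * y ^ 2 := by positivity
    linarith
  calc y ^ 4 = 2 / δ₀ ^ 2 * ((δ₀ * y ^ 2) ^ 2 / 2) := by field_simp
    _ ≤ _ := by gcongr

/-- third moment constant -/
def M3 (δ₀ D : ℝ) : ℝ := 1 + 2 / δ₀ ^ 2 * D

lemma moments {δ₀ D : ℝ} (h0 : 0 < δ₀) (ν : Measure ℂ) [IsProbabilityMeasure ν]
    (hD : (∫⁻ z, ENNReal.ofReal (Real.exp (δ₀ * ‖z‖ ^ 2)) ∂ν) ≤ ENNReal.ofReal D) :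
    1 ≤ M3 δ₀ D ∧ Integrable (fun z : ℂ => ‖z‖ ^ 3) ν ∧ (∫ z, ‖z‖ ^ 3 ∂ν) ≤ M3 δ₀ D
     ∧ Integrable (fun z : ℂ => ‖z‖ ^ 2) ν ∧ Integrable (fun z : ℂ => z) ν := by
  have hm : AEStronglyMeasurable (fun z : ℂ => Real.exp (δ₀ * ‖z‖ ^ 2)) ν := by
    apply Continuous.aestronglyMeasurable; fun_prop
  have hint : Integrable (fun z : ℂ => Real.exp (δ₀ * ‖z‖ ^ 2)) ν := by
    refine ⟨hm, ?_⟩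
    rw [hasFiniteIntegral_iff_ofReal (ae_of_all _ fun z => (Real.exp_pos _).le)]
    exact hD.trans_lt ENNReal.ofReal_lt_top
  have hDpos : 0 < D := by
    by_contra hn
    rw [ENNReal.ofReal_of_nonpos (not_lt.mp hn)] at hD
    have h1 : (∫⁻ z, 1 ∂ν) ≤ ∫⁻ z, ENNReal.ofReal (Real.exp (δ₀ * ‖z‖ ^ 2)) ∂ν := by
      apply lintegral_mono
      intro z
      simp only [ENNReal.one_le_ofReal]
      apply Real.one_le_exp; positivity
    simp at h1
    have := h1.trans hD
    simp at this
  have hI : (∫ z, Real.exp (δ₀ * ‖z‖ ^ 2) ∂ν) ≤ D := by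
    rw [integral_eq_lintegral_of_nonneg_ae (ae_of_all _ fun z => (Real.exp_pos _).le) hm]
    exact ENNReal.toReal_le_of_le_ofReal hDpos.le hD
  have hg : Integrable (fun z : ℂ => 1 + 2 / δ₀ ^ 2 * Real.exp (δ₀ * ‖z‖ ^ 2)) ν :=
    (integrable_const _).add (hint.const_mul _)
  have bd : ∀ y : ℝ, 0 ≤ y → y ^ 3 ≤ 1 + y ^ 4 ∧ y ^ 2 ≤ 1 + y ^ 4 ∧ y ≤ 1 + y ^ 4 := by
    intro y hy
    refine ⟨?_, ?_, ?_⟩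
    · nlinarith [sq_nonneg (y ^ 2 - y), sq_nonneg (y-1), sq_nonneg (y^2 - 1), sq_nonneg (y^2-y/2)]
    · nlinarith [sq_nonneg (y ^ 2 - 1)]
    · nlinarith [sq_nonneg (y ^ 2 - 1/2), sq_nonneg (y-1/2)]
  have hi3 : Integrable (fun z : ℂ => ‖z‖ ^ 3) ν := by
    refine hg.mono' (by apply Continuous.aestronglyMeasurable; fun_prop) (ae_of_all _ fun z => ?_)
    rw [Real.norm_of_nonneg (by positivity)]
    exact (bd _ (norm_nonneg z)).1.trans (by gcongr; exact pow4_le δ₀ h0 _)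
  refine ⟨?_, hi3, ?_, ?_, ?_⟩
  · unfold M3; have : 0 ≤ 2 / δ₀ ^ 2 * D := by positivity
    linarith
  · refine (integral_mono hi3 hg fun z =>
      (bd _ (norm_nonneg z)).1.trans (by gcongr; exact pow4_le δ₀ h0 _)).trans ?_
    rw [integral_add (integrable_const _) (hint.const_mul _), integral_const_mul]
    simp only [integral_const, probReal_univ, smul_eq_mul, mul_one, M3]
    gcongr
  · refine hg.mono' (by apply Continuous.aestronglyMeasurable; fun_prop) (ae_of_all _ fun z => ?_)
    rw [Real.norm_of_nonneg (by positivity)]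
    exact (bd _ (norm_nonneg z)).2.1.trans (by gcongr; exact pow4_le δ₀ h0 _)
  · refine hg.mono' (by apply Continuous.aestronglyMeasurable; fun_prop) (ae_of_all _ fun z => ?_)
    exact (bd _ (norm_nonneg z)).2.2.trans (by gcongr; exact pow4_le δ₀ h0 _)

lemma prob_of_prod (μ : Measure ℝ) (h : (μ.prod μ) Set.univ = 1) : IsProbabilityMeasure μ := by
  rw [Measure.prod] at h
  by_cases hf : AEMeasurable (fun x : ℝ => Measure.map (Prod.mk x) μ) μ
  · rw [Measure.bind_apply MeasurableSet.univ hf] at h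
    have e : ∀ x : ℝ, (Measure.map (Prod.mk x) μ : Measure (ℝ × ℝ)) Set.univ = μ Set.univ := by
      intro x; rw [Measure.map_apply measurable_prodMk_left MeasurableSet.univ]; simp
    simp only [e, lintegral_const] at h
    refine ⟨?_⟩
    rcases lt_trichotomy (μ Set.univ) 1 with h1 | h1 | h1
    · have := ENNReal.mul_lt_mul h1 h1
      rw [h] at this; simp at this
    · exact h1
    · have := ENNReal.mul_lt_mul h1 h1
      rw [h] at this; simp at this
  · rw [Measure.bind, Measure.map_of_not_aemeasurable hf] at h
    simp at h

lemma second (ν : Measure ℂ) [IsProbabilityMeasure ν] (h2 : Integrable (fun z : ℂ => ‖z‖ ^ 2) ν)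
    (h1 : Integrable (fun z : ℂ => z) ν) (hmean : (∫ z, z ∂ν) = 0) (hvar : (∫ z, ‖z‖ ^ 2 ∂ν) = 1)
    (hs : ComplexSymm ν) :
    Integrable (fun z : ℂ => z.re ^ 2) ν ∧ Integrable (fun z : ℂ => z.im ^ 2) ν ∧
    Integrable (fun z : ℂ => z.re * z.im) ν ∧
    (∫ z, z.re ^ 2 ∂ν) = 1 / 2 ∧ (∫ z, z.im ^ 2 ∂ν) = 1 / 2 ∧ (∫ z, z.re * z.im ∂ν) = 0 := by
  have hn : ∀ z : ℂ, ‖z‖ ^ 2 = z.re ^ 2 + z.im ^ 2 := by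
    intro z; rw [← Complex.normSq_eq_norm_sq, Complex.normSq_apply]; ring
  have ire : Integrable (fun z : ℂ => z.re ^ 2) ν := by
    refine h2.mono' (by apply Continuous.aestronglyMeasurable; fun_prop) (ae_of_all _ fun z => ?_)
    rw [Real.norm_of_nonneg (by positivity), hn]; nlinarith [sq_nonneg z.im]
  have iim : Integrable (fun z : ℂ => z.im ^ 2) ν := by
    refine h2.mono' (by apply Continuous.aestronglyMeasurable; fun_prop) (ae_of_all _ fun z => ?_)
    rw [Real.norm_of_nonneg (by positivity), hn]; nlinarith [sq_nonneg z.re]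
  have ic : Integrable (fun z : ℂ => z.re * z.im) ν := by
    refine h2.mono' (by apply Continuous.aestronglyMeasurable; fun_prop) (ae_of_all _ fun z => ?_)
    rw [hn, Real.norm_eq_abs, abs_le]; constructor <;> nlinarith [sq_nonneg (z.re + z.im), sq_nonneg (z.re - z.im)]
  have hsum : (∫ z, z.re ^ 2 ∂ν) + (∫ z, z.im ^ 2 ∂ν) = 1 := by
    rw [← integral_add ire iim, ← hvar]; simp only [hn]
  suffices h : (∫ z, z.re ^ 2 ∂ν) = (∫ z, z.im ^ 2 ∂ν) ∧ (∫ z, z.re * z.im ∂ν) = 0 by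
    exact ⟨ire, iim, ic, by linarith [h.1], by linarith [h.1], h.2⟩
  rcases hs with ⟨μ, hμ⟩ | hrot
  · have hT : Measurable (fun p : ℝ × ℝ => (p.1 : ℂ) + p.2 * Complex.I) := by fun_prop
    have hμp : IsProbabilityMeasure μ := by
      apply prob_of_prod
      have : ν Set.univ = 1 := measure_univ
      rwa [hμ, Measure.map_apply hT MeasurableSet.univ, Set.preimage_univ] at this
    have tr : ∀ f : ℂ → ℝ, Continuous f →
        (∫ z, f z ∂ν) = ∫ p : ℝ × ℝ, f ((p.1 : ℂ) + p.2 * Complex.I) ∂(μ.prod μ) := by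
      intro f hf
      rw [hμ, integral_map hT.aemeasurable hf.aestronglyMeasurable]
    have hre : (∫ z, z.re ∂ν) = 0 := by
      have := integral_re (𝕜 := ℂ) h1
      rw [hmean] at this; simpa using this
    have e1 := tr (fun z => z.re ^ 2) (by fun_prop)
    have e2 := tr (fun z => z.im ^ 2) (by fun_prop)
    have e3 := tr (fun z => z.re * z.im) (by fun_prop)
    have e4 := tr (fun z => z.re) (by fun_prop)
    simp at e1 e2 e3 e4
    have f1 := integral_prod_mul (μ := μ) (ν := μ) (fun x : ℝ => x ^ 2) (fun _ => (1 : ℝ))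
    have f2 := integral_prod_mul (μ := μ) (ν := μ) (fun _ => (1 : ℝ)) (fun x : ℝ => x ^ 2)
    have f3 := integral_prod_mul (μ := μ) (ν := μ) (fun x : ℝ => x) (fun x : ℝ => x)
    have f4 := integral_prod_mul (μ := μ) (ν := μ) (fun x : ℝ => x) (fun _ => (1 : ℝ))
    simp at f1 f2 f3 f4
    constructor
    · rw [e1, e2, f1, f2]
    · rw [e3, f3, ← f4, ← e4, hre]; simp
  · have hr := hrot (Real.pi / 2)
    have : Complex.exp ((Real.pi / 2 : ℝ) * Complex.I) = Complex.I := by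
      push_cast; exact Complex.exp_pi_div_two_mul_I
    rw [this] at hr
    have tr : ∀ f : ℂ → ℝ, Continuous f → (∫ z, f z ∂ν) = ∫ z, f (Complex.I * z) ∂ν := by
      intro f hf
      conv_lhs => rw [← hr]
      rw [integral_map (by fun_prop) hf.aestronglyMeasurable]
    have e1 := tr (fun z => z.re ^ 2) (by fun_prop)
    have e3 := tr (fun z => z.re * z.im) (by fun_prop)
    simp [integral_neg] at e1 e3
    refine ⟨e1, ?_⟩
    have : (∫ z : ℂ, z.im * z.re ∂ν) = ∫ z : ℂ, z.re * z.im ∂ν := by simp only [mul_comm]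
    linarith

lemma charFun_bd {δ₀ D : ℝ} (h0 : 0 < δ₀) (ν : Measure ℂ) [IsProbabilityMeasure ν]
    (hD : (∫⁻ z, ENNReal.ofReal (Real.exp (δ₀ * ‖z‖ ^ 2)) ∂ν) ≤ ENNReal.ofReal D)
    (hmean : (∫ z, z ∂ν) = 0) (hvar : (∫ z, ‖z‖ ^ 2 ∂ν) = 1)
    (hs : ComplexSymm ν) (w : ℂ) (hw : ‖w‖ ≤ 1) (hw2 : 4 * M3 δ₀ D * ‖w‖ ≤ 1 / 48) :
    ‖charFun ν w‖ ≤ Real.exp (-(11 / 48) * ‖w‖ ^ 2) := by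
  obtain ⟨hM, i3, m3, i2, i1⟩ := moments h0 ν hD
  obtain ⟨ire, iim, ic, ere, eim, ec⟩ := second ν i2 i1 hmean hvar hs
  have hn : ‖w‖ ^ 2 = w.re ^ 2 + w.im ^ 2 := by
    rw [← Complex.normSq_eq_norm_sq, Complex.normSq_apply]; ring
  have hin : ∀ z : ℂ, inner ℝ z w = z.re * w.re + z.im * w.im := by
    intro z; rw [Complex.inner]; simp; ring
  have hmre : (∫ z, z.re ∂ν) = 0 := by
    have := integral_re (𝕜 := ℂ) i1
    rw [hmean] at this; simpa using this
  have hmim : (∫ z, z.im ∂ν) = 0 := by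
    have := integral_im (𝕜 := ℂ) i1
    rw [hmean] at this; simpa using this
  have i1r : Integrable (fun z : ℂ => z.re) ν := i1.re
  have i1i : Integrable (fun z : ℂ => z.im) ν := i1.im
  have J1 : Integrable (fun z : ℂ => (inner ℝ z w : ℝ)) ν := by
    simp only [hin]; exact (i1r.mul_const _).add (i1i.mul_const _)
  have E1 : (∫ z : ℂ, (inner ℝ z w : ℝ) ∂ν) = 0 := by
    simp only [hin]
    rw [integral_add (i1r.mul_const _) (i1i.mul_const _), integral_mul_const, integral_mul_const, hmre, hmim]; simp
  have hsq : ∀ z : ℂ, (inner ℝ z w : ℝ) ^ 2 =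
      z.re ^ 2 * w.re ^ 2 + z.im ^ 2 * w.im ^ 2 + z.re * z.im * (2 * w.re * w.im) := by
    intro z; rw [hin]; ring
  have J2 : Integrable (fun z : ℂ => (inner ℝ z w : ℝ) ^ 2) ν := by
    simp only [hsq]
    exact ((ire.mul_const _).add (iim.mul_const _)).add (ic.mul_const _)
  have E2 : (∫ z : ℂ, (inner ℝ z w : ℝ) ^ 2 ∂ν) = ‖w‖ ^ 2 / 2 := by
    simp only [hsq]
    have JJ : Integrable (fun z : ℂ => z.re ^ 2 * w.re ^ 2 + z.im ^ 2 * w.im ^ 2) ν :=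
      (ire.mul_const _).add (iim.mul_const _)
    rw [integral_add JJ (ic.mul_const _),
      integral_add (ire.mul_const _) (iim.mul_const _), integral_mul_const, integral_mul_const,
      integral_mul_const, ere, eim, ec, hn]
    ring
  have J1c : Integrable (fun z : ℂ => ((inner ℝ z w : ℝ) : ℂ)) ν := J1.ofReal
  have J2c : Integrable (fun z : ℂ => ((inner ℝ z w : ℝ) : ℂ) ^ 2) ν := by
    have := J2.ofReal (𝕜 := ℂ)
    simpa using this
  have E1c : (∫ z : ℂ, ((inner ℝ z w : ℝ) : ℂ) ∂ν) = 0 := by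
    have := integral_ofReal (𝕜 := ℂ) (μ := ν) (f := fun z : ℂ => (inner ℝ z w : ℝ))
    rw [E1] at this; simpa using this
  have E2c : (∫ z : ℂ, ((inner ℝ z w : ℝ) : ℂ) ^ 2 ∂ν) = ((‖w‖ ^ 2 / 2 : ℝ) : ℂ) := by
    have := integral_ofReal (𝕜 := ℂ) (μ := ν) (f := fun z : ℂ => (inner ℝ z w : ℝ) ^ 2)
    rw [E2] at this; simpa using this
  have Jp : Integrable (fun z : ℂ => (1 + ((inner ℝ z w : ℝ) : ℂ) * Complex.I
      - ((inner ℝ z w : ℝ) : ℂ) ^ 2 / 2)) ν :=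
    ((integrable_const _).add (J1c.mul_const _)).sub (J2c.div_const _)
  have Ep : (∫ z : ℂ, (1 + ((inner ℝ z w : ℝ) : ℂ) * Complex.I
      - ((inner ℝ z w : ℝ) : ℂ) ^ 2 / 2) ∂ν) = ((1 - ‖w‖ ^ 2 / 4 : ℝ) : ℂ) := by
    have JJ : Integrable (fun z : ℂ => 1 + ((inner ℝ z w : ℝ) : ℂ) * Complex.I) ν :=
      (integrable_const _).add (J1c.mul_const _)
    rw [integral_sub JJ (J2c.div_const _),
      integral_add (integrable_const _) (J1c.mul_const _), integral_mul_const, integral_div, E1c, E2c]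
    simp; ring
  have Je : Integrable (fun z : ℂ => Complex.exp (((inner ℝ z w : ℝ) : ℂ) * Complex.I)) ν := by
    refine (integrable_const (1 : ℝ)).mono' (by apply Continuous.aestronglyMeasurable; fun_prop)
      (ae_of_all _ fun z => ?_)
    rw [Complex.norm_exp_ofReal_mul_I]
  have key : ‖charFun ν w - ((1 - ‖w‖ ^ 2 / 4 : ℝ) : ℂ)‖ ≤ 4 * M3 δ₀ D * ‖w‖ ^ 3 := by
    rw [charFun_apply, ← Ep, ← integral_sub Je Jp]
    refine (norm_integral_le_of_norm_le (g := fun z => 4 * (‖z‖ ^ 3 * ‖w‖ ^ 3))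
      ((i3.mul_const _).const_mul _) (ae_of_all _ fun z => ?_)).trans ?_
    · refine (taylor_bound _).trans ?_
      rw [← mul_pow]
      gcongr
      exact abs_real_inner_le_norm z w
    · rw [integral_const_mul, integral_mul_const]
      have : (∫ z, ‖z‖ ^ 3 ∂ν) * ‖w‖ ^ 3 ≤ M3 δ₀ D * ‖w‖ ^ 3 := by gcongr
      linarith
  have hw0 := norm_nonneg w
  have hw1 : ‖w‖ ^ 2 ≤ 1 := by nlinarith
  have : ‖charFun ν w‖ ≤ (1 - ‖w‖ ^ 2 / 4) + 4 * M3 δ₀ D * ‖w‖ ^ 3 := by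
    have h := norm_le_norm_add_norm_sub' (charFun ν w) ((1 - ‖w‖ ^ 2 / 4 : ℝ) : ℂ)
    rw [Complex.norm_real, Real.norm_of_nonneg (by linarith)] at h
    linarith
  refine this.trans ?_
  have h3 : 4 * M3 δ₀ D * ‖w‖ ^ 3 ≤ 1 / 48 * ‖w‖ ^ 2 := by
    have : 4 * M3 δ₀ D * ‖w‖ ^ 3 = (4 * M3 δ₀ D * ‖w‖) * ‖w‖ ^ 2 := by ring
    rw [this]; gcongr
  have := Real.add_one_le_exp (-(11 / 48) * ‖w‖ ^ 2)
  linarith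

abbrev G (κ : Type) [Fintype κ] : Measure (κ → ℝ) := Measure.pi (fun _ : κ => gaussianReal 0 1)

lemma G_char {κ : Type} [Fintype κ] (c : κ → ℝ) :
    (∫ x, Complex.exp (((∑ k, x k * c k : ℝ) : ℂ) * Complex.I) ∂(G κ))
      = ((Real.exp (-(∑ k, c k ^ 2) / 2) : ℝ) : ℂ) := by
  have e : ∀ x : κ → ℝ, Complex.exp (((∑ k, x k * c k : ℝ) : ℂ) * Complex.I)
      = ∏ k, Complex.exp ((c k : ℂ) * (x k : ℂ) * Complex.I) := by
    intro x; rw [← Complex.exp_sum]; congr 1; push_cast; rw [Finset.sum_mul]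
    exact Finset.sum_congr rfl fun k _ => by ring
  simp only [e]
  rw [integral_fintype_prod_eq_prod (𝕜 := ℂ) (fun k (y : ℝ) => Complex.exp ((c k : ℂ) * (y : ℂ) * Complex.I))]
  simp only [← charFun_apply_real, charFun_gaussianReal]
  rw [← Complex.exp_sum, Complex.ofReal_exp]
  congr 1
  push_cast
  rw [neg_div, Finset.sum_div, ← Finset.sum_neg_distrib]
  exact Finset.sum_congr rfl fun k _ => by simp

lemma g_sq (a : ℝ) (ha : 0 ≤ a) : (∫ x, Real.exp (-a * x ^ 2) ∂(gaussianReal 0 1)) ≤ Real.exp (-a + a ^ 2) := by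
  rw [integral_gaussianReal_eq_integral_smul (by norm_num)]
  have e : ∀ x : ℝ, gaussianPDFReal 0 1 x • Real.exp (-a * x ^ 2)
      = (√(2 * Real.pi))⁻¹ * Real.exp (-(1 / 2 + a) * x ^ 2) := by
    intro x
    simp only [gaussianPDFReal, smul_eq_mul, NNReal.coe_one, mul_one, sub_zero]
    rw [mul_assoc, ← Real.exp_add]; congr 2; ring
  simp only [e]
  rw [integral_const_mul, integral_gaussian, ← Real.sqrt_inv, ← Real.sqrt_mul (by positivity)]
  have : (2 * Real.pi)⁻¹ * (Real.pi / (1 / 2 + a)) = (1 + 2 * a)⁻¹ := by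
    field_simp
    try ring
  rw [this]
  apply Real.sqrt_le_iff.mpr
  refine ⟨(Real.exp_pos _).le, ?_⟩
  rw [← Real.exp_nat_mul]
  have h := Real.le_log_one_add_of_nonneg (x := 2 * a) (by positivity)
  rw [show (1 + 2 * a)⁻¹ = Real.exp (-Real.log (1 + 2 * a)) by
    rw [Real.exp_neg, Real.exp_log (by positivity)]]
  apply Real.exp_le_exp.mpr
  have h2 : 2 * a - 2 * a ^ 2 ≤ 2 * (2 * a) / (2 * a + 2) := by
    rw [le_div_iff₀ (by positivity)]
    nlinarith [pow_nonneg ha 3]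
  push_cast
  linarith

lemma G_sq {κ : Type} [Fintype κ] (a : ℝ) (ha : 0 ≤ a) :
    (∫ x, Real.exp (-a * ∑ k, x k ^ 2) ∂(G κ)) ≤ Real.exp ((-a + a ^ 2) * Fintype.card κ) := by
  have e : ∀ x : κ → ℝ, Real.exp (-a * ∑ k, x k ^ 2) = ∏ k, Real.exp (-a * x k ^ 2) := by
    intro x; rw [← Real.exp_sum, Finset.mul_sum]
  simp only [e]
  rw [integral_fintype_prod_eq_prod (𝕜 := ℝ) (fun _ (y : ℝ) => Real.exp (-a * y ^ 2))]
  refine (Finset.prod_le_prod (fun _ _ => integral_nonneg fun _ => (Real.exp_pos _).le)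
    fun _ _ => g_sq a ha) |>.trans ?_
  rw [Finset.prod_const, ← Real.exp_nat_mul, Finset.card_univ, mul_comm]

lemma G_tail {κ : Type} [Fintype κ] (c : κ → ℝ) (A ρ : ℝ) (hρ : 0 ≤ ρ) (hA : ∑ k, c k ^ 2 = A)
    (hA0 : 0 < A) :
    (G κ).real {x | ρ ≤ ∑ k, x k * c k} ≤ Real.exp (-(ρ ^ 2 / (2 * A))) := by
  set t := ρ / A with ht
  have e : ∀ x : κ → ℝ, Real.exp (t * ∑ k, x k * c k) = ∏ k, Real.exp ((t * c k) * x k) := by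
    intro x; rw [← Real.exp_sum, Finset.mul_sum]; congr 1
    exact Finset.sum_congr rfl fun k _ => by ring
  have hint : Integrable (fun x : κ → ℝ => Real.exp (t * ∑ k, x k * c k)) (G κ) := by
    simp only [e]
    exact Integrable.fintype_prod (f := fun k (y : ℝ) => Real.exp ((t * c k) * y))
      (fun k => integrable_exp_mul_gaussianReal _)
  refine (measure_ge_le_exp_mul_mgf ρ (by positivity) hint).trans ?_
  have hm : mgf (fun x : κ → ℝ => ∑ k, x k * c k) (G κ) t = Real.exp (t ^ 2 * A / 2) := by
    simp only [mgf, e]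
    rw [integral_fintype_prod_eq_prod (𝕜 := ℝ) (fun k (y : ℝ) => Real.exp ((t * c k) * y))]
    have : ∀ k, (∫ y, Real.exp ((t * c k) * y) ∂(gaussianReal 0 1)) = Real.exp ((t * c k) ^ 2 / 2) := by
      intro k
      have := mgf_gaussianReal (p := gaussianReal 0 1) (X := id) (μ := 0) (v := 1) (by simp) (t * c k)
      simpa [mgf] using this
    simp only [this]
    rw [← Real.exp_sum, ← hA, Finset.mul_sum, Finset.sum_div]
    congr 1
    exact Finset.sum_congr rfl fun k _ => by ring
  rw [hm, ← Real.exp_add]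
  apply Real.exp_le_exp.mpr
  rw [ht]
  apply le_of_eq
  field_simp
  ring

/-- the linear image of the Gaussian vector -/
def uu {ι J : Type} [Fintype ι] (v : ι → J → ℂ) (x : ι ⊕ ι → ℝ) (i : J) : ℂ :=
  ∑ α, ((x (Sum.inl α) : ℂ) - x (Sum.inr α) * Complex.I) * v α i

lemma uu_re {ι J : Type} [Fintype ι] (v : ι → J → ℂ) (x : ι ⊕ ι → ℝ) (i : J) :
    (uu v x i).re = ∑ k, x k * Sum.elim (fun α => (v α i).re) (fun α => (v α i).im) k := by
  rw [Fintype.sum_sum_type, uu, Complex.re_sum, ← Finset.sum_add_distrib]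
  exact Finset.sum_congr rfl fun α _ => by simp

lemma uu_im {ι J : Type} [Fintype ι] (v : ι → J → ℂ) (x : ι ⊕ ι → ℝ) (i : J) :
    (uu v x i).im = ∑ k, x k * Sum.elim (fun α => (v α i).im) (fun α => -(v α i).re) k := by
  rw [Fintype.sum_sum_type, uu, Complex.im_sum, ← Finset.sum_add_distrib]
  exact Finset.sum_congr rfl fun α _ => by simp; try ring

lemma nsq (z : ℂ) : ‖z‖ ^ 2 = z.re ^ 2 + z.im ^ 2 := by
  rw [← Complex.normSq_eq_norm_sq, Complex.normSq_apply]; ring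

lemma uu_inner {ι J : Type} [Fintype ι] [Fintype J] (v : ι → J → ℂ) (x : ι ⊕ ι → ℝ) (b : J → ℂ) :
    ∑ i, inner ℝ (b i) (uu v x i) = ∑ k, x k * Sum.elim
      (fun α => (∑ i, (starRingEnd ℂ) (b i) * v α i).re)
      (fun α => (∑ i, (starRingEnd ℂ) (b i) * v α i).im) k := by
  rw [Fintype.sum_sum_type, ← Finset.sum_add_distrib]
  simp only [Sum.elim_inl, Sum.elim_inr, Complex.re_sum, Complex.im_sum, Finset.mul_sum,
    ← Finset.sum_add_distrib, Complex.inner, uu, Finset.sum_mul]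
  rw [Finset.sum_comm]
  refine Finset.sum_congr rfl fun α _ => Finset.sum_congr rfl fun i _ => ?_
  simp; ring

section
variable {ι J : Type} [Fintype ι] [DecidableEq ι] [Fintype J] (v : ι → J → ℂ)

lemma uu_norm
    (hv : ∀ α β : ι, (∑ i, (starRingEnd ℂ) (v α i) * v β i) = if α = β then 1 else 0) (x : ι ⊕ ι → ℝ) : ∑ i, ‖uu v x i‖ ^ 2 = ∑ k, x k ^ 2 := by
  have h : ((∑ i, ‖uu v x i‖ ^ 2 : ℝ) : ℂ) = ((∑ k, x k ^ 2 : ℝ) : ℂ) := by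
    push_cast
    simp only [← Complex.conj_mul', uu, map_sum, map_mul, Finset.sum_mul, Finset.mul_sum]
    rw [Finset.sum_comm]
    have : ∀ α : ι, ∑ i, ∑ β, (starRingEnd ℂ) ((x (Sum.inl α) : ℂ) - x (Sum.inr α) * Complex.I) *
        (starRingEnd ℂ) (v α i) * (((x (Sum.inl β) : ℂ) - x (Sum.inr β) * Complex.I) * v β i)
        = (x (Sum.inl α) : ℂ) ^ 2 + (x (Sum.inr α) : ℂ) ^ 2 := by
      intro α
      rw [Finset.sum_comm]
      have : ∀ β : ι, ∑ i, (starRingEnd ℂ) ((x (Sum.inl α) : ℂ) - x (Sum.inr α) * Complex.I) *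
        (starRingEnd ℂ) (v α i) * (((x (Sum.inl β) : ℂ) - x (Sum.inr β) * Complex.I) * v β i)
        = (starRingEnd ℂ) ((x (Sum.inl α) : ℂ) - x (Sum.inr α) * Complex.I) *
          ((x (Sum.inl β) : ℂ) - x (Sum.inr β) * Complex.I) * if α = β then 1 else 0 := by
        intro β
        rw [← hv α β, Finset.mul_sum]
        exact Finset.sum_congr rfl fun i _ => by ring
      simp only [this]
      simp
      ring_nf
      simp
    have h2 := Finset.sum_congr rfl (fun α (_ : α ∈ (Finset.univ : Finset ι)) => this α)
    rw [Fintype.sum_sum_type, ← Finset.sum_add_distrib, ← h2]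
    rw [Finset.sum_comm]
    rw [Finset.sum_comm (s := (Finset.univ : Finset ι)) (t := (Finset.univ : Finset J))]
    refine Finset.sum_congr rfl fun i _ => ?_
    first
    | rfl
    | exact Finset.sum_comm
  exact_mod_cast h

lemma a_le
    (hv : ∀ α β : ι, (∑ i, (starRingEnd ℂ) (v α i) * v β i) = if α = β then 1 else 0) (i : J) : ∑ α, ‖v α i‖ ^ 2 ≤ 1 := by
  classical
  have ho : Orthonormal ℂ (fun α => (WithLp.toLp 2 (v α) : EuclideanSpace ℂ J)) := by
    rw [orthonormal_iff_ite]
    intro α β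
    rw [← hv α β, PiLp.inner_apply]
    exact Finset.sum_congr rfl fun i _ => by simp [mul_comm]
  have := ho.sum_inner_products_le (s := Finset.univ) (EuclideanSpace.single i (1 : ℂ))
  simpa [EuclideanSpace.inner_single_right] using this

lemma a_sum
    (hv : ∀ α β : ι, (∑ i, (starRingEnd ℂ) (v α i) * v β i) = if α = β then 1 else 0) : ∑ i, ∑ α, ‖v α i‖ ^ 2 = Fintype.card ι := by
  rw [Finset.sum_comm]
  have : ∀ α, ∑ i, ‖v α i‖ ^ 2 = 1 := by
    intro α
    have h := hv α α
    simp only [Complex.conj_mul', if_true] at h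
    exact_mod_cast h
  simp [this]

lemma exp_ineq (a x : ℝ) (ha : 0 < a) (ha1 : a ≤ 1) (hx : 1 ≤ x) :
    Real.exp (-(x / a)) ≤ a * Real.exp (-x) := by
  have h : Real.log a⁻¹ ≤ x * (a⁻¹ - 1) := by
    have h1 := Real.log_le_sub_one_of_pos (inv_pos.mpr ha)
    have h2 : 1 ≤ a⁻¹ := (one_le_inv₀ ha).mpr ha1
    nlinarith
  rw [Real.log_inv] at h
  calc Real.exp (-(x / a)) ≤ Real.exp (Real.log a + -x) := by
        apply Real.exp_le_exp.mpr; rw [div_eq_mul_inv]; linarith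
    _ = a * Real.exp (-x) := by rw [Real.exp_add, Real.exp_log ha]

lemma bad_one
    (hv : ∀ α β : ι, (∑ i, (starRingEnd ℂ) (v α i) * v β i) = if α = β then 1 else 0) (R : ℝ) (hR : 4 ≤ R ^ 2) (hR0 : 0 < R) (i : J) :
    (G (ι ⊕ ι)).real {x | R < ‖uu v x i‖} ≤ 4 * (∑ α, ‖v α i‖ ^ 2) * Real.exp (-(R ^ 2 / 4)) := by
  set A := ∑ α, ‖v α i‖ ^ 2 with hAd
  have hA1 : A ≤ 1 := a_le v hv i
  have hA0 : 0 ≤ A := Finset.sum_nonneg fun _ _ => by positivity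
  rcases hA0.eq_or_lt with h0 | hpos
  · have hz : ∀ α, v α i = 0 := by
      intro α
      have := (Finset.sum_eq_zero_iff_of_nonneg (fun α _ => by positivity)).mp (hAd.symm.trans h0.symm) α (Finset.mem_univ _)
      simpa using this
    have : {x : ι ⊕ ι → ℝ | R < ‖uu v x i‖} = ∅ := by
      ext x; simp [uu, hz, hR0.le]
    rw [this]; simp; positivity
  · set c1 : ι ⊕ ι → ℝ := Sum.elim (fun α => (v α i).re) (fun α => (v α i).im) with hc1
    set c2 : ι ⊕ ι → ℝ := Sum.elim (fun α => (v α i).im) (fun α => -(v α i).re) with hc2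
    have s1 : ∑ k, c1 k ^ 2 = A := by
      rw [Fintype.sum_sum_type, ← Finset.sum_add_distrib, hAd]
      exact Finset.sum_congr rfl fun α _ => by simp [hc1, nsq]
    have s2 : ∑ k, c2 k ^ 2 = A := by
      rw [Fintype.sum_sum_type, ← Finset.sum_add_distrib, hAd]
      exact Finset.sum_congr rfl fun α _ => by simp [hc2, nsq]; ring
    have s3 : ∑ k, (-c1 k) ^ 2 = A := by simpa using s1
    have s4 : ∑ k, (-c2 k) ^ 2 = A := by simpa using s2
    set ρ := R / √2 with hρd
    have hρ0 : 0 < ρ := by positivity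
    have hρ2 : ρ ^ 2 = R ^ 2 / 2 := by rw [hρd, div_pow, Real.sq_sqrt (by norm_num)]
    have hb : Real.exp (-(ρ ^ 2 / (2 * A))) ≤ A * Real.exp (-(R ^ 2 / 4)) := by
      have := exp_ineq A (R ^ 2 / 4) hpos hA1 (by linarith)
      rw [hρ2]
      convert this using 3
      field_simp
      try norm_num
    have t1 := (G_tail c1 A ρ hρ0.le s1 hpos).trans hb
    have t2 := (G_tail c2 A ρ hρ0.le s2 hpos).trans hb
    have t3 := (G_tail (fun k => -c1 k) A ρ hρ0.le s3 hpos).trans hb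
    have t4 := (G_tail (fun k => -c2 k) A ρ hρ0.le s4 hpos).trans hb
    have hsub : {x : ι ⊕ ι → ℝ | R < ‖uu v x i‖} ⊆
        (({x | ρ ≤ ∑ k, x k * c1 k} ∪ {x | ρ ≤ ∑ k, x k * c2 k}) ∪
        ({x | ρ ≤ ∑ k, x k * (-c1 k)} ∪ {x | ρ ≤ ∑ k, x k * (-c2 k)})) := by
      intro x hx
      simp only [Set.mem_ofPred_eq, Set.mem_union] at hx ⊢
      have hx2 : R ^ 2 < ‖uu v x i‖ ^ 2 := by gcongr
      rw [nsq] at hx2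
      simp only [mul_neg, Finset.sum_neg_distrib]
      rw [← uu_re, ← uu_im]
      by_contra hcon
      push Not at hcon
      obtain ⟨⟨h1, h2⟩, h3, h4⟩ := hcon
      have := abs_lt.mpr ⟨by linarith, h1⟩
      have := abs_lt.mpr ⟨by linarith, h2⟩
      have := sq_lt_sq' (by linarith) h1
      have := sq_lt_sq' (by linarith) h2
      linarith
    refine (measureReal_mono hsub).trans ?_
    refine (measureReal_union_le _ _).trans ?_
    have u1 := measureReal_union_le (μ := G (ι ⊕ ι)) {x | ρ ≤ ∑ k, x k * c1 k} {x | ρ ≤ ∑ k, x k * c2 k}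
    have u2 := measureReal_union_le (μ := G (ι ⊕ ι)) {x | ρ ≤ ∑ k, x k * (-c1 k)} {x | ρ ≤ ∑ k, x k * (-c2 k)}
    linarith

lemma bad_all
    (hv : ∀ α β : ι, (∑ i, (starRingEnd ℂ) (v α i) * v β i) = if α = β then 1 else 0) (R : ℝ) (hR : 4 ≤ R ^ 2) (hR0 : 0 < R) :
    (G (ι ⊕ ι)).real {x | ∃ i, R < ‖uu v x i‖} ≤ 4 * Fintype.card ι * Real.exp (-(R ^ 2 / 4)) := by
  have : {x : ι ⊕ ι → ℝ | ∃ i, R < ‖uu v x i‖} = ⋃ i, {x | R < ‖uu v x i‖} := by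
    ext x; simp
  rw [this]
  refine (measureReal_iUnion_fintype_le _).trans ?_
  refine (Finset.sum_le_sum fun i _ => bad_one v hv R hR hR0 i).trans ?_
  rw [← Finset.sum_mul, ← Finset.mul_sum, a_sum v hv]
end

section
variable {ι J : Type} [Fintype ι] [DecidableEq ι] [Fintype J] (v : ι → J → ℂ)

lemma uu_cont (i : J) : Continuous (fun x : ι ⊕ ι → ℝ => uu v x i) := by
  unfold uu; fun_prop

/-- the quadratic form -/
def XX (b : J → ℂ) : ℝ := ∑ α, ‖∑ i, (starRingEnd ℂ) (b i) * v α i‖ ^ 2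

lemma XX_cont : Continuous (XX v) := by
  unfold XX; fun_prop

lemma laplace_eq (ν : Measure ℂ) [IsProbabilityMeasure ν] (t : ℝ) :
    ((∫ b, Real.exp (-(t ^ 2 * XX v b / 2)) ∂(Measure.pi fun _ : J => ν) : ℝ) : ℂ)
      = ∫ x, ∏ i, charFun ν (t • uu v x i) ∂(G (ι ⊕ ι)) := by
  have e1 : ∀ b : J → ℂ, ((Real.exp (-(t ^ 2 * XX v b / 2)) : ℝ) : ℂ)
      = ∫ x, Complex.exp (((∑ i, inner ℝ (b i) (t • uu v x i) : ℝ) : ℂ) * Complex.I) ∂(G (ι ⊕ ι)) := by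
    intro b
    have h := G_char (κ := ι ⊕ ι) (fun k => t * Sum.elim
      (fun α => (∑ i, (starRingEnd ℂ) (b i) * v α i).re)
      (fun α => (∑ i, (starRingEnd ℂ) (b i) * v α i).im) k)
    have hX : ∑ k, (t * Sum.elim
      (fun α => (∑ i, (starRingEnd ℂ) (b i) * v α i).re)
      (fun α => (∑ i, (starRingEnd ℂ) (b i) * v α i).im) k) ^ 2 = t ^ 2 * XX v b := by
      rw [Fintype.sum_sum_type, ← Finset.sum_add_distrib, XX, Finset.mul_sum]
      refine Finset.sum_congr rfl fun α _ => ?_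
      rw [nsq]
      simp only [Sum.elim_inl, Sum.elim_inr]
      ring
    rw [hX, neg_div] at h
    rw [← h]
    refine integral_congr_ae (ae_of_all _ fun x => ?_)
    simp only [real_inner_smul_right]
    rw [← Finset.mul_sum, uu_inner, Finset.mul_sum]
    congr 4
    funext k
    ring
  rw [← integral_complex_ofReal]
  simp only [e1]
  rw [integral_integral_swap]
  · refine integral_congr_ae (ae_of_all _ fun x => ?_)
    have e2 : ∀ b : J → ℂ, Complex.exp (((∑ i, inner ℝ (b i) (t • uu v x i) : ℝ) : ℂ) * Complex.I)
        = ∏ i, Complex.exp (((inner ℝ (b i) (t • uu v x i) : ℝ) : ℂ) * Complex.I) := by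
      intro b
      rw [← Complex.exp_sum]; push_cast; rw [Finset.sum_mul]
    simp only [e2]
    rw [integral_fintype_prod_eq_prod (𝕜 := ℂ)
      (fun i (z : ℂ) => Complex.exp (((inner ℝ z (t • uu v x i) : ℝ) : ℂ) * Complex.I))]
    simp only [← charFun_apply]
  · refine (integrable_const (1 : ℝ)).mono' ?_ (ae_of_all _ fun p => ?_)
    · apply Continuous.aestronglyMeasurable
      unfold Function.uncurry uu
      fun_prop
    · unfold Function.uncurry
      rw [Complex.norm_exp_ofReal_mul_I]

lemma laplace_le
    (hv : ∀ α β : ι, (∑ i, (starRingEnd ℂ) (v α i) * v β i) = if α = β then 1 else 0)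
    (ν : Measure ℂ) [IsProbabilityMeasure ν] (t r : ℝ) (ht : 0 < t) (hr : 0 < r) (htr : 4 * t ^ 2 ≤ r ^ 2)
    (hφ : ∀ w : ℂ, ‖w‖ ≤ r → ‖charFun ν w‖ ≤ Real.exp (-(11 / 48) * ‖w‖ ^ 2)) :
    (∫ b, Real.exp (-(t ^ 2 * XX v b / 2)) ∂(Measure.pi fun _ : J => ν))
      ≤ Real.exp ((-(11 / 48 * t ^ 2) + (11 / 48 * t ^ 2) ^ 2) * (2 * Fintype.card ι))
        + 4 * Fintype.card ι * Real.exp (-(r ^ 2 / (4 * t ^ 2))) := by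
  set B : Set (ι ⊕ ι → ℝ) := {x | ∃ i, r / t < ‖uu v x i‖} with hB
  have hBm : MeasurableSet B := by
    have : B = ⋃ i, {x | r / t < ‖uu v x i‖} := by
      ext x; simp [hB]
    rw [this]
    exact MeasurableSet.iUnion fun i =>
      measurableSet_lt measurable_const (uu_cont v i).norm.measurable
  have hbad := bad_all v hv (r / t) (by rw [div_pow, le_div_iff₀ (by positivity)]; exact htr) (by positivity)
  set L := ∫ b, Real.exp (-(t ^ 2 * XX v b / 2)) ∂(Measure.pi fun _ : J => ν) with hL
  have hL0 : 0 ≤ L := integral_nonneg fun _ => (Real.exp_pos _).le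
  have hLn : L = ‖∫ x, ∏ i, charFun ν (t • uu v x i) ∂(G (ι ⊕ ι))‖ := by
    rw [← laplace_eq, Complex.norm_real, Real.norm_of_nonneg hL0]
  rw [hLn]
  have i1 : Integrable (fun x : ι ⊕ ι → ℝ => Real.exp (-(11 / 48 * t ^ 2) * ∑ k, x k ^ 2)) (G (ι ⊕ ι)) := by
    refine (integrable_const (1 : ℝ)).mono' (by apply Continuous.aestronglyMeasurable; fun_prop)
      (ae_of_all _ fun x => ?_)
    rw [Real.norm_of_nonneg (Real.exp_pos _).le]
    apply Real.exp_le_one_iff.mpr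
    have : 0 ≤ ∑ k, x k ^ 2 := Finset.sum_nonneg fun _ _ => by positivity
    have : 0 ≤ t ^ 2 * ∑ k, x k ^ 2 := by positivity
    linarith
  have i2 : Integrable (B.indicator (fun _ => (1 : ℝ))) (G (ι ⊕ ι)) :=
    (integrable_const _).indicator hBm
  refine (norm_integral_le_of_norm_le (i1.add i2) (ae_of_all _ fun x => ?_)).trans ?_
  · rw [norm_prod]
    simp only [Pi.add_apply]
    by_cases hx : x ∈ B
    · rw [Set.indicator_of_mem hx]
      have : ∏ i, ‖charFun ν (t • uu v x i)‖ ≤ 1 :=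
        Finset.prod_le_one (fun _ _ => norm_nonneg _) fun _ _ => norm_charFun_le_one _
      have := Real.exp_pos (-(11 / 48 * t ^ 2) * ∑ k, x k ^ 2)
      linarith
    · rw [Set.indicator_of_notMem hx, add_zero]
      simp only [hB, Set.mem_ofPred_eq, not_exists, not_lt] at hx
      rw [← uu_norm v hv x]
      calc ∏ i, ‖charFun ν (t • uu v x i)‖
          ≤ ∏ i, Real.exp (-(11 / 48) * ‖t • uu v x i‖ ^ 2) := by
            refine Finset.prod_le_prod (fun _ _ => norm_nonneg _) fun i _ => hφ _ ?_
            rw [norm_smul, Real.norm_of_nonneg ht.le]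
            have := hx i
            rw [le_div_iff₀ ht] at this
            linarith
        _ = _ := by
            rw [← Real.exp_sum, Finset.mul_sum]
            congr 1
            refine Finset.sum_congr rfl fun i _ => ?_
            rw [norm_smul, Real.norm_of_nonneg ht.le]; ring
  · have hadd := integral_add i1 i2
    have hs := G_sq (κ := ι ⊕ ι) (11 / 48 * t ^ 2) (by positivity)
    rw [Fintype.card_sum] at hs
    have hi : ∫ x, B.indicator (fun _ => (1 : ℝ)) x ∂(G (ι ⊕ ι)) = (G (ι ⊕ ι)).real B := by
      rw [integral_indicator hBm]; simp
    simp only [Pi.add_apply]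
    rw [hadd, hi]
    refine add_le_add (hs.trans_eq ?_) (hbad.trans_eq ?_)
    · push_cast; ring_nf
    · congr 3; rw [div_pow]; field_simp
end

lemma final_num (r ε s : ℝ) (hr : 0 < r) (hr1 : r ≤ 1) (hε : ε = r ^ 4 / 20000) (hs : 1 ≤ s) :
    Real.exp (-(ε * s / 3)) + 4 * s ^ 2 * Real.exp (ε * s / 2 - r ^ 2 * s / (8 * ε))
      ≤ Real.exp (-(ε / 6 * s)) := by
  have hε0 : 0 < ε := by rw [hε]; positivity
  have hr4 : r ^ 4 ≤ 1 := pow_le_one₀ hr.le hr1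
  have hr42 : r ^ 4 ≤ r ^ 2 := by nlinarith [sq_nonneg r, pow_le_one₀ (n := 2) hr.le hr1]
  set q := ε * s / 6 with hq
  have hq0 : 0 < q := by positivity
  set K := r ^ 2 / (8 * ε) with hK
  have hKr : r ^ 2 * s / (8 * ε) = K * s := by rw [hK]; ring
  have hK0 : 0 < K := by positivity
  have hKε : 2 * ε ≤ K / 2 := by
    rw [hK, div_div, le_div_iff₀ (by positivity)]
    have : ε ≤ r ^ 2 / 20000 := by rw [hε]; gcongr
    have : ε ≤ 1 := by rw [hε]; linarith
    nlinarith
  have hKK : 24 ≤ ε * (K / 2) ^ 2 / 2 := by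
    have : ε * (K / 2) ^ 2 / 2 = r ^ 4 / (512 * ε) := by
      rw [hK]; field_simp; norm_num
    rw [this, le_div_iff₀ (by positivity), hε]
    nlinarith [pow_pos hr 4]
  have hexp : (K / 2 * s) ^ 2 / 2 ≤ Real.exp (K / 2 * s) := by
    have := Real.quadratic_le_exp_of_nonneg (x := K / 2 * s) (by positivity)
    have : 0 ≤ K / 2 * s := by positivity
    linarith
  -- 24 s ≤ ε e^{Ks/2}
  have h24 : 24 * s ≤ ε * Real.exp (K / 2 * s) := by
    calc 24 * s ≤ 24 * s ^ 2 := by nlinarith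
      _ ≤ (ε * (K / 2) ^ 2 / 2) * s ^ 2 := by gcongr
      _ = ε * ((K / 2 * s) ^ 2 / 2) := by ring
      _ ≤ _ := by gcongr
  have hE : 4 * s ^ 2 * Real.exp (-(K / 2 * s)) ≤ q := by
    rw [Real.exp_neg, hq, mul_inv_le_iff₀ (Real.exp_pos _)]
    nlinarith
  have hE2 : 4 * s ^ 2 * Real.exp (ε * s / 2 - K * s) ≤ q * Real.exp (-(2 * q)) := by
    calc 4 * s ^ 2 * Real.exp (ε * s / 2 - K * s)
        ≤ 4 * s ^ 2 * (Real.exp (-(K / 2 * s)) * Real.exp (-(2 * q))) := by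
          rw [← Real.exp_add]
          gcongr
          rw [hq]
          nlinarith
      _ = (4 * s ^ 2 * Real.exp (-(K / 2 * s))) * Real.exp (-(2 * q)) := by ring
      _ ≤ _ := by gcongr
  rw [hKr]
  have e1 : Real.exp (-(ε * s / 3)) = Real.exp (-(2 * q)) := by congr 1; rw [hq]; ring
  have e2 : Real.exp (-(ε / 6 * s)) = Real.exp q * Real.exp (-(2 * q)) := by
    rw [← Real.exp_add]; congr 1; rw [hq]; ring
  rw [e1, e2]
  have := Real.add_one_le_exp q
  nlinarith [Real.exp_pos (-(2 * q))]

lemma main_pi {ι J : Type} [Fintype ι] [DecidableEq ι] [Fintype J] (v : ι → J → ℂ)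
    (hv : ∀ α β : ι, (∑ i, (starRingEnd ℂ) (v α i) * v β i) = if α = β then 1 else 0)
    (ν : Measure ℂ) [IsProbabilityMeasure ν] (r ε : ℝ) (hr : 0 < r) (hr1 : r ≤ 1)
    (hε : ε = r ^ 4 / 20000) (δ : ℝ) (hδ : δ ≤ 1 / 2)
    (hφ : ∀ w : ℂ, ‖w‖ ≤ r → ‖charFun ν w‖ ≤ Real.exp (-(11 / 48) * ‖w‖ ^ 2)) :
    (Measure.pi fun _ : J => ν).real {b | XX v b ≤ δ * Fintype.card ι}
      ≤ Real.exp (-(ε / 6 * √(Fintype.card ι))) := by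
  rcases Nat.eq_zero_or_pos (Fintype.card ι) with h0 | hpos
  · rw [h0]; simp
  set m : ℝ := (Fintype.card ι : ℝ) with hm
  have hm1 : 1 ≤ m := by rw [hm]; exact_mod_cast hpos
  set s := √m with hsd
  have hs1 : 1 ≤ s := by rw [hsd]; exact Real.one_le_sqrt.mpr hm1
  have hs2 : s ^ 2 = m := Real.sq_sqrt (by linarith)
  have hr4 : r ^ 4 ≤ 1 := pow_le_one₀ hr.le hr1
  have hr42 : r ^ 4 ≤ r ^ 2 := by nlinarith [sq_nonneg r, pow_le_one₀ (n := 2) hr.le hr1]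
  have hε0 : 0 < ε := by rw [hε]; positivity
  set l := ε / s with hl
  have hl0 : 0 < l := by positivity
  have hlε : l ≤ ε := div_le_self hε0.le hs1
  set t := √(2 * l) with htd
  have ht0 : 0 < t := by positivity
  have ht2 : t ^ 2 = 2 * l := Real.sq_sqrt (by positivity)
  have hlap := laplace_le v hv ν t r ht0 hr (by rw [ht2]; linarith) hφ
  rw [ht2, ← hm] at hlap
  set Q := (Measure.pi fun _ : J => ν)
  have hint : Integrable (fun b => Real.exp (-(2 * l * XX v b / 2))) Q := by
    refine (integrable_const (1 : ℝ)).mono' ?_ (ae_of_all _ fun x => ?_)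
    · apply Continuous.aestronglyMeasurable
      have := XX_cont v
      fun_prop
    · rw [Real.norm_of_nonneg (Real.exp_pos _).le]
      apply Real.exp_le_one_iff.mpr
      have : 0 ≤ XX v x := Finset.sum_nonneg fun _ _ => by positivity
      have : 0 ≤ l * XX v x := by positivity
      linarith
  have hmk := mul_meas_ge_le_integral_of_nonneg (ae_of_all _ fun b => (Real.exp_pos _).le) hint
    (Real.exp (-(l * m / 2)))
  have hsub : {b | XX v b ≤ δ * m} ⊆ {b | Real.exp (-(l * m / 2)) ≤ Real.exp (-(2 * l * XX v b / 2))} := by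
    intro b hb
    simp only [Set.mem_ofPred_eq] at hb ⊢
    apply Real.exp_le_exp.mpr
    have : XX v b ≤ m / 2 := by nlinarith
    nlinarith
  have h1 : Q.real {b | XX v b ≤ δ * m} ≤ Real.exp (l * m / 2) *
      (Real.exp ((-(11 / 48 * (2 * l)) + (11 / 48 * (2 * l)) ^ 2) * (2 * m))
        + 4 * m * Real.exp (-(r ^ 2 / (4 * (2 * l))))) := by
    have h2 := (mul_le_mul_of_nonneg_left (measureReal_mono (μ := Q) hsub) (Real.exp_pos (-(l * m / 2))).le).trans
      (hmk.trans hlap)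
    rw [Real.exp_neg] at h2
    rwa [inv_mul_le_iff₀ (Real.exp_pos _)] at h2
  refine h1.trans ((le_of_eq_of_le (b := Real.exp (l * m / 2) *
    Real.exp ((-(11 / 48 * (2 * l)) + (11 / 48 * (2 * l)) ^ 2) * (2 * m)) + _) ?_
    (add_le_add ?_ le_rfl)).trans (final_num r ε s hr hr1 hε hs1))
  · rw [mul_add]
    congr 1
    rw [← hs2]
    have a1 : l * s ^ 2 / 2 = ε * s / 2 := by rw [hl]; field_simp
    have a2 : r ^ 2 / (4 * (2 * l)) = r ^ 2 * s / (8 * ε) := by rw [hl]; field_simp; norm_num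
    rw [a1, a2, sub_eq_add_neg, Real.exp_add]; ring
  · rw [← Real.exp_add]
    apply Real.exp_le_exp.mpr
    have a1 : ε * s = l * m := by rw [hl, ← hs2]; field_simp
    rw [a1]
    have : ε ≤ 1 / 20000 := by rw [hε]; linarith
    have hl1 : l * (l * m) ≤ 1 / 20000 * (l * m) := by
      gcongr; linarith
    nlinarith

end S16

/-- **Lower tail for sums of the overlaps `ξ_α = |b ⋅ v_α|²` (Lemma `lm:bour`).** -/
theorem stmt_16 :
    ∀ δ₀ D δ : ℝ, 0 < δ₀ → 0 < δ → δ ≤ 1 / 2 →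
    ∃ c : ℝ, 0 < c ∧
    ∀ (N : ℕ) (Ω : Type) (_ : MeasurableSpace Ω) (P : Measure Ω)
      (bvec : Ω → Fin (N - 1) → ℂ) (ν : Measure ℂ)
      (ι : Type) [Fintype ι] [DecidableEq ι] (v : ι → Fin (N - 1) → ℂ),
      IsProbabilityMeasure P →
      IsProbabilityMeasure ν →
      (∫⁻ z, ENNReal.ofReal (Real.exp (δ₀ * ‖z‖ ^ 2)) ∂ν) ≤ ENNReal.ofReal D →
      (∫ z, z ∂ν) = 0 →
      (∫ z, ‖z‖ ^ 2 ∂ν) = 1 →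
      ComplexSymm ν →
      (∀ i, P.map (fun ω => bvec ω i) = ν) →
      iIndepFun (fun (i : Fin (N - 1)) (ω : Ω) => bvec ω i) P →
      (∀ α β : ι, (∑ i, (starRingEnd ℂ) (v α i) * v β i) = if α = β then 1 else 0) →
        P {ω | (∑ α : ι, ‖∑ i, (starRingEnd ℂ) (bvec ω i) * v α i‖ ^ 2)
            ≤ δ * (Fintype.card ι)}
          ≤ ENNReal.ofReal (Real.exp (-(c * Real.sqrt (Fintype.card ι)))) := by
  intro δ₀ D δ h0 hδ hδ2
  set M := max 1 (S16.M3 δ₀ D) with hMd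
  have hM1 : 1 ≤ M := le_max_left _ _
  set r : ℝ := 1 / (192 * M) with hr
  have hr0 : 0 < r := by positivity
  have hr1 : r ≤ 1 := by
    rw [hr, div_le_one (by positivity)]; linarith
  have hMr : 4 * M * r = 1 / 48 := by rw [hr]; field_simp; norm_num
  refine ⟨r ^ 4 / 20000 / 6, by positivity, ?_⟩
  intro N Ω _ P bvec ν ι _ _ v hP hν hD hmean hvar hsym hlaw hind hv
  have hφ : ∀ w : ℂ, ‖w‖ ≤ r → ‖charFun ν w‖ ≤ Real.exp (-(11 / 48) * ‖w‖ ^ 2) := by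
    intro w hw
    refine S16.charFun_bd h0 ν hD hmean hvar hsym w (hw.trans hr1) ?_
    rw [← hMr]
    have : S16.M3 δ₀ D ≤ M := le_max_right _ _
    gcongr
  have hmeas : ∀ i, AEMeasurable (fun ω => bvec ω i) P := by
    intro i
    by_contra hn
    have h := hlaw i
    rw [Measure.map_of_not_aemeasurable hn] at h
    exact (IsProbabilityMeasure.ne_zero ν) h.symm
  have hpi := (iIndepFun_iff_map_fun_eq_pi_map hmeas).mp hind
  simp only [hlaw] at hpi
  have hmain := S16.main_pi v hv ν r (r ^ 4 / 20000) hr0 hr1 rfl δ hδ2 hφ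
  have hset : MeasurableSet {b | S16.XX v b ≤ δ * Fintype.card ι} :=
    measurableSet_le (S16.XX_cont v).measurable measurable_const
  have hb : AEMeasurable (fun ω i => bvec ω i) P := aemeasurable_pi_lambda _ hmeas
  have heq : P {ω | (∑ α : ι, ‖∑ i, (starRingEnd ℂ) (bvec ω i) * v α i‖ ^ 2)
            ≤ δ * (Fintype.card ι)} =
      (Measure.pi fun _ : Fin (N - 1) => ν) {b | S16.XX v b ≤ δ * Fintype.card ι} := by
    rw [← hpi, Measure.map_apply_of_aemeasurable hb hset]
    rfl
  rw [heq, ← ofReal_measureReal]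
  exact ENNReal.ofReal_le_ofReal hmain

end
end
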